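/- arXiv:1504.04886 — 2 statements merged into one kernel-verified Lean document; each statement's English description precedes it below -/
import Mathlib

section
/- Let R be a finitely generated subring of ℂ and F its field of fractions. Let S be an associative unital R-algebra with the generic freeness property: for every finitely generated left S-module M there exists a nonzero f ∈ R such that the localization M_f is a free R_f-module. Assume that for every nonzero f ∈ R and every natural number N there exist a prime number q > max(N, 2), an algebraically closed field 𝕜 of characteristic q, and a ring homomorphism ρ : R_f → W(𝕜) such that, writing A := S ⊗_R 𝕜 (with 𝕜 an R-algebra via R → R_f →ρ W(𝕜) → 𝕜) and Ã := S ⊗_R W(𝕜): (a) Ã has no q-torsion; (b) the center Z of A is a finitely generated, formally smooth 𝕜-algebra and an integral domain; (c) A is an Azumaya algebra over Z; (d) Z carries a symplectic Poisson structure {·,·} such that for all z, w ∈ Z and all lifts z̃, w̃ ∈ Ã of z, w under Ã → A, there exists c ∈ Ã with q·c = z̃w̃ − w̃z̃ whose image in A equals {z, w}. Then the F-algebra S ⊗_R F is simple: its only two-sided ideals are 0 and the whole ring. -/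
universe u

set_option maxHeartbeats 1000000
set_option synthInstance.maxHeartbeats 400000

open scoped TensorProduct

/-- A symplectic Poisson structure on a commutative `k`-algebra `S`. -/
structure SymplecticPoisson (k S : Type u) [CommRing k] [CommRing S] [Algebra k S] where
  bracket : S → S → S
  add_left : ∀ x y z : S, bracket (x + y) z = bracket x z + bracket y z
  smul_left : ∀ (c : k) (x z : S), bracket (c • x) z = c • bracket x z
  antisymm : ∀ x y : S, bracket x y = - bracket y x
  leibniz : ∀ x y z : S, bracket x (y * z) = bracket x y * z + y * bracket x z
  jacobi : ∀ x y z : S,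
    bracket x (bracket y z) + bracket y (bracket z x) + bracket z (bracket x y) = 0
  nondeg : ∃ ι : KaehlerDifferential k S ≃ₗ[S] Derivation k S S,
    ∀ f g x : S, ι (g • KaehlerDifferential.D k S f) x = g * bracket f x

/-- The natural map `A ⊗[S] Aᵐᵒᵖ → End_S(A)`, `a ⊗ b ↦ (x ↦ a·x·b)`. -/
noncomputable def mulLeftRightMap (S : Type u) (A : Type*) [CommRing S] [Ring A]
    [Algebra S A] : A ⊗[S] Aᵐᵒᵖ →ₗ[S] Module.End S A :=
  TensorProduct.lift <| LinearMap.mk₂ S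
    (fun a b => (LinearMap.mulRight S b.unop) ∘ₗ (LinearMap.mulLeft S a))
    (fun a₁ a₂ b => by ext x; simp [add_mul])
    (fun s a b => by ext x; simp [smul_mul_assoc])
    (fun a b₁ b₂ => by ext x; simp [mul_add])
    (fun s a b => by ext x; simp [mul_smul_comm])

/-- The center of an algebra acts centrally, making `A` an algebra over its center. -/
noncomputable instance centerAlgebra (k A : Type*) [CommSemiring k] [Semiring A] [Algebra k A] :
    Algebra (Subalgebra.center k A) A :=
  RingHom.toAlgebra' (Subalgebra.center k A).val.toRingHom
    (fun z a => (Subalgebra.mem_center_iff.mp z.2 a).symm)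

/-- `A` is an Azumaya algebra over `S`. -/
def IsAzumayaOver (S : Type u) (A : Type*) [CommRing S] [Ring A] [Algebra S A] : Prop :=
  Module.Finite S A ∧ Module.Projective S A ∧ FaithfulSMul S A ∧
    Function.Bijective (mulLeftRightMap S A)

/-- The good-reduction condition at `f ∈ R` and the prime `q`: there is a homomorphism
`ρ : R_f → W(𝕜)` such that, for `A = 𝕜 ⊗_R S` and `Ã = W(𝕜) ⊗_R S` (where `𝕜` is an
`R`-algebra via `R → R_f → W(𝕜) → 𝕜`): `Ã` has no `q`-torsion; the center `Z` of `A` is a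
finitely generated formally smooth `𝕜`-algebra and a domain; `A` is Azumaya over `Z`; and
`Z` carries a symplectic Poisson structure which is the deformation bracket, i.e. commutators
of lifts to `Ã` divided by `q` reduce to the bracket. -/
def QuantCond (R : Type) [CommRing R] (S : Type) [Ring S] [Algebra R S]
    (f : R) (q : ℕ) [Fact q.Prime]
    (𝕜 : Type) [Field 𝕜] [IsAlgClosed 𝕜] [CharP 𝕜 q] : Prop :=
  ∃ (ρ : Localization.Away f →+* WittVector q 𝕜) (σ : WittVector q 𝕜 →+* 𝕜),
    (∀ w : WittVector q 𝕜, σ w = w.coeff 0) ∧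
    (letI : Algebra R 𝕜 :=
      ((σ.comp ρ).comp (algebraMap R (Localization.Away f))).toAlgebra
     letI : Algebra R (WittVector q 𝕜) :=
      (ρ.comp (algebraMap R (Localization.Away f))).toAlgebra
     (∀ x : WittVector q 𝕜 ⊗[R] S, (q : WittVector q 𝕜 ⊗[R] S) * x = 0 → x = 0) ∧
     Algebra.FiniteType 𝕜 (Subalgebra.center 𝕜 (𝕜 ⊗[R] S)) ∧
     Algebra.FormallySmooth 𝕜 (Subalgebra.center 𝕜 (𝕜 ⊗[R] S)) ∧
     IsDomain (Subalgebra.center 𝕜 (𝕜 ⊗[R] S)) ∧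
     IsAzumayaOver (Subalgebra.center 𝕜 (𝕜 ⊗[R] S)) (𝕜 ⊗[R] S) ∧
     ∃ P : SymplecticPoisson 𝕜 (Subalgebra.center 𝕜 (𝕜 ⊗[R] S)),
       ∃ τ : (WittVector q 𝕜 ⊗[R] S) →+* (𝕜 ⊗[R] S),
         (∀ (w : WittVector q 𝕜) (s : S), τ (w ⊗ₜ[R] s) = σ w ⊗ₜ[R] s) ∧
         ∀ (z w : Subalgebra.center 𝕜 (𝕜 ⊗[R] S)) (zt wt : WittVector q 𝕜 ⊗[R] S),
           τ zt = ↑z → τ wt = ↑w →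
           ∃ c : WittVector q 𝕜 ⊗[R] S,
             (q : WittVector q 𝕜 ⊗[R] S) * c = zt * wt - wt * zt ∧
             τ c = ↑(P.bracket z w))

section Coordinates

variable {k O : Type*} [Field k] [CommRing O] [Algebra k O]

lemma Derivation.iterate_pow_mul_of_apply_eq_one (D : Derivation k O O) {x : O} (hx : D x = 1)
    (b : ℕ) : ∀ c : O, D c = 0 → D^[b] (x ^ b * c) = (b.factorial : O) * c := by
  induction b with
  | zero => intro c _; simp
  | succ b ih =>
    intro c hc
    have h : D (x ^ (b + 1) * c) = x ^ b * (((b + 1 : ℕ) : O) * c) := by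
      rw [D.leibniz, hc, D.leibniz_pow, hx]
      simp only [smul_zero, zero_add, Nat.add_sub_cancel, smul_eq_mul, nsmul_eq_mul]
      ring
    rw [Function.iterate_succ_apply, h, ih _ (by rw [D.leibniz, hc, D.map_natCast]; simp),
      Nat.factorial_succ]
    push_cast; ring

lemma CharP.exists_mul_factorial_eq_one (q : ℕ) [Fact q.Prime] [CharP k q] {b : ℕ} (hb : b < q) :
    ∃ e : k, algebraMap k O e * (b.factorial : O) = 1 := by
  have h : (b.factorial : k) ≠ 0 := by
    rw [Ne, CharP.cast_eq_zero_iff k q, (Fact.out : q.Prime).dvd_factorial]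
    omega
  refine ⟨(b.factorial : k)⁻¹, ?_⟩
  rw [← map_natCast (algebraMap k O), ← map_mul, inv_mul_cancel₀ h, map_one]

lemma Derivation.iterate_mem {D : Derivation k O O} {Q : Ideal O} (hQ : ∀ z ∈ Q, D z ∈ Q)
    {z : O} (hz : z ∈ Q) (b : ℕ) : D^[b] z ∈ Q := by
  induction b with
  | zero => exact hz
  | succ b ih => rw [Function.iterate_succ_apply']; exact hQ _ ih

lemma Derivation.iterate_comm_apply_eq_zero {D E : Derivation k O O}
    (h : ∀ y, E (D y) = D (E y)) {z : O} (hz : E z = 0) (b : ℕ) : E (D^[b] z) = 0 := by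
  induction b with
  | zero => exact hz
  | succ b ih => rw [Function.iterate_succ_apply', h, ih, map_zero]

lemma Derivation.iterate_sub_apply (D : Derivation k O O) (b : ℕ) (y z : O) :
    D^[b] (y - z) = D^[b] y - D^[b] z :=
  iterate_map_sub D b y z

/-- An element with derivative in a stable ideal is congruent to a constant. -/
lemma Derivation.exists_sub_mem_of_apply_mem (q : ℕ) [Fact q.Prime] [CharP k q]
    (D : Derivation k O O) {x : O} (hx : D x = 1) {Q : Ideal O} (hQ : ∀ z ∈ Q, D z ∈ Q)
    (b : ℕ) (hb : b ≤ q) : ∀ z : O, D^[b] z = 0 → D z ∈ Q → ∃ w, z - w ∈ Q ∧ D w = 0 ∧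
      ∀ E : Derivation k O O, (∀ y, E (D y) = D (E y)) → E x = 0 → E z = 0 → E w = 0 := by
  induction b with
  | zero =>
    intro z hz _
    exact ⟨0, by simp_all, by simp, by simp⟩
  | succ b ih =>
    intro z hz hDz
    rcases Nat.eq_zero_or_pos b with rfl | hb0
    · exact ⟨z, by simp, by simpa using hz, fun E _ _ h => h⟩
    obtain ⟨e, he⟩ := CharP.exists_mul_factorial_eq_one (k := k) (O := O) q (b := b) (by omega)
    have hc : D (D^[b] z) = 0 := by rwa [← Function.iterate_succ_apply' (f := D)]
    have hcQ : D^[b] z ∈ Q := by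
      obtain ⟨b, rfl⟩ : ∃ m, b = m + 1 := ⟨b - 1, by omega⟩
      rw [Function.iterate_succ_apply]
      exact D.iterate_mem hQ hDz b
    have hc' : D (algebraMap k O e * D^[b] z) = 0 := by
      rw [D.leibniz, hc, D.map_algebraMap]; simp
    have hsQ : x ^ b * (algebraMap k O e * D^[b] z) ∈ Q :=
      Q.mul_mem_left _ (Q.mul_mem_left _ hcQ)
    obtain ⟨w, hw, hDw, hE⟩ := ih (by omega) (z - x ^ b * (algebraMap k O e * D^[b] z))
      (by
        rw [D.iterate_sub_apply, D.iterate_pow_mul_of_apply_eq_one hx b _ hc', ← mul_assoc,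
          mul_comm (b.factorial : O), he, one_mul, sub_self])
      (by rw [map_sub]; exact Q.sub_mem hDz (hQ _ hsQ))
    refine ⟨w, ?_, hDw, fun E hED hEx hEz => hE E hED hEx ?_⟩
    · have := Q.add_mem hw hsQ
      convert this using 1; ring
    · rw [map_sub, hEz, E.leibniz, E.leibniz, D.iterate_comm_apply_eq_zero hED hEz, E.leibniz_pow,
        hEx, E.map_algebraMap]
      simp

/-- Local coordinates with dual commuting derivations of order `q`. -/
structure DualCoordinates (k O : Type*) [Field k] [CommRing O] [Algebra k O] (q : ℕ)
    (ι : Type*) where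
  coord : ι → O
  partialD : ι → Derivation k O O
  partialD_self : ∀ i, partialD i (coord i) = 1
  partialD_of_ne : ∀ i j, i ≠ j → partialD j (coord i) = 0
  partialD_comm : ∀ i j y, partialD i (partialD j y) = partialD j (partialD i y)
  partialD_iterate : ∀ i y, (partialD i)^[q] y = 0

namespace DualCoordinates

variable {q : ℕ} [Fact q.Prime] [CharP k q] {ι : Type*} (X : DualCoordinates k O q ι)

/-- If all derivatives of `z` lie in a stable ideal, `z` is congruent to a constant. -/
lemma exists_sub_mem_of_forall_mem [Fintype ι] {Q : Ideal O}
    (hQ : ∀ i, ∀ z ∈ Q, X.partialD i z ∈ Q) {z : O} (hz : ∀ i, X.partialD i z ∈ Q) :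
    ∃ w, z - w ∈ Q ∧ ∀ i, X.partialD i w = 0 := by
  classical
  suffices H : ∀ t : Finset ι, ∃ w, z - w ∈ Q ∧ ∀ i ∈ t, X.partialD i w = 0 by
    obtain ⟨w, h1, h2⟩ := H Finset.univ
    exact ⟨w, h1, fun i => h2 i (Finset.mem_univ i)⟩
  intro t
  induction t using Finset.induction_on with
  | empty => exact ⟨z, by simp, by simp⟩
  | insert j t hj ih =>
    obtain ⟨w, hw, hwt⟩ := ih
    have hjw : X.partialD j w ∈ Q := by
      have := Q.sub_mem (hz j) (hQ j _ hw)
      rwa [map_sub, sub_sub_cancel] at this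
    obtain ⟨v, hv, hDv, hE⟩ := (X.partialD j).exists_sub_mem_of_apply_mem q (X.partialD_self j)
      (hQ j) q le_rfl w (X.partialD_iterate j w) hjw
    refine ⟨v, by simpa using Q.add_mem hw hv, fun i hi => ?_⟩
    rcases Finset.mem_insert.mp hi with rfl | hi
    · exact hDv
    · have hij : j ≠ i := fun h => hj (h ▸ hi)
      exact hE _ (X.partialD_comm i j) (X.partialD_of_ne j i hij) (hwt i hi)

/-- A stable ideal is generated by its constants. -/
lemma mem_span_constants [Fintype ι] {Q : Ideal O}
    (hQ : ∀ i, ∀ z ∈ Q, X.partialD i z ∈ Q) {z : O} (hz : z ∈ Q) :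
    z ∈ Ideal.span {y | y ∈ Q ∧ ∀ i, X.partialD i y = 0} := by
  classical
  suffices H : ∀ t : Finset ι, ∀ z ∈ Q, (∀ i ∉ t, X.partialD i z = 0) →
      z ∈ Ideal.span {y | y ∈ Q ∧ ∀ i, X.partialD i y = 0} from
    H Finset.univ z hz (by simp)
  intro t
  induction t using Finset.induction_on with
  | empty => exact fun z hz h => Ideal.subset_span ⟨hz, fun i => h i (by simp)⟩
  | insert j t hj ih =>
    suffices H : ∀ b ≤ q, ∀ z ∈ Q, (X.partialD j)^[b] z = 0 →
        (∀ i ∉ insert j t, X.partialD i z = 0) →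
        z ∈ Ideal.span {y | y ∈ Q ∧ ∀ i, X.partialD i y = 0} from
      fun z hz h => H q le_rfl z hz (X.partialD_iterate j z) h
    intro b
    induction b with
    | zero => intro _ z _ hz _; rw [Function.iterate_zero_apply] at hz; rw [hz]; exact zero_mem _
    | succ b ihb =>
      intro hb z hz hDz hzt
      obtain ⟨e, he⟩ := CharP.exists_mul_factorial_eq_one (k := k) (O := O) q (b := b) (by omega)
      set c := (X.partialD j)^[b] z with hcdef
      have hc : X.partialD j c = 0 := by rwa [hcdef, ← Function.iterate_succ_apply' (f := X.partialD j)]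
      have hcQ : c ∈ Q := (X.partialD j).iterate_mem (hQ j) hz b
      have hct : ∀ i ∉ insert j t, X.partialD i c = 0 := fun i hi =>
        (X.partialD j).iterate_comm_apply_eq_zero (X.partialD_comm i j) (hzt i hi) b
      have hcs := ih c hcQ fun i hi => by
        by_cases hij : i = j
        · rw [hij, hc]
        · exact hct i (by simp [hij, hi])
      have hc' : X.partialD j (algebraMap k O e * c) = 0 := by
        rw [Derivation.leibniz, hc, Derivation.map_algebraMap]; simp
      have h := ihb (by omega) (z - X.coord j ^ b * (algebraMap k O e * c))
        (Q.sub_mem hz (Q.mul_mem_left _ (Q.mul_mem_left _ hcQ)))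
        (by
          rw [Derivation.iterate_sub_apply,
            (X.partialD j).iterate_pow_mul_of_apply_eq_one (X.partialD_self j) b _ hc', ← mul_assoc,
            mul_comm (b.factorial : O), he, one_mul, sub_self])
        (fun i hi => by
          have hij : j ≠ i := fun h => hi (by simp [h])
          rw [map_sub, hzt i hi, Derivation.leibniz, Derivation.leibniz, hct i hi,
            Derivation.leibniz_pow, X.partialD_of_ne j i hij, Derivation.map_algebraMap]
          simp)
      have := Ideal.add_mem _ h (Ideal.mul_mem_left _ (X.coord j ^ b)
        (Ideal.mul_mem_left _ (algebraMap k O e) hcs))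
      simpa using this

end DualCoordinates

end Coordinates

section Constants

variable {k O : Type*} [Field k] [CommRing O] [Algebra k O]

open Polynomial in
lemma Derivation.apply_eval_of_coeff (D : Derivation k O O) {x : O} (hx : D x = 1) (p : O[X])
    (hp : ∀ n, D (p.coeff n) = 0) : D (p.eval x) = p.derivative.eval x := by
  rw [eval_eq_sum_range, map_sum, derivative_eval, Polynomial.sum_over_range _ (by simp)]
  refine Finset.sum_congr rfl fun n _ => ?_
  rw [D.leibniz, hp, D.leibniz_pow, hx]
  simp only [smul_zero, add_zero, smul_eq_mul, nsmul_eq_mul]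
  ring

open Polynomial in
/-- Powers of a coordinate of exponent less than the characteristic are linearly independent
over the constants. -/
lemma Derivation.eq_zero_of_eval_eq_zero (q : ℕ) [Fact q.Prime] [CharP k q]
    (D : Derivation k O O) {x : O} (hx : D x = 1) (d : ℕ) : d < q → ∀ p : O[X],
    p.natDegree ≤ d → (∀ n, D (p.coeff n) = 0) → p.eval x = 0 → p = 0 := by
  induction d with
  | zero =>
    intro _ p hp _ hev
    rw [eq_C_of_natDegree_le_zero hp] at hev ⊢
    rw [eval_C] at hev
    rw [hev, C_0]
  | succ d ih =>
    intro hd p hp hc hev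
    have h0 : derivative p = 0 := by
      refine ih (by omega) _ ((natDegree_derivative_le p).trans (by omega)) (fun n => ?_) ?_
      · rw [coeff_derivative, D.leibniz, hc]
        have : D ((n : O) + 1) = 0 := by
          rw [map_add, D.map_natCast, D.map_one_eq_zero, add_zero]
        rw [this]; simp
      · rw [← D.apply_eval_of_coeff hx p hc, hev, map_zero]
    have hC : p = C (p.coeff 0) := by
      ext n
      rcases n with _ | n
      · simp
      rw [coeff_C_succ]
      by_cases hn : n + 1 ≤ d + 1
      · have h1 : p.coeff (n + 1) * ((n : O) + 1) = 0 := by rw [← coeff_derivative, h0, coeff_zero]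
        have h2 : ((n + 1 : ℕ) : k) ≠ 0 := by
          rw [Ne, CharP.cast_eq_zero_iff k q]
          exact fun h => absurd (Nat.le_of_dvd (by omega) h) (by omega)
        have h3 : algebraMap k O ((n + 1 : ℕ) : k)⁻¹ * ((n : O) + 1) = 1 := by
          have : ((n : O) + 1) = algebraMap k O ((n + 1 : ℕ) : k) := by simp
          rw [this, ← map_mul, inv_mul_cancel₀ h2, map_one]
        calc p.coeff (n + 1) = (algebraMap k O ((n + 1 : ℕ) : k)⁻¹ * ((n : O) + 1)) *
              p.coeff (n + 1) := by rw [h3, one_mul]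
          _ = algebraMap k O ((n + 1 : ℕ) : k)⁻¹ * (p.coeff (n + 1) * ((n : O) + 1)) := by ring
          _ = 0 := by rw [h1, mul_zero]
      · exact coeff_eq_zero_of_natDegree_lt (by omega)
    rw [hC] at hev ⊢
    rw [eval_C] at hev
    rw [hev, C_0]

lemma Derivation.apply_pow_char (q : ℕ) [CharP O q] (D : Derivation k O O) (a : O) :
    D (a ^ q) = 0 := by
  rw [D.leibniz_pow, nsmul_eq_mul, CharP.cast_eq_zero, zero_mul]

namespace DualCoordinates

variable [Nontrivial O] {q : ℕ} [Fact q.Prime] [CharP k q] [CharP O q] {ι : Type*} (X : DualCoordinates k O q ι)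

open Polynomial in
lemma mem_frobenius_range_of_mem_adjoin (t : Finset ι) :
    ∀ z ∈ Algebra.adjoin (frobenius O q).range (X.coord '' t), (∀ i ∈ t, X.partialD i z = 0) →
      z ∈ (frobenius O q).range := by
  classical
  induction t using Finset.induction_on with
  | empty =>
    intro z hz _
    rw [Finset.coe_empty, Set.image_empty, Algebra.adjoin_empty, Algebra.mem_bot] at hz
    obtain ⟨y, rfl⟩ := hz
    exact y.2
  | insert j t hj ih =>
    intro z hz hD
    refine ih z ?_ fun i hi => hD i (Finset.mem_insert_of_mem hi)
    set S := Algebra.adjoin (frobenius O q).range (X.coord '' t) with hS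
    have hkill : ∀ y ∈ S, X.partialD j y = 0 := by
      intro y hy
      induction hy using Algebra.adjoin_induction with
      | mem y hy =>
        obtain ⟨i, hi, rfl⟩ := hy
        exact X.partialD_of_ne i j fun h => hj (h ▸ hi)
      | algebraMap r =>
        obtain ⟨a, ha⟩ := r.2
        change X.partialD j (r : O) = 0
        rw [← ha, frobenius_def, Derivation.apply_pow_char]
      | add a b _ _ ha hb => rw [map_add, ha, hb, add_zero]
      | mul a b _ _ ha hb => rw [Derivation.leibniz, ha, hb]; simp
    have hxq : X.coord j ^ q ∈ S :=
      S.algebraMap_mem ⟨frobenius O q (X.coord j), ⟨_, rfl⟩⟩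
    obtain ⟨p, rfl⟩ : ∃ p : S[X], aeval (X.coord j) p = z := by
      rw [Finset.coe_insert, Set.image_insert_eq, Set.insert_eq, Set.union_comm,
        Algebra.adjoin_union_eq_adjoin_adjoin] at hz
      have hz' : z ∈ Algebra.adjoin S {X.coord j} := hz
      rwa [Algebra.adjoin_singleton_eq_range_aeval] at hz'
    set g : S[X] := Polynomial.X ^ q - C ⟨_, hxq⟩ with hg
    have hq0 : q ≠ 0 := (Fact.out : q.Prime).ne_zero
    have hgm : g.Monic := monic_X_pow_sub_C _ hq0
    have hev : aeval (X.coord j) (p %ₘ g) = aeval (X.coord j) p := by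
      conv_rhs => rw [← modByMonic_add_div p g]
      rw [map_add, map_mul]
      have : aeval (X.coord j) g = 0 := by
        simp only [hg, aeval_def, eval₂_sub, eval₂_pow, eval₂_X, eval₂_C]
        exact sub_self _
      rw [this, zero_mul, add_zero]
    have hdeg : (p %ₘ g).natDegree < q := by
      have h1 : g.natDegree = q := natDegree_X_pow_sub_C
      have := natDegree_modByMonic_lt p hgm (fun h => by rw [h, natDegree_one] at h1; exact hq0 h1.symm)
      rwa [h1] at this
    rw [← hev] at hD ⊢
    set r := p %ₘ g
    have hmap : (r.map (algebraMap S O) - C (aeval (X.coord j) r)) = 0 := by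
      refine (X.partialD j).eq_zero_of_eval_eq_zero q (X.partialD_self j) (q - 1) (by omega) _
        ?_ (fun n => ?_) ?_
      · rw [natDegree_sub_C]
        exact (natDegree_map_le).trans (by omega)
      · rw [coeff_sub, map_sub, coeff_map, coeff_C]
        rw [show X.partialD j (algebraMap S O (r.coeff n)) = 0 from hkill _ (r.coeff n).2]
        split_ifs
        · rw [hD j (Finset.mem_insert_self _ _), sub_zero]
        · simp
      · rw [eval_sub, eval_C, eval_map_algebraMap, sub_self]
    have := congrArg (fun f => coeff f 0) hmap
    simp only [coeff_sub, coeff_map, coeff_C_zero, coeff_zero, sub_eq_zero] at this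
    rw [← this]
    exact (r.coeff 0).2

end DualCoordinates

end Constants

section CharacteristicPower

variable {k O : Type*} [CommRing k] [CommRing O] [Algebra k O]

open Finset Nat in
/-- The general Leibniz rule. -/
lemma Derivation.iterate_apply_mul (D : Derivation k O O) (n : ℕ) (a b : O) :
    D^[n] (a * b) = ∑ ij ∈ antidiagonal n, choose n ij.1 • (D^[ij.1] a * D^[ij.2] b) := by
  induction n with
  | zero => simp
  | succ n ih =>
    rw [sum_antidiagonal_choose_succ_nsmul (M := O) (fun i j => D^[i] a * D^[j] b) n]
    simp only [Function.iterate_succ_apply', ih, map_sum, map_nsmul, D.leibniz, smul_eq_mul,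
      smul_add, sum_add_distrib, add_right_inj]
    refine sum_congr rfl fun ⟨i, j⟩ hij ↦ ?_
    rw [n.choose_symm_of_eq_add (mem_antidiagonal.1 hij).symm, mul_comm]

open Finset Nat in
/-- In characteristic `q`, the `q`-th power of a derivation is a derivation. -/
def Derivation.charPow (q : ℕ) [Fact q.Prime] [CharP O q] (D : Derivation k O O) :
    Derivation k O O :=
  Derivation.mk' ((D : O →ₗ[k] O) ^ q) fun a b => by
    have hq : q.Prime := Fact.out
    simp only [Module.End.pow_apply, Derivation.coeFn_coe]
    obtain ⟨m, hm⟩ : ∃ m, q = m + 1 := ⟨q - 1, by have := hq.pos; omega⟩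
    rw [D.iterate_apply_mul, sum_antidiagonal_eq_sum_range_succ
      (fun i j => choose q i • (D^[i] a * D^[j] b)) q, sum_range_succ]
    conv_lhs => rw [show range q = range (m + 1) by rw [hm], sum_range_succ']
    rw [Finset.sum_eq_zero]
    · simp [mul_comm, add_comm]
    · intro i hi
      have h1 : q ∣ choose q (i + 1) :=
        hq.dvd_choose_self (by omega) (by have := mem_range.1 hi; omega)
      rw [nsmul_eq_mul, (CharP.cast_eq_zero_iff O q _).2 h1, zero_mul]

lemma Derivation.charPow_apply (q : ℕ) [Fact q.Prime] [CharP O q] (D : Derivation k O O) (z : O) :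
    D.charPow q z = D^[q] z := by
  change ((D : O →ₗ[k] O) ^ q) z = _
  rw [Module.End.pow_apply]; rfl

/-- A derivation vanishing on elements whose differentials span is zero. -/
lemma Derivation.eq_of_span_eq_top {M ι : Type*} [AddCommGroup M] [Module O M] [Module k M]
    [IsScalarTower k O M] {D E : Derivation k O M} {x : ι → O}
    (hx : Submodule.span O (Set.range fun i => KaehlerDifferential.D k O (x i)) = ⊤)
    (h : ∀ i, D (x i) = E (x i)) (y : O) : D y = E y := by
  have : D.liftKaehlerDifferential = E.liftKaehlerDifferential := by
    refine LinearMap.ext_on_range hx fun i => ?_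
    rw [Derivation.liftKaehlerDifferential_comp_D, Derivation.liftKaehlerDifferential_comp_D, h]
  rw [← D.liftKaehlerDifferential_comp_D, this, E.liftKaehlerDifferential_comp_D]

end CharacteristicPower

section LocalCoordinates

variable {k O : Type u} [Field k] [CommRing O] [Algebra k O]

/-- Differentials whose restrictions to the cotangent space vanish come from the square of the
maximal ideal. -/
lemma AlgHom.mem_ker_sq_of_D_mem (e : O →ₐ[k] k) {y : O} (hy : y ∈ RingHom.ker e)
    (h : KaehlerDifferential.D k O y ∈
      (RingHom.ker e) • (⊤ : Submodule O (Ω[O⁄k]))) : y ∈ (RingHom.ker e) ^ 2 := by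
  have hmem (a : O) : a - algebraMap k O (e a) ∈ RingHom.ker e := by
    rw [RingHom.mem_ker, map_sub, AlgHom.commutes]; exact sub_self _
  set I := RingHom.ker e with hI
  let δ : Derivation k O I.Cotangent := Derivation.mk'
    { toFun := fun a => I.toCotangent ⟨_, hmem a⟩
      map_add' := fun a b => by
        rw [← map_add]; congr 1; ext; simp only [map_add, Submodule.coe_add]; ring
      map_smul' := fun c a => by
        rw [RingHom.id_apply, ← IsScalarTower.algebraMap_smul O c (I.toCotangent _), ← map_smul]
        congr 1; ext
        simp [Algebra.smul_def, mul_sub] }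
    (fun a b => by
      simp only [LinearMap.coe_mk, AddHom.coe_mk]
      rw [← map_smul, ← map_smul, ← map_add, Ideal.toCotangent_eq]
      have := Ideal.mul_mem_mul (hmem a) (hmem b)
      rw [← pow_two, ← neg_mem_iff] at this
      convert this using 1
      simp only [map_mul, Submodule.coe_add, Submodule.coe_smul, smul_eq_mul]
      ring)
  have h1 : δ y ∈ I • (⊤ : Submodule O I.Cotangent) := by
    rw [← δ.liftKaehlerDifferential_comp_D]
    have := Submodule.mem_map_of_mem (f := δ.liftKaehlerDifferential) h
    rw [Submodule.map_smul''] at this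
    exact Submodule.smul_mono le_rfl le_top this
  have hbot : I • (⊤ : Submodule O I.Cotangent) ≤ ⊥ := Submodule.smul_le.2 fun r hr n _ => by
    obtain ⟨m, rfl⟩ := I.toCotangent_surjective n
    rw [← map_smul, Submodule.mem_bot, Ideal.toCotangent_eq_zero, pow_two]
    exact Ideal.mul_mem_mul hr m.2
  replace h1 := (Submodule.mem_bot O).1 (hbot h1)
  have h2 : δ y = I.toCotangent ⟨_, hmem y⟩ := rfl
  rw [h2, Ideal.toCotangent_eq_zero] at h1
  have h3 : e y = 0 := hy
  simpa [h3] using h1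

/-- A formally smooth local algebra essentially of finite type over a field, with rational
residue field, has coordinates generating the maximal ideal. -/
lemma exists_dualCoordinates [IsLocalRing O] [Algebra.EssFiniteType k O]
    [Algebra.FormallySmooth k O] (e : O →ₐ[k] k) (q : ℕ) [Fact q.Prime] [CharP k q] [CharP O q] :
    ∃ (ι : Type u) (_ : Fintype ι) (X : DualCoordinates k O q ι),
      Ideal.span (Set.range X.coord) = RingHom.ker e := by
  classical
  have hq : q.Prime := Fact.out
  have : IsNoetherianRing O := Algebra.EssFiniteType.isNoetherianRing k O
  have hspan : Submodule.span O (Set.range fun y : RingHom.ker e =>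
      KaehlerDifferential.D k O (y : O)) = ⊤ := by
    rw [eq_top_iff, ← KaehlerDifferential.span_range_derivation, Submodule.span_le]
    rintro _ ⟨a, rfl⟩
    refine Submodule.subset_span ⟨⟨a - algebraMap k O (e a), ?_⟩, ?_⟩
    · rw [RingHom.mem_ker, map_sub, AlgHom.commutes]; exact sub_self _
    · simp
  have : Module.FinitePresentation O (Ω[O⁄k]) := Module.finitePresentation_of_finite _ _
  obtain ⟨ι, a, b, hb⟩ := Module.exists_basis_of_span_of_flat _ hspan
  have : Fintype ι := @Fintype.ofFinite ι (Module.Finite.finite_basis b)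
  have hx : Submodule.span O (Set.range fun i => KaehlerDifferential.D k O (a i : O)) = ⊤ := by
    rw [← b.span_eq]; congr 2; ext i; rw [hb]
  let d (i : ι) : Derivation k O O := (b.coord i).compDer (KaehlerDifferential.D k O)
  have hd (i j : ι) : d i (a j) = if j = i then 1 else 0 := by
    change b.coord i (KaehlerDifferential.D k O (a j : O)) = _
    rw [← hb j]; simp [Finsupp.single_apply]
  refine ⟨ι, inferInstance, ⟨fun i => a i, d, fun i => by rw [hd, if_pos rfl],
    fun i j h => by rw [hd, if_neg h], fun i j y => ?_, fun i y => ?_⟩, ?_⟩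
  · have : ⁅d i, d j⁆ y = (0 : Derivation k O O) y :=
      Derivation.eq_of_span_eq_top hx (fun l => by
        rw [Derivation.commutator_apply, hd, hd]; split_ifs <;> simp) y
    rwa [Derivation.commutator_apply, Derivation.zero_apply, sub_eq_zero] at this
  · rw [← Derivation.charPow_apply]
    refine Derivation.eq_of_span_eq_top (E := 0) hx (fun l => ?_) y
    obtain ⟨m, hm⟩ : ∃ m, q = m + 2 := ⟨q - 2, by have := hq.two_le; omega⟩
    rw [Derivation.charPow_apply, Derivation.zero_apply]
    conv_lhs => rw [show (d i)^[q] = (d i)^[m + 2] by rw [hm]]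
    rw [Function.iterate_add_apply]
    have : (d i)^[2] (a l : O) = 0 := by
      change d i (d i (a l : O)) = 0
      rw [hd]; split_ifs <;> simp
    rw [this, iterate_map_zero]
  · change Ideal.span (Set.range fun i => (a i : O)) = _
    refine le_antisymm ?_ ?_
    · rw [Ideal.span_le]; rintro _ ⟨i, rfl⟩; exact (a i).2
    refine Submodule.le_of_le_smul_of_le_jacobson_bot (I := RingHom.ker e)
      (IsNoetherian.noetherian _) ?_ fun y hy => ?_
    · rw [IsLocalRing.jacobson_eq_maximalIdeal _ bot_ne_top]
      exact IsLocalRing.le_maximalIdeal (RingHom.ker_ne_top _)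
    have hs : ∑ i, d i y * (a i : O) ∈ Ideal.span (Set.range fun i => (a i : O)) :=
      Ideal.sum_mem _ fun i _ => Ideal.mul_mem_left _ _ (Ideal.subset_span ⟨i, rfl⟩)
    have hsk : ∑ i, d i y * (a i : O) ∈ RingHom.ker e :=
      Ideal.sum_mem _ fun i _ => Ideal.mul_mem_left _ _ (a i).2
    rw [smul_eq_mul, ← pow_two]
    rw [← add_sub_cancel (∑ i, d i y * (a i : O)) y]
    refine Submodule.add_mem_sup hs (AlgHom.mem_ker_sq_of_D_mem e (Ideal.sub_mem _ hy hsk) ?_)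
    have h1 : KaehlerDifferential.D k O y = ∑ i, d i y • KaehlerDifferential.D k O (a i : O) := by
      conv_lhs => rw [← b.sum_repr (KaehlerDifferential.D k O y)]
      exact Finset.sum_congr rfl fun i _ => by rw [hb]; rfl
    rw [map_sub, map_sum, h1, ← Finset.sum_sub_distrib]
    refine Submodule.sum_mem _ fun i _ => ?_
    rw [Derivation.leibniz, ← sub_sub, sub_self, zero_sub]
    exact Submodule.neg_mem _ (Submodule.smul_mem_smul (a i).2 trivial)

/-- Over a perfect field, a local algebra essentially of finite type with rational residue field
is generated over its `q`-th powers by generators of the maximal ideal. -/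
lemma adjoin_frobenius_range_eq_top [IsAlgClosed k] [IsLocalRing O] [Algebra.EssFiniteType k O]
    (e : O →ₐ[k] k) (q : ℕ) [Fact q.Prime] [CharP k q] [CharP O q] {s : Set O}
    (hs : Ideal.span s = RingHom.ker e) :
    Algebra.adjoin (frobenius O q).range s = ⊤ := by
  classical
  have hq : q.Prime := Fact.out
  have : IsNoetherianRing O := Algebra.EssFiniteType.isNoetherianRing k O
  have hk (c : k) : algebraMap k O c ∈ (frobenius O q).range := by
    obtain ⟨d, hd⟩ := IsAlgClosed.exists_pow_nat_eq c hq.pos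
    exact ⟨algebraMap k O d, by rw [frobenius_def, ← map_pow, hd]⟩
  have hfin : Module.Finite (frobenius O q).range O := by
    set σ := Algebra.EssFiniteType.finset k O
    have hint : ∀ x ∈ (σ : Set O), IsIntegral (frobenius O q).range x := fun x _ =>
      IsIntegral.of_pow hq.pos (isIntegral_algebraMap (x := (⟨x ^ q, x, rfl⟩ : (frobenius O q).range)))
    have htop : Algebra.adjoin (frobenius O q).range (σ : Set O) = ⊤ := by
      have hle : ∀ x ∈ Algebra.adjoin k (σ : Set O),
          x ∈ Algebra.adjoin (frobenius O q).range (σ : Set O) := by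
        intro x hx
        induction hx using Algebra.adjoin_induction with
        | mem x hx => exact Algebra.subset_adjoin hx
        | algebraMap c => exact Subalgebra.algebraMap_mem _ (⟨_, hk c⟩ : (frobenius O q).range)
        | add _ _ _ _ h1 h2 => exact add_mem h1 h2
        | mul _ _ _ _ h1 h2 => exact mul_mem h1 h2
      refine eq_top_iff.2 fun x _ => ?_
      obtain ⟨t, ht, htu, hxt⟩ := (Algebra.essFiniteType_cond_iff k O σ).mp
        Algebra.EssFiniteType.cond.choose_spec x
      obtain ⟨v, rfl⟩ := htu
      obtain ⟨m, hm⟩ : ∃ m, q = m + 1 := ⟨q - 1, by have := hq.pos; omega⟩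
      have h1 : x = (x * v) * (v : O) ^ m * ((v⁻¹ : Oˣ) : O) ^ q := by
        rw [mul_assoc x, ← pow_succ', ← hm, mul_assoc, ← mul_pow, Units.mul_inv, one_pow, mul_one]
      rw [h1]
      exact mul_mem (mul_mem (hle _ hxt) (pow_mem (hle _ ht) _))
        (Subalgebra.algebraMap_mem _ (⟨_, ((v⁻¹ : Oˣ) : O), rfl⟩ : (frobenius O q).range))
    have := fg_adjoin_of_finite (σ.finite_toSet) hint
    rw [htop] at this
    exact ⟨this⟩
  have : IsLocalRing (frobenius O q).range :=
    IsLocalRing.of_surjective' _ (frobenius O q).rangeRestrict_surjective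
  set N := Algebra.adjoin (frobenius O q).range s with hN
  have hbase : ∀ z : O, ∃ y ∈ N, z - y ∈ RingHom.ker e := fun z =>
    ⟨algebraMap k O (e z), N.algebraMap_mem (⟨_, hk _⟩ : (frobenius O q).range), by
      rw [RingHom.mem_ker, map_sub, AlgHom.commutes]; exact sub_self _⟩
  have hstep : ∀ n, ∀ z ∈ (RingHom.ker e) ^ n, ∃ y ∈ N, z - y ∈ (RingHom.ker e) ^ (n + 1) := by
    intro n
    induction n with
    | zero => intro z _; simpa using hbase z
    | succ n ih =>
      intro z hz
      have hgen : ∀ b ∈ Ideal.span s, ∀ a ∈ (RingHom.ker e) ^ n, ∃ y ∈ N,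
          a * b - y ∈ (RingHom.ker e) ^ (n + 1 + 1) := by
        intro b hb
        induction hb using Submodule.span_induction with
        | mem x hx =>
          intro a ha
          obtain ⟨y, hy, h⟩ := ih a ha
          refine ⟨y * x, mul_mem hy (Algebra.subset_adjoin hx), ?_⟩
          rw [← sub_mul, pow_succ _ (n + 1)]
          exact Ideal.mul_mem_mul h (hs ▸ Ideal.subset_span hx)
        | zero => exact fun a _ => ⟨0, zero_mem _, by simp⟩
        | add x y _ _ h1 h2 =>
          intro a ha
          obtain ⟨u, hu, hu'⟩ := h1 a ha
          obtain ⟨v, hv, hv'⟩ := h2 a ha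
          exact ⟨u + v, add_mem hu hv, by rw [mul_add, add_sub_add_comm]; exact add_mem hu' hv'⟩
        | smul c x _ h =>
          intro a ha
          obtain ⟨u, hu, hu'⟩ := h (a * c) (Ideal.mul_mem_right _ _ ha)
          exact ⟨u, hu, by rwa [smul_eq_mul, ← mul_assoc]⟩
      rw [pow_succ] at hz
      induction hz using Submodule.mul_induction_on' with
      | mem_mul_mem a ha b hb => exact hgen b (hs ▸ hb) a ha
      | add x _ y _ h1 h2 =>
        obtain ⟨u, hu, hu'⟩ := h1
        obtain ⟨v, hv, hv'⟩ := h2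
        exact ⟨u + v, add_mem hu hv, by rw [add_sub_add_comm]; exact add_mem hu' hv'⟩
  have hall : ∀ n, ∀ z : O, ∃ y ∈ N, z - y ∈ (RingHom.ker e) ^ n := by
    intro n
    induction n with
    | zero => exact fun z => ⟨0, zero_mem _, by simp⟩
    | succ n ih =>
      intro z
      obtain ⟨y, hy, h⟩ := ih z
      obtain ⟨y', hy', h'⟩ := hstep n _ h
      exact ⟨y + y', add_mem hy hy', by rwa [← sub_sub]⟩
  set m' := IsLocalRing.maximalIdeal (frobenius O q).range
  have hrad : RingHom.ker e ≤ (m'.map (algebraMap (frobenius O q).range O)).radical := by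
    intro x hx
    refine ⟨q, Ideal.mem_map_of_mem _ (x := (⟨x ^ q, x, rfl⟩ : (frobenius O q).range)) ?_⟩
    rw [IsLocalRing.mem_maximalIdeal, mem_nonunits_iff]
    intro hu
    have := hu.map (algebraMap (frobenius O q).range O)
    have h2 : IsUnit (x ^ q) := this
    have h3 := h2.map e
    rw [map_pow, (hx : e x = 0), zero_pow hq.ne_zero] at h3
    exact not_isUnit_zero h3
  obtain ⟨n, hn⟩ := Ideal.exists_pow_le_of_le_radical_of_fg hrad (IsNoetherian.noetherian _)
  have key : (⊤ : Submodule (frobenius O q).range O) ≤ Subalgebra.toSubmodule N := by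
    refine Submodule.le_of_le_smul_of_le_jacobson_bot (I := m') hfin.1
      (by rw [IsLocalRing.jacobson_eq_maximalIdeal _ bot_ne_top]) fun z _ => ?_
    obtain ⟨y, hy, h⟩ := hall n z
    rw [← add_sub_cancel y z]
    refine Submodule.add_mem_sup hy ?_
    rw [Ideal.smul_top_eq_map]
    exact hn h
  exact eq_top_iff.2 fun z _ => key trivial

end LocalCoordinates

section StableIdeals

variable {k Z : Type u} [Field k] [CommRing Z] [Algebra k Z]

/-- If all derivatives of `z` lie in `Q`, so do, up to extension, the values at `z` of derivations
into any algebra. -/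
lemma Derivation.mem_map_of_forall_mem [Algebra.FormallySmooth k Z] {O : Type*} [CommRing O]
    [Algebra Z O] [Algebra k O] [IsScalarTower k Z O] {Q : Ideal Z} {z : Z}
    (hz : ∀ D : Derivation k Z Z, D z ∈ Q) (E : Derivation k Z O) :
    E z ∈ Q.map (algebraMap Z O) := by
  obtain ⟨s, hs⟩ := (inferInstance : Module.Projective Z (Ω[Z⁄k])).out
  rw [← E.liftKaehlerDifferential_comp_D, ← hs (KaehlerDifferential.D k Z z),
    Finsupp.linearCombination_apply, Finsupp.sum, map_sum]
  refine Ideal.sum_mem _ fun w _ => ?_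
  rw [LinearMap.map_smul, Algebra.smul_def]
  refine Ideal.mul_mem_right _ _ (Ideal.mem_map_of_mem _ ?_)
  exact hz ((Finsupp.lapply w ∘ₗ s).compDer (KaehlerDifferential.D k Z))

/-- A finitely generated algebra over an algebraically closed field has a rational point at
each maximal ideal. -/
lemma exists_algHom_localization_atPrime [IsAlgClosed k] [Algebra.FiniteType k Z] (m : Ideal Z)
    [m.IsMaximal] : Nonempty (Localization.AtPrime m →ₐ[k] k) := by
  letI : Field (Z ⧸ m) := Ideal.Quotient.field m
  have : Algebra.FiniteType k (Z ⧸ m) :=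
    Algebra.FiniteType.of_surjective (Ideal.Quotient.mkₐ k m) (Ideal.Quotient.mkₐ_surjective k m)
  have : Module.Finite k (Z ⧸ m) := finite_of_finite_type_of_isJacobsonRing k (Z ⧸ m)
  let e : k ≃ₐ[k] (Z ⧸ m) := AlgEquiv.ofBijective (Algebra.ofId k (Z ⧸ m))
    (IsAlgClosed.algebraMap_bijective_of_isIntegral)
  refine ⟨IsLocalization.liftAlgHom (M := m.primeCompl)
    (f := (e.symm : (Z ⧸ m) →ₐ[k] k).comp (Ideal.Quotient.mkₐ k m)) fun y => ?_⟩
  rw [isUnit_iff_ne_zero]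
  intro h
  refine y.2 ?_
  have h' : e.symm (Ideal.Quotient.mk m y) = 0 := h
  rwa [map_eq_zero_iff _ e.symm.injective, Ideal.Quotient.eq_zero_iff_mem] at h'

variable [IsAlgClosed k] [Algebra.FiniteType k Z] [Algebra.FormallySmooth k Z] (q : ℕ)
  [Fact q.Prime] [CharP k q]

/-- The local structure at a maximal ideal: dual coordinates whose constants are `q`-th powers,
and which preserve extensions of stable ideals. -/
lemma exists_dualCoordinates_atPrime (m : Ideal Z) [m.IsMaximal] :
    ∃ (ι : Type u) (_ : Fintype ι) (X : DualCoordinates k (Localization.AtPrime m) q ι),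
      (∀ w, (∀ i, X.partialD i w = 0) → ∃ t, t ^ q = w) ∧
      (∀ (Q : Ideal Z) (z : Z), (∀ D : Derivation k Z Z, D z ∈ Q) → ∀ i,
        X.partialD i (algebraMap Z _ z) ∈ Q.map (algebraMap Z (Localization.AtPrime m))) ∧
      (∀ Q : Ideal Z, (∀ (D : Derivation k Z Z), ∀ z ∈ Q, D z ∈ Q) → ∀ i,
        ∀ z ∈ Q.map (algebraMap Z (Localization.AtPrime m)),
          X.partialD i z ∈ Q.map (algebraMap Z (Localization.AtPrime m))) := by
  obtain ⟨e⟩ := exists_algHom_localization_atPrime (k := k) m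
  have : Algebra.EssFiniteType Z (Localization.AtPrime m) :=
    Algebra.EssFiniteType.of_isLocalization _ m.primeCompl
  have : Algebra.EssFiniteType k (Localization.AtPrime m) :=
    Algebra.EssFiniteType.comp k Z (Localization.AtPrime m)
  have : CharP (Localization.AtPrime m) q := charP_of_injective_algebraMap' k q
  obtain ⟨ι, hι, X, hX⟩ := exists_dualCoordinates e q
  have h2 : ∀ (Q : Ideal Z) (z : Z), (∀ D : Derivation k Z Z, D z ∈ Q) → ∀ i,
      X.partialD i (algebraMap Z _ z) ∈ Q.map (algebraMap Z (Localization.AtPrime m)) :=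
    fun Q z hz i => Derivation.mem_map_of_forall_mem hz ((X.partialD i).compAlgebraMap Z)
  refine ⟨ι, hι, X, fun w hw => ?_, h2, fun Q hQ i z hz => ?_⟩
  · have := X.mem_frobenius_range_of_mem_adjoin Finset.univ w (by
      rw [Finset.coe_univ, Set.image_univ, adjoin_frobenius_range_eq_top e q hX]; trivial)
      fun i _ => hw i
    exact this
  · induction hz using Submodule.span_induction with
    | mem x hx =>
      obtain ⟨y, hy, rfl⟩ := hx
      exact h2 Q y (fun D => hQ D y hy) i
    | zero => rw [map_zero]; exact zero_mem _
    | add x y _ _ h1 h2 => rw [map_add]; exact add_mem h1 h2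
    | smul c x hx h =>
      rw [smul_eq_mul, Derivation.leibniz]
      exact add_mem (Ideal.mul_mem_left _ _ h) (Ideal.mul_mem_right _ _ hx)

/-- Elements whose derivatives lie in a stable ideal are `q`-th powers modulo this ideal. -/
lemma exists_eq_add_pow_of_forall_mem [IsDomain Z] {Q : Ideal Z}
    (hQ : ∀ (D : Derivation k Z Z), ∀ z ∈ Q, D z ∈ Q) {z : Z}
    (hz : ∀ D : Derivation k Z Z, D z ∈ Q) : ∃ p ∈ Q, ∃ t, z = p + t ^ q := by
  have hq : q.Prime := Fact.out
  have : CharP Z q := charP_of_injective_algebraMap' k q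
  let I : Ideal Z :=
    { carrier := {s | ∃ p ∈ Q, ∃ t, s ^ q * z = p + t ^ q}
      zero_mem' := ⟨0, zero_mem _, 0, by simp [hq.ne_zero]⟩
      add_mem' := by
        rintro a b ⟨p, hp, t, h⟩ ⟨p', hp', t', h'⟩
        refine ⟨p + p', add_mem hp hp', t + t', ?_⟩
        rw [add_pow_char, add_pow_char, add_mul, h, h']; ring
      smul_mem' := by
        rintro c a ⟨p, hp, t, h⟩
        refine ⟨c ^ q * p, Ideal.mul_mem_left _ _ hp, c * t, ?_⟩
        rw [smul_eq_mul, mul_pow, mul_assoc, h, mul_pow]; ring }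
  suffices h : I = ⊤ by
    obtain ⟨p, hp, t, h⟩ : (1 : Z) ∈ I := h ▸ trivial
    exact ⟨p, hp, t, by simpa using h⟩
  by_contra hI
  obtain ⟨m, hm, hIm⟩ := Ideal.exists_le_maximal I hI
  obtain ⟨ι, _, X, h1, h2, h3⟩ := exists_dualCoordinates_atPrime (k := k) q m
  obtain ⟨w, hw, hw0⟩ := X.exists_sub_mem_of_forall_mem (h3 Q hQ) (h2 Q z hz)
  obtain ⟨t, rfl⟩ := h1 w hw0
  obtain ⟨⟨p, v⟩, hpv⟩ := (IsLocalization.mem_map_algebraMap_iff m.primeCompl _).1 hw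
  obtain ⟨⟨g, u⟩, hgu⟩ := IsLocalization.surj m.primeCompl t
  have hinj := IsLocalization.injective (Localization.AtPrime m) m.primeCompl_le_nonZeroDivisors
  refine (u * v).2 (hIm ⟨(u : Z) ^ q * v ^ (q - 1) * p, Ideal.mul_mem_left _ _ p.2, v * g, hinj ?_⟩)
  obtain ⟨n, hn⟩ : ∃ n, q = n + 1 := ⟨q - 1, by have := hq.pos; omega⟩
  simp only [map_mul, map_add, map_pow, Submonoid.coe_mul] at hpv hgu ⊢
  rw [← hpv, ← hgu, mul_pow, mul_pow, mul_pow]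
  have : algebraMap Z (Localization.AtPrime m) (v : Z) ^ q =
      algebraMap Z (Localization.AtPrime m) (v : Z) ^ (q - 1) * algebraMap Z _ (v : Z) := by
    rw [← pow_succ, Nat.sub_add_cancel hq.pos]
  rw [this]; ring

/-- Stable ideals are generated by the `q`-th powers they contain. -/
lemma mem_span_pow_of_stable [IsDomain Z] {Q : Ideal Z}
    (hQ : ∀ (D : Derivation k Z Z), ∀ z ∈ Q, D z ∈ Q) :
    Q ≤ Ideal.span {y | y ∈ Q ∧ ∃ t, t ^ q = y} := by
  refine Ideal.le_of_localization_maximal fun m hm => ?_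
  obtain ⟨ι, _, X, h1, h2, h3⟩ := exists_dualCoordinates_atPrime (k := k) q m
  intro z hz
  refine (Ideal.span_le.2 ?_) (X.mem_span_constants (h3 Q hQ) hz)
  rintro y ⟨hy, hy0⟩
  obtain ⟨t, rfl⟩ := h1 y hy0
  obtain ⟨⟨g, u⟩, hgu⟩ := IsLocalization.surj m.primeCompl t
  have hg : algebraMap Z (Localization.AtPrime m) (g ^ q) ∈ Q.map (algebraMap Z _) := by
    rw [map_pow, ← hgu, mul_pow]; exact Ideal.mul_mem_right _ _ hy
  obtain ⟨⟨p, v⟩, hpv⟩ := (IsLocalization.mem_map_algebraMap_iff m.primeCompl _).1 hg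
  have hinj := IsLocalization.injective (Localization.AtPrime m) m.primeCompl_le_nonZeroDivisors
  have hgv : g ^ q * v ∈ Q := by
    have : g ^ q * (v : Z) = p := hinj (by rw [map_mul]; exact hpv)
    rw [this]; exact p.2
  have hmem : (g * v) ^ q ∈ Ideal.span {y | y ∈ Q ∧ ∃ t, t ^ q = y} := by
    refine Ideal.subset_span ⟨?_, _, rfl⟩
    rw [mul_pow, ← Nat.sub_add_cancel (Fact.out : q.Prime).pos, pow_succ (v : Z),
      mul_comm (_ ^ _) (v : Z), ← mul_assoc, Nat.sub_add_cancel (Fact.out : q.Prime).pos]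
    exact Ideal.mul_mem_right _ _ hgv
  have hunit (s : m.primeCompl) : IsUnit (algebraMap Z (Localization.AtPrime m) s) :=
    IsLocalization.map_units _ s
  have h := Ideal.mem_map_of_mem (algebraMap Z (Localization.AtPrime m)) hmem
  have heq : algebraMap Z (Localization.AtPrime m) ((g * v) ^ q) =
      t ^ q * (algebraMap Z _ (u : Z) * algebraMap Z _ (v : Z)) ^ q := by
    rw [map_pow, map_mul, ← hgu]; ring
  rw [heq] at h
  exact (Ideal.mul_unit_mem_iff_mem _ (((hunit u).mul (hunit v)).pow q)).1 h

/-- A stable ideal closed under `q`-th roots is trivial. -/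
lemma eq_bot_or_eq_top_of_stable [IsDomain Z] {Q : Ideal Z} (h2 : 2 ≤ q)
    (hQ : ∀ (D : Derivation k Z Z), ∀ z ∈ Q, D z ∈ Q) (hroot : ∀ z, z ^ q ∈ Q → z ∈ Q) :
    Q = ⊥ ∨ Q = ⊤ := by
  have : IsNoetherianRing Z := Algebra.FiniteType.isNoetherianRing k Z
  refine (Ideal.isIdempotentElem_iff_eq_bot_or_top Q (IsNoetherian.noetherian Q)).1 ?_
  refine le_antisymm Ideal.mul_le_left ((mem_span_pow_of_stable (k := k) q hQ).trans ?_)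
  rw [Ideal.span_le]
  rintro _ ⟨hy, t, rfl⟩
  have ht := hroot t hy
  rw [← Nat.sub_add_cancel h2, pow_add, pow_two]
  exact Ideal.mul_mem_left _ _ (Ideal.mul_mem_mul ht ht)

end StableIdeals

section Hochschild

open Polynomial

lemma Polynomial.coeff_pow_pred_mul_derivative {R : Type*} [CommRing R] (n : ℕ) (f : R[X]) :
    (f ^ n * derivative f).coeff n = (f ^ (n + 1)).coeff (n + 1) := by
  let φ : MvPolynomial R ℤ →+* R := (MvPolynomial.aeval (R := ℤ) (id : R → R)).toRingHom
  have hφ : Function.Surjective φ := fun r => ⟨MvPolynomial.X r, MvPolynomial.aeval_X _ _⟩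
  obtain ⟨g, rfl⟩ := Polynomial.map_surjective φ hφ f
  rw [derivative_map, ← Polynomial.map_pow, ← Polynomial.map_pow, ← Polynomial.map_mul, coeff_map,
    coeff_map]
  congr 1
  have h := congrArg (coeff · n) (derivative_pow g (n + 1))
  simp only [coeff_derivative, Nat.add_sub_cancel, mul_assoc, coeff_C_mul] at h
  have h0 : ((n + 1 : ℕ) : MvPolynomial R ℤ) ≠ 0 := Nat.cast_ne_zero.2 n.succ_ne_zero
  refine mul_left_cancel₀ h0 ?_
  rw [← h]; push_cast; ring

lemma Polynomial.coeff_pow_char {R : Type*} [CommRing R] (q : ℕ) [Fact q.Prime] [CharP R q]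
    (f : R[X]) : (f ^ q).coeff q = f.coeff 1 ^ q := by
  have hq : q.Prime := Fact.out
  rw [← map_frobenius_expand (p := q), coeff_map, frobenius_def]
  conv_lhs => rw [show (expand R q f).coeff q = (expand R q f).coeff (1 * q) by rw [one_mul]]
  rw [coeff_expand_mul hq.pos]

variable {k O : Type*} [Field k] [CommRing O] [Algebra k O]

open Finset in
/-- Hochschild's identity. -/
lemma Derivation.iterate_pow_pred_mul (q : ℕ) [Fact q.Prime] [CharP k q] [CharP O q]
    (D : Derivation k O O) (z : O) :
    D^[q - 1] (z ^ (q - 1) * D z) = z ^ (q - 1) * D^[q] z - D z ^ q := by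
  have hq : q.Prime := Fact.out
  choose e' he' using fun b : Fin q =>
    CharP.exists_mul_factorial_eq_one (k := k) (O := O) q (b := b) b.2
  let e (j : ℕ) : O := if h : j < q then algebraMap k O (e' ⟨j, h⟩) else 0
  have he (j : ℕ) (hj : j < q) : e j * (j.factorial : O) = 1 := by
    simp only [e, dif_pos hj]; exact he' ⟨j, hj⟩
  let Φ (a : O) : O[X] := ∑ j ∈ range q, monomial j (e j * D^[j] a)
  have hΦ (a : O) (n : ℕ) (hn : n < q) : (Φ a).coeff n = e n * D^[n] a := by
    simp [Φ, coeff_monomial, hn]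
  have hmul (a b : O) (n : ℕ) (hn : n < q) : (Φ a * Φ b).coeff n = (Φ (a * b)).coeff n := by
    rw [hΦ _ _ hn, coeff_mul, D.iterate_apply_mul, mul_sum]
    refine sum_congr rfl fun ⟨i, j⟩ hij => ?_
    have hij' : i + j = n := mem_antidiagonal.1 hij
    rw [hΦ _ _ (by omega : i < q), hΦ _ _ (by omega : j < q)]
    have h3 : e i * e j = e n * (n.choose i : O) := by
      have h := Nat.choose_mul_factorial_mul_factorial (show i ≤ n by omega)
      rw [show n - i = j by omega] at h
      have h' : (n.choose i : O) * i.factorial * j.factorial = n.factorial := by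
        rw [← h]; push_cast; ring
      calc e i * e j = (e n * n.factorial) * (e i * e j) := by rw [he n hn, one_mul]
        _ = e n * n.choose i * ((e i * i.factorial) * (e j * j.factorial)) := by rw [← h']; ring
        _ = _ := by rw [he i (by omega), he j (by omega)]; ring
    rw [nsmul_eq_mul]
    calc _ = (e i * e j) * (D^[i] a * D^[j] b) := by ring
      _ = _ := by rw [h3]; ring
  have hpow (m : ℕ) : ∀ n < q, (Φ z ^ m).coeff n = (Φ (z ^ m)).coeff n := by
    induction m with
    | zero =>
      intro n hn
      rw [pow_zero, pow_zero, hΦ _ _ hn, coeff_one]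
      rcases n with _ | n
      · have := he 0 hq.pos; simpa using this.symm
      · rw [Function.iterate_succ_apply, D.map_one_eq_zero, iterate_map_zero]; simp
    | succ m ih =>
      intro n hn
      rw [pow_succ, pow_succ, ← hmul _ _ _ hn, coeff_mul, coeff_mul]
      exact sum_congr rfl fun ⟨i, j⟩ hij => by
        rw [ih i (by have := mem_antidiagonal.1 hij; simp only at this; omega)]
  obtain ⟨r, hr⟩ : ∃ r, q = r + 1 := ⟨q - 1, by have := hq.pos; omega⟩
  have hqr : q - 1 = r := by omega
  have hwil : (r.factorial : O) = -1 := by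
    have h1 := ZMod.wilsons_lemma q
    have h2 := congrArg (ZMod.castHom (dvd_refl q) O) h1
    rwa [_root_.map_natCast, _root_.map_neg, _root_.map_one, hqr] at h2
  have her : e r = -1 := by
    have := he r (by omega)
    rw [hwil] at this
    linear_combination -this
  have hder (n : ℕ) (hn : n < q) : (Φ (D z)).coeff n =
      (derivative (Φ z)).coeff n + (if n = r then e r * D^[q] z else 0) := by
    rw [hΦ _ _ hn, coeff_derivative, ← Function.iterate_succ_apply]
    split_ifs with h
    · have h1 : (Φ z).coeff (n + 1) = 0 := by
        simp only [Φ, finsetSum_coeff, coeff_monomial]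
        exact sum_eq_zero fun i hi => if_neg (by have := mem_range.1 hi; omega)
      rw [h1, zero_mul, zero_add, h, hr]
    · have hn1 : n + 1 < q := by omega
      rw [hΦ _ _ hn1, add_zero]
      have h1 := he n hn
      have h2 := he _ hn1
      rw [Nat.factorial_succ] at h2; push_cast at h2
      calc _ = (e (n + 1) * ((n + 1) * n.factorial)) * (e n * D^[n.succ] z) := by
            rw [h2, one_mul]
        _ = (e n * n.factorial) * (e (n + 1) * D^[n + 1] z * (n + 1)) := by
            rw [Nat.succ_eq_add_one]; ring
        _ = _ := by rw [h1, one_mul]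
  have hrq : r < q := by omega
  have key := hmul (z ^ r) (D z) r hrq
  rw [hΦ _ _ hrq, coeff_mul] at key
  have hsum : ∑ x ∈ antidiagonal r, (Φ (z ^ r)).coeff x.1 * (Φ (D z)).coeff x.2 =
      (Φ z ^ r * derivative (Φ z)).coeff r + z ^ r * (e r * D^[q] z) := by
    have h1 : ∀ x ∈ antidiagonal r, (Φ (z ^ r)).coeff x.1 * (Φ (D z)).coeff x.2 =
        (Φ z ^ r).coeff x.1 * (derivative (Φ z)).coeff x.2 +
          (if x = (0, r) then z ^ r * (e r * D^[q] z) else 0) := by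
      rintro ⟨i, j⟩ hij
      have hij' : i + j = r := mem_antidiagonal.1 hij
      rw [← hpow r i (by omega), hder j (by omega), mul_add]
      congr 1
      by_cases hj : j = r
      · obtain rfl : i = 0 := by omega
        rw [if_pos hj, if_pos (by rw [hj]), hpow r 0 hq.pos, hΦ _ _ hq.pos]
        have := he 0 hq.pos
        rw [Nat.factorial_zero, Nat.cast_one, mul_one] at this
        rw [this, Function.iterate_zero_apply, one_mul]
      · rw [if_neg hj, if_neg (by simp [hj]), mul_zero]
    rw [sum_congr rfl h1, sum_add_distrib, coeff_mul, sum_ite_eq',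
      if_pos (by simp)]
  rw [hsum, coeff_pow_pred_mul_derivative, ← hr, coeff_pow_char, hΦ _ _ hq.one_lt,
    Function.iterate_one] at key
  have h1 : e 1 = 1 := by simpa using he 1 hq.one_lt
  rw [h1, one_mul, her] at key
  rw [hqr]
  linear_combination key

end Hochschild

section Cartier

variable {k Z : Type*} [Field k] [CommRing Z] [Algebra k Z] (q : ℕ) [Fact q.Prime] [CharP Z q]

/-- `G` is the image of the one-form `F` under the Cartier operator, where one-forms are viewed as
functions on derivations. -/
def IsCartier (F G : Derivation k Z Z → Z) : Prop :=
  ∀ D, G D ^ q = F (D.charPow q) - D^[q - 1] (F D)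

/-- `G` is the image of `F` under the `n`-th iterate of the Cartier operator. -/
def IsCartierIterate : ℕ → (Derivation k Z Z → Z) → (Derivation k Z Z → Z) → Prop
  | 0, F, G => F = G
  | n + 1, F, G => ∃ H, IsCartierIterate n F H ∧ IsCartier q H G

variable {q}

lemma IsCartier.add {F F' G G' : Derivation k Z Z → Z} (h : IsCartier q F G)
    (h' : IsCartier q F' G') : IsCartier q (F + F') (G + G') := fun D => by
  simp only [Pi.add_apply]
  rw [add_pow_char, h, h', iterate_map_add]; ring

lemma IsCartierIterate.add {n : ℕ} : ∀ {F F' G G' : Derivation k Z Z → Z},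
    IsCartierIterate q n F G → IsCartierIterate q n F' G' →
    IsCartierIterate q n (F + F') (G + G') := by
  induction n with
  | zero => rintro F F' G G' rfl rfl; rfl
  | succ n ih =>
    rintro F F' G G' ⟨H, h1, h2⟩ ⟨H', h1', h2'⟩
    exact ⟨H + H', ih h1 h1', h2.add h2'⟩

lemma isCartier_apply_zero (z : Z) : IsCartier q (fun D : Derivation k Z Z => D z) 0 := fun D => by
  have hq : q.Prime := Fact.out
  beta_reduce
  rw [Pi.zero_apply, zero_pow hq.ne_zero, Derivation.charPow_apply, ← Function.iterate_succ_apply,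
    Nat.succ_eq_add_one, Nat.sub_add_cancel hq.pos, sub_self]

lemma IsCartier.eq_zero [IsDomain Z] {G : Derivation k Z Z → Z} (h : IsCartier q 0 G) : G = 0 := by
  funext D
  have := h D
  rw [Pi.zero_apply, Pi.zero_apply, iterate_map_zero, sub_zero] at this
  exact pow_eq_zero_iff (Fact.out : q.Prime).ne_zero |>.1 this

lemma IsCartierIterate.eq_zero [IsDomain Z] {n : ℕ} :
    ∀ {G : Derivation k Z Z → Z}, IsCartierIterate q n 0 G → G = 0 := by
  induction n with
  | zero => rintro G rfl; rfl
  | succ n ih =>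
    rintro G ⟨H, h1, h2⟩
    rw [ih h1] at h2
    exact h2.eq_zero

lemma Derivation.iterate_pow_char_mul (D : Derivation k Z Z) (c y : Z) (n : ℕ) :
    D^[n] (c ^ q * y) = c ^ q * D^[n] y := by
  induction n with
  | zero => rfl
  | succ n ih =>
    rw [Function.iterate_succ_apply', ih, D.leibniz, D.apply_pow_char q, smul_zero, add_zero,
      Function.iterate_succ_apply', smul_eq_mul]

lemma isCartier_pow_mul [CharP k q] (t : Z) (n : ℕ) :
    IsCartier q (fun D : Derivation k Z Z => t ^ (q ^ (n + 1) - 1) * D t)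
      (fun D => t ^ (q ^ n - 1) * D t) := fun D => by
  have hq : q.Prime := Fact.out
  have he : q ^ (n + 1) - 1 = (q ^ n - 1) * q + (q - 1) := by
    have h1 : 1 ≤ q ^ n := Nat.one_le_pow _ _ hq.pos
    have h2 : q ≤ q ^ n * q := Nat.le_mul_of_pos_left _ h1
    have h3 := hq.pos
    rw [pow_succ, Nat.sub_mul, one_mul]; omega
  beta_reduce
  rw [he, pow_add, pow_mul, mul_assoc, mul_assoc]
  rw [D.iterate_pow_char_mul, D.iterate_pow_pred_mul q, Derivation.charPow_apply]
  ring

lemma isCartierIterate_pow_mul [CharP k q] (t : Z) (n : ℕ) : ∀ j,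
    IsCartierIterate q n (fun D : Derivation k Z Z => t ^ (q ^ (n + j) - 1) * D t)
      (fun D => t ^ (q ^ j - 1) * D t) := by
  induction n with
  | zero => intro j; rw [zero_add]; rfl
  | succ n ih =>
    intro j
    have := ih (j + 1)
    rw [show n + (j + 1) = n + 1 + j by omega] at this
    exact ⟨_, this, isCartier_pow_mul t j⟩

/-- The iterated Cartier operator preserves membership in the ideals of iterated `q`-th roots. -/
lemma IsCartierIterate.mem_comap {P : Ideal Z} {n : ℕ} (hP : ∀ j < n,
      ∀ (D : Derivation k Z Z), ∀ z ∈ P.comap (iterateFrobenius Z q j),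
        D z ∈ P.comap (iterateFrobenius Z q j)) :
    ∀ {F G : Derivation k Z Z → Z}, IsCartierIterate q n F G → (∀ D, F D ∈ P) → ∀ D,
      G D ∈ P.comap (iterateFrobenius Z q n) := by
  induction n with
  | zero =>
    rintro F G rfl h D
    rw [Ideal.mem_comap, iterateFrobenius_def, pow_zero, pow_one]; exact h D
  | succ n ih =>
    rintro F G ⟨H, h1, h2⟩ hF D
    have hH := ih (fun j hj => hP j (by omega)) h1 hF
    rw [Ideal.mem_comap, iterateFrobenius_def, pow_succ', pow_mul, h2 D, ← iterateFrobenius_def,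
      ← Ideal.mem_comap]
    exact Ideal.sub_mem _ (hH _) (Derivation.iterate_mem (fun z hz => hP n (by omega) D z hz) (hH D) _)

end Cartier

section Azumaya

variable {S : Type u} {A : Type*} [CommRing S] [Ring A] [Algebra S A]

lemma mulLeftRightMap_tmul (a : A) (b : Aᵐᵒᵖ) (x : A) :
    mulLeftRightMap S A (a ⊗ₜ[S] b) x = a * x * b.unop := by
  simp [mulLeftRightMap]

lemma mulLeftRightMap_apply_mem {𝔞 : Ideal A} [𝔞.IsTwoSided] {x : A} (hx : x ∈ 𝔞)
    (t : A ⊗[S] Aᵐᵒᵖ) : mulLeftRightMap S A t x ∈ 𝔞 := by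
  induction t using TensorProduct.induction_on with
  | zero => simp
  | tmul a b =>
    rw [mulLeftRightMap_tmul]
    exact 𝔞.mul_mem_right _ (𝔞.mul_mem_left _ hx)
  | add t t' h h' => rw [map_add, LinearMap.add_apply]; exact 𝔞.add_mem h h'

lemma mulLeftRightMap_apply_sub_mem {𝔞 : Ideal A} [𝔞.IsTwoSided] {c : A}
    (hc : ∀ a, c * a - a * c ∈ 𝔞) (t : A ⊗[S] Aᵐᵒᵖ) :
    c * mulLeftRightMap S A t 1 - mulLeftRightMap S A t c ∈ 𝔞 := by
  induction t using TensorProduct.induction_on with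
  | zero => simp
  | tmul a b =>
    rw [mulLeftRightMap_tmul, mulLeftRightMap_tmul, mul_one, ← mul_assoc, ← sub_mul]
    exact 𝔞.mul_mem_right _ (hc a)
  | add t t' h h' =>
    rw [map_add, LinearMap.add_apply, LinearMap.add_apply, mul_add, add_sub_add_comm]
    exact 𝔞.add_mem h h'

/-- Two-sided ideals of an Azumaya algebra are controlled by the base. -/
lemma IsAzumayaOver.eq_zero_of_mem (h : IsAzumayaOver S A) {𝔞 : Ideal A} [𝔞.IsTwoSided]
    (h𝔞 : ∀ z : S, algebraMap S A z ∈ 𝔞 → algebraMap S A z = 0) {x : A} (hx : x ∈ 𝔞) : x = 0 := by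
  obtain ⟨-, hproj, -, hbij⟩ := h
  obtain ⟨s, hs⟩ := hproj.out
  have hφ (φ : A →ₗ[S] S) : algebraMap S A (φ x) = 0 := by
    obtain ⟨t, ht⟩ := hbij.2 ((Algebra.linearMap S A) ∘ₗ φ)
    have := mulLeftRightMap_apply_mem hx t
    rw [ht] at this
    exact h𝔞 _ this
  rw [← hs x, Finsupp.linearCombination_apply, Finsupp.sum]
  refine Finset.sum_eq_zero fun w _ => ?_
  have := hφ (Finsupp.lapply w ∘ₗ s)
  rw [Algebra.smul_def]
  exact (congrArg (· * id w) this).trans (zero_mul _)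

lemma exists_linearMap_apply_one_eq_one [Module.Finite S A] [Module.Projective S A]
    [FaithfulSMul S A] : ∃ φ : A →ₗ[S] S, φ 1 = 1 := by
  suffices h : LinearMap.range (LinearMap.applyₗ (R := S) (M₂ := S) (1 : A)) = ⊤ by
    obtain ⟨φ, hφ⟩ := (h ▸ trivial : (1 : S) ∈ LinearMap.range (LinearMap.applyₗ (R := S) (M₂ := S) (1 : A)))
    exact ⟨φ, hφ⟩
  by_contra hne
  obtain ⟨m, hm, hle⟩ := Ideal.exists_le_maximal _ hne
  obtain ⟨s, hs⟩ := (inferInstance : Module.Projective S A).out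
  have h1 : ∀ a : A, a ∈ m • (⊤ : Submodule S A) := fun a => by
    rw [← one_mul a, ← hs 1, Finsupp.linearCombination_apply, Finsupp.sum, Finset.sum_mul]
    refine Submodule.sum_mem _ fun w _ => ?_
    rw [smul_mul_assoc]
    exact Submodule.smul_mem_smul (hle ⟨Finsupp.lapply w ∘ₗ s, rfl⟩) trivial
  obtain ⟨r, hr, hr0⟩ := Submodule.exists_sub_one_mem_and_smul_eq_zero_of_fg_of_le_smul m ⊤
    Module.Finite.fg_top fun a _ => h1 a
  have hr1 : r = 0 := FaithfulSMul.eq_of_smul_eq_smul (α := A) fun a => by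
    rw [hr0 a trivial, zero_smul]
  rw [hr1, zero_sub, neg_mem_iff] at hr
  exact hm.ne_top ((Ideal.eq_top_iff_one m).2 hr)

/-- An element of an Azumaya algebra which is central modulo a two-sided ideal is congruent to a
central element. -/
lemma IsAzumayaOver.exists_sub_mem (h : IsAzumayaOver S A) {𝔞 : Ideal A} [𝔞.IsTwoSided] {c : A}
    (hc : ∀ a, c * a - a * c ∈ 𝔞) : ∃ z : S, c - algebraMap S A z ∈ 𝔞 := by
  obtain ⟨hfin, hproj, hfaith, hbij⟩ := h
  obtain ⟨φ, hφ⟩ := exists_linearMap_apply_one_eq_one (S := S) (A := A)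
  obtain ⟨t, ht⟩ := hbij.2 ((Algebra.linearMap S A) ∘ₗ φ)
  have := mulLeftRightMap_apply_sub_mem hc t
  rw [ht] at this
  refine ⟨φ c, ?_⟩
  simpa [hφ] using this

end Azumaya

section Quantization

namespace Ring

variable {B : Type*} [Ring B] (a b c : B) (n : ℕ)

lemma commutator_add_left : ⁅a + b, c⁆ = ⁅a, c⁆ + ⁅b, c⁆ := by
  simp only [Ring.lie_def]; noncomm_ring

lemma commutator_sub_left : ⁅a - b, c⁆ = ⁅a, c⁆ - ⁅b, c⁆ := by
  simp only [Ring.lie_def]; noncomm_ring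

lemma commutator_add_right : ⁅a, b + c⁆ = ⁅a, b⁆ + ⁅a, c⁆ := by
  simp only [Ring.lie_def]; noncomm_ring

lemma commutator_sub_right : ⁅a, b - c⁆ = ⁅a, b⁆ - ⁅a, c⁆ := by
  simp only [Ring.lie_def]; noncomm_ring

lemma nsmul_commutator : ⁅n • a, b⁆ = n • ⁅a, b⁆ := by
  simp only [Ring.lie_def, smul_mul_assoc, mul_smul_comm, smul_sub]

lemma commutator_nsmul : ⁅a, n • b⁆ = n • ⁅a, b⁆ := by
  simp only [Ring.lie_def, smul_mul_assoc, mul_smul_comm, smul_sub]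

lemma commutator_commutator : ⁅⁅a, b⁆, c⁆ = ⁅a, ⁅b, c⁆⁆ - ⁅b, ⁅a, c⁆⁆ := by
  simp only [Ring.lie_def]; noncomm_ring

end Ring

lemma exists_derivation_of_perfect {k Z : Type*} [Field k] [IsAlgClosed k] [CommRing Z]
    [Algebra k Z] (q : ℕ) [Fact q.Prime] [CharP Z q] (f : Z → Z)
    (hadd : ∀ x y, f (x + y) = f x + f y) (hmul : ∀ x y, f (x * y) = f x * y + x * f y) :
    ∃ D : Derivation k Z Z, ∀ z, D z = f z := by
  let E : Derivation ℤ Z Z := Derivation.mk' (AddMonoidHom.mk' f hadd).toIntLinearMap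
    fun a b => by
      change f (a * b) = a * f b + b * f a
      rw [hmul]; ring
  have hE (z : Z) : E z = f z := rfl
  have hk (c : k) : f (algebraMap k Z c) = 0 := by
    obtain ⟨d, rfl⟩ := IsAlgClosed.exists_pow_nat_eq c (Fact.out : q.Prime).pos
    rw [map_pow, ← hE, E.leibniz_pow, nsmul_eq_mul, CharP.cast_eq_zero, zero_mul]
  exact ⟨Derivation.mk'
    { toFun := f
      map_add' := hadd
      map_smul' := fun c x => by
        rw [Algebra.smul_def, hmul, hk, zero_mul, zero_add, RingHom.id_apply, Algebra.smul_def] }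
    (fun a b => by
      change f (a * b) = a * f b + b * f a
      rw [hmul]; ring), fun _ => rfl⟩

/-- A ring `B` without `q`-torsion together with an identification `B / qB ≃ A`, such that the
resulting bracket on the center `Z` of `A` is nondegenerate. -/
structure Quantization (q : ℕ) (k Z A B : Type*) [CommRing k] [CommRing Z] [Algebra k Z] [Ring A]
    [Algebra Z A] [Ring B] where
  algebraMap_injective : Function.Injective (algebraMap Z A)
  exists_algebraMap_eq : ∀ a : A, (∀ b, b * a = a * b) → ∃ z : Z, algebraMap Z A z = a
  red : B →+* A
  red_surjective : Function.Surjective red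
  exists_of_red_eq_zero : ∀ x, red x = 0 → ∃ y, x = q • y
  eq_zero_of_smul : ∀ x : B, q • x = 0 → x = 0
  toDer : Ω[Z⁄k] ≃ₗ[Z] Derivation k Z Z
  bracket : ∀ (z w : Z) (zt wt : B), red zt = algebraMap Z A z → red wt = algebraMap Z A w →
    ∃ c, q • c = ⁅zt, wt⁆ ∧ red c = algebraMap Z A (toDer (KaehlerDifferential.D k Z z) w)

namespace Quantization

variable {q : ℕ} {k Z A B : Type*} [Field k] [CommRing Z] [Algebra k Z] [Ring A] [Algebra Z A]
  [Ring B] (X : Quantization q k Z A B)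

/-- `u` is central modulo `q ^ n`. -/
def IsCentralMod (_ : Quantization q k Z A B) (n : ℕ) (u : B) : Prop :=
  ∀ b : B, ∃ c : B, q ^ n • c = ⁅u, b⁆

/-- The derivation of the center of `A` induced by `q ^ (-n) • ⁅u, ·⁆` corresponds to `ω`. -/
def IsForm (n : ℕ) (u : B) (ω : Ω[Z⁄k]) : Prop :=
  ∀ (w : Z) (wt : B), X.red wt = algebraMap Z A w → ∃ c, q ^ n • c = ⁅u, wt⁆ ∧ X.red c = algebraMap Z A (X.toDer ω w)

include X in
lemma smul_pow_cancel (n : ℕ) {x y : B} (h : q ^ n • x = q ^ n • y) : x = y := by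
  induction n with
  | zero => simpa using h
  | succ n ih =>
    refine ih ?_
    rw [pow_succ', mul_smul, mul_smul, ← sub_eq_zero, ← smul_sub] at h
    exact sub_eq_zero.1 (X.eq_zero_of_smul _ h)

variable {X}

section Basic

variable {n : ℕ} {u v : B} {ω η : Ω[Z⁄k]}

lemma isCentralMod_zero (u : B) : X.IsCentralMod 0 u := fun b => ⟨⁅u, b⁆, by simp⟩

lemma IsCentralMod.add (hu : X.IsCentralMod n u) (hv : X.IsCentralMod n v) :
    X.IsCentralMod n (u + v) := fun b => by
  obtain ⟨c, hc⟩ := hu b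
  obtain ⟨d, hd⟩ := hv b
  exact ⟨c + d, by rw [smul_add, hc, hd, Ring.commutator_add_left]⟩

lemma IsCentralMod.sub (hu : X.IsCentralMod n u) (hv : X.IsCentralMod n v) :
    X.IsCentralMod n (u - v) := fun b => by
  obtain ⟨c, hc⟩ := hu b
  obtain ⟨d, hd⟩ := hv b
  exact ⟨c - d, by rw [smul_sub, hc, hd, Ring.commutator_sub_left]⟩

lemma IsCentralMod.of_succ (hu : X.IsCentralMod (n + 1) u) : X.IsCentralMod n u := fun b => by
  obtain ⟨c, hc⟩ := hu b
  exact ⟨q • c, by rw [smul_smul, ← pow_succ, hc]⟩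

lemma IsCentralMod.smul (hu : X.IsCentralMod n u) : X.IsCentralMod (n + 1) (q • u) := fun b => by
  obtain ⟨c, hc⟩ := hu b
  exact ⟨c, by rw [Ring.nsmul_commutator, ← hc, smul_smul, pow_succ']⟩

lemma IsCentralMod.of_smul (hu : X.IsCentralMod (n + 1) (q • u)) : X.IsCentralMod n u := fun b => by
  obtain ⟨c, hc⟩ := hu b
  refine ⟨c, X.smul_pow_cancel 1 ?_⟩
  rw [smul_smul, ← pow_add, add_comm, hc, Ring.nsmul_commutator, pow_one]

lemma IsForm.add (hu : X.IsForm n u ω) (hv : X.IsForm n v η) : X.IsForm n (u + v) (ω + η) :=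
  fun w wt hw => by
  obtain ⟨c, hc, hc'⟩ := hu w wt hw
  obtain ⟨d, hd, hd'⟩ := hv w wt hw
  exact ⟨c + d, by rw [smul_add, hc, hd, Ring.commutator_add_left], by
    rw [map_add, hc', hd', map_add, Derivation.add_apply, map_add]⟩

lemma IsForm.of_smul (hu : X.IsForm (n + 1) (q • u) ω) : X.IsForm n u ω := fun w wt hw => by
  obtain ⟨c, hc, hc'⟩ := hu w wt hw
  refine ⟨c, X.smul_pow_cancel 1 ?_, hc'⟩
  rw [smul_smul, ← pow_add, add_comm, hc, Ring.nsmul_commutator, pow_one]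

lemma IsForm.smul (hu : X.IsForm n u ω) : X.IsForm (n + 1) (q • u) ω := fun w wt hw => by
  obtain ⟨c, hc, hc'⟩ := hu w wt hw
  exact ⟨c, by rw [Ring.nsmul_commutator, ← hc, smul_smul, pow_succ'], hc'⟩

lemma IsForm.eq (hu : X.IsForm n u ω) (hu' : X.IsForm n u η) : ω = η := by
  refine X.toDer.injective (Derivation.ext fun w => X.algebraMap_injective ?_)
  obtain ⟨wt, hw⟩ := X.red_surjective (algebraMap Z A w)
  obtain ⟨c, hc, hc'⟩ := hu w wt hw
  obtain ⟨d, hd, hd'⟩ := hu' w wt hw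
  rw [← hc', ← hd', X.smul_pow_cancel n (hc.trans hd.symm)]

end Basic

variable [CharP Z q]

lemma red_smul (X : Quantization q k Z A B) (b : B) : X.red (q • b) = 0 := by
  rw [map_nsmul, ← Nat.cast_smul_eq_nsmul Z, CharP.cast_eq_zero, zero_smul]

variable {n : ℕ} {u v : B} {ω η : Ω[Z⁄k]}

lemma isCentralMod_one_of_red_eq {z : Z} (h : X.red u = algebraMap Z A z) :
    X.IsCentralMod 1 u := fun b => by
  obtain ⟨c, hc⟩ := X.exists_of_red_eq_zero ⁅u, b⁆ (by
    rw [Ring.lie_def, map_sub, map_mul, map_mul, h, Algebra.commutes, sub_self])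
  exact ⟨c, by rw [pow_one, hc]⟩

lemma IsCentralMod.exists_red_eq (h : X.IsCentralMod 1 u) : ∃ z : Z, X.red u = algebraMap Z A z := by
  obtain ⟨z, hz⟩ := X.exists_algebraMap_eq (X.red u) fun b => by
    obtain ⟨b, rfl⟩ := X.red_surjective b
    obtain ⟨c, hc⟩ := h b
    have := congrArg X.red hc
    rw [pow_one, red_smul, Ring.lie_def, map_sub, map_mul, map_mul] at this
    exact (sub_eq_zero.1 this.symm).symm
  exact ⟨z, hz.symm⟩

lemma isForm_one {z : Z} (h : X.red u = algebraMap Z A z) :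
    X.IsForm 1 u (KaehlerDifferential.D k Z z) := fun w wt hw => by
  obtain ⟨c, hc, hc'⟩ := X.bracket z w u wt h hw
  exact ⟨c, by rw [pow_one, hc], hc'⟩

lemma IsCentralMod.isForm_zero (hu : X.IsCentralMod (n + 1) u) : X.IsForm n u 0 :=
  fun w wt _ => by
  obtain ⟨c, hc⟩ := hu wt
  exact ⟨q • c, by rw [smul_smul, ← pow_succ, hc], by
    rw [red_smul, map_zero, Derivation.zero_apply, map_zero]⟩

/-- Division of `⁅u, ·⁆` by `q ^ n` preserves centrality modulo `q`. -/
lemma IsCentralMod.isCentralMod_one (hn : 1 ≤ n) (hu : X.IsCentralMod n u) {wt c : B}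
    (hw : X.IsCentralMod 1 wt) (hc : q ^ n • c = ⁅u, wt⁆) : X.IsCentralMod 1 c := fun b => by
  obtain ⟨e, he⟩ := hw b
  obtain ⟨g, hg⟩ := hu b
  obtain ⟨e', he'⟩ := hu e
  obtain ⟨g', hg'⟩ := hw g
  refine ⟨e' - g', X.smul_pow_cancel n ?_⟩
  rw [← Ring.nsmul_commutator, hc, Ring.commutator_commutator, ← he, ← hg, Ring.commutator_nsmul, Ring.commutator_nsmul, ← he', ← hg']
  simp only [smul_smul, smul_sub, mul_comm]

variable [IsAlgClosed k] [Fact q.Prime]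

lemma IsCentralMod.exists_isForm (hn : 1 ≤ n) (hu : X.IsCentralMod n u) :
    ∃ ω, X.IsForm n u ω := by
  choose σ hσ using X.red_surjective
  choose c hc using hu
  have hcent (wt : B) (w : Z) (hw : X.red wt = algebraMap Z A w) :
      ∃ f : Z, X.red (c wt) = algebraMap Z A f :=
    (IsCentralMod.isCentralMod_one hn (fun b => ⟨_, hc b⟩)
      (isCentralMod_one_of_red_eq hw) (hc wt)).exists_red_eq
  have hcongr (wt wt' : B) (h : X.red wt = X.red wt') : X.red (c wt) = X.red (c wt') := by
    obtain ⟨y, hy⟩ := X.exists_of_red_eq_zero (wt - wt') (by rw [map_sub, h, sub_self])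
    rw [← sub_eq_zero, ← map_sub]
    have : c wt - c wt' = q • c y := X.smul_pow_cancel n (by
      rw [smul_sub, hc, hc, ← Ring.commutator_sub_right, hy, Ring.commutator_nsmul, ← hc y, smul_smul, smul_smul, mul_comm])
    rw [this, red_smul]
  choose f hf' using fun w : Z => hcent (σ (algebraMap Z A w)) w (hσ _)
  have hf (w : Z) (wt : B) (h : X.red wt = algebraMap Z A w) :
      X.red (c wt) = algebraMap Z A (f w) := by
    rw [← hf' w]; exact hcongr _ _ (by rw [h, hσ])
  obtain ⟨D, hD⟩ := exists_derivation_of_perfect (k := k) q f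
    (fun x y => X.algebraMap_injective (by
      rw [← hf (x + y) (σ (algebraMap Z A x) + σ (algebraMap Z A y))
        (by rw [map_add, hσ, hσ, map_add])]
      have : c (σ (algebraMap Z A x) + σ (algebraMap Z A y)) =
          c (σ (algebraMap Z A x)) + c (σ (algebraMap Z A y)) := X.smul_pow_cancel n (by
        rw [smul_add, hc, hc, hc, Ring.commutator_add_right])
      rw [this, map_add, map_add, hf', hf']))
    (fun x y => X.algebraMap_injective (by
      rw [← hf (x * y) (σ (algebraMap Z A x) * σ (algebraMap Z A y))
        (by rw [map_mul, hσ, hσ, map_mul])]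
      have : c (σ (algebraMap Z A x) * σ (algebraMap Z A y)) =
          c (σ (algebraMap Z A x)) * σ (algebraMap Z A y) +
            σ (algebraMap Z A x) * c (σ (algebraMap Z A y)) := X.smul_pow_cancel n (by
        rw [smul_add, ← smul_mul_assoc, ← mul_smul_comm, hc, hc, hc]
        simp only [Ring.lie_def]; noncomm_ring)
      rw [this, map_add, map_mul, map_mul, hσ, hσ, map_add, map_mul, map_mul, hf', hf']))
  refine ⟨X.toDer.symm D, fun w wt hw => ⟨c wt, hc wt, ?_⟩⟩
  rw [hf w wt hw, LinearEquiv.apply_symm_apply, hD]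

end Quantization

end Quantization

namespace Quantization

section Power

lemma exists_mul_pow_eq {B : Type*} [Ring B] {q n : ℕ} {u b₁ b₂ b₃ : B}
    (h₁ : b₁ * u = u * b₁ + q ^ (n + 1) • b₂) (h₂ : b₂ * u = u * b₂ + q ^ (n + 1) • b₃) (m : ℕ) :
    ∃ r, b₁ * u ^ (m + 1) =
      u ^ (m + 1) * b₁ + ((m + 1) * q ^ (n + 1)) • (u ^ m * b₂) + q ^ (n + 2) • r := by
  induction m with
  | zero => exact ⟨0, by simp [h₁]⟩
  | succ m ih =>
    obtain ⟨r, hr⟩ := ih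
    refine ⟨r * u + ((m + 1) * q ^ n) • (u ^ m * b₃), ?_⟩
    rw [pow_succ u (m + 1), ← mul_assoc, hr]
    simp only [add_mul, smul_mul_assoc, mul_assoc, h₁, h₂, mul_add, mul_smul_comm, pow_succ u m]
    module

lemma exists_pow_commutator_eq {B : Type*} [Ring B] {q n : ℕ} {u b b₁ b₂ b₃ : B}
    (h₀ : u * b = b * u + q ^ (n + 1) • b₁)
    (h₁ : b₁ * u = u * b₁ + q ^ (n + 1) • b₂) (h₂ : b₂ * u = u * b₂ + q ^ (n + 1) • b₃) (m : ℕ) :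
    ∃ r, u ^ (m + 2) * b = b * u ^ (m + 2) + q ^ (n + 1) • ((m + 2) • (u ^ (m + 1) * b₁) +
      ((m + 2).choose 2 * q ^ (n + 1)) • (u ^ m * b₂) + q ^ (n + 2) • r) := by
  induction m with
  | zero =>
    refine ⟨0, ?_⟩
    simp only [zero_add, pow_two, mul_assoc, h₀, mul_add, mul_smul_comm, pow_one, pow_zero, one_mul,
      Nat.choose_self]
    rw [← mul_assoc u b u, h₀, add_mul, smul_mul_assoc, h₁, mul_assoc]
    module
  | succ m ih =>
    obtain ⟨r, hr⟩ := ih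
    obtain ⟨s, hs⟩ := exists_mul_pow_eq h₁ h₂ (m + 1)
    refine ⟨u * r + s, ?_⟩
    have hc : (m + 1 + 2).choose 2 = (m + 2) + (m + 2).choose 2 := by
      rw [show m + 1 + 2 = (m + 2) + 1 by ring, Nat.choose_succ_succ' (m + 2) 1, Nat.choose_one_right]
    rw [show m + 1 + 2 = (m + 2) + 1 by ring, pow_succ' u (m + 2), mul_assoc, hr, mul_add,
      ← mul_assoc u b, h₀, add_mul, mul_assoc b, ← pow_succ' u, smul_mul_assoc, hs,
      show (m + 2) + 1 = m + 1 + 2 by ring, hc]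
    simp only [mul_add, mul_smul_comm, ← mul_assoc, ← pow_succ']
    module

end Power

variable {q : ℕ} {k Z A B : Type*} [Field k] [CommRing Z] [Algebra k Z] [Ring A] [Algebra Z A]
  [Ring B] {X : Quantization q k Z A B} {n : ℕ} {u : B} {ω : Ω[Z⁄k]}

lemma IsCentralMod.exists_pow (hq : q.Prime) (hq2 : 2 < q) (hn : 1 ≤ n) (hu : X.IsCentralMod n u)
    {b b₁ : B} (hb : q ^ n • b₁ = ⁅u, b⁆) :
    ∃ c r, q ^ (n + 1) • c = ⁅u ^ q, b⁆ ∧ c = u ^ (q - 1) * b₁ + q • r := by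
  obtain ⟨n, rfl⟩ := Nat.exists_eq_add_of_le' hn
  have key (x : B) : ∃ y, x * u = u * x + q ^ (n + 1) • y := by
    obtain ⟨y, hy⟩ := hu x
    refine ⟨-y, ?_⟩
    rw [smul_neg, hy, Ring.lie_def]; abel
  obtain ⟨b₂, h₁⟩ := key b₁
  obtain ⟨b₃, h₂⟩ := key b₂
  obtain ⟨m, hm⟩ := Nat.exists_eq_add_of_le' hq2.le
  obtain ⟨r, hr⟩ := exists_pow_commutator_eq (by rw [hb, Ring.lie_def, add_sub_cancel]) h₁ h₂ m
  obtain ⟨e, he⟩ := hq.dvd_choose_self two_ne_zero hq2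
  rw [← hm, he] at hr
  refine ⟨_, (e * q ^ n) • (u ^ m * b₂) + q ^ n • r, ?_, rfl⟩
  rw [Ring.lie_def, hr, show q - 1 = m + 1 by omega]
  module

variable [CharP Z q]

lemma IsCentralMod.pow (hq : q.Prime) (hq2 : 2 < q) (hn : 1 ≤ n) (hu : X.IsCentralMod n u) :
    X.IsCentralMod (n + 1) (u ^ q) := fun b => by
  obtain ⟨b₁, hb⟩ := hu b
  obtain ⟨c, -, hc, -⟩ := hu.exists_pow hq hq2 hn hb
  exact ⟨c, hc⟩

lemma IsForm.pow (hq : q.Prime) (hq2 : 2 < q) (hn : 1 ≤ n) (hu : X.IsCentralMod n u)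
    (hω : X.IsForm n u ω) {z : Z} (hz : X.red u = algebraMap Z A z) :
    X.IsForm (n + 1) (u ^ q) (z ^ (q - 1) • ω) := fun w wt hw => by
  obtain ⟨b₁, hb, hb'⟩ := hω w wt hw
  obtain ⟨c, r, hc, rfl⟩ := hu.exists_pow hq hq2 hn hb
  refine ⟨_, hc, ?_⟩
  rw [map_add, red_smul, add_zero, map_mul, map_pow, hz, hb', map_smul, Derivation.smul_apply,
    smul_eq_mul, map_mul, map_pow]

lemma isCentralMod_and_isForm_pow_pow (hq : q.Prime) (hq2 : 2 < q) {z : Z}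
    (hz : X.red u = algebraMap Z A z) (n : ℕ) :
    X.IsCentralMod (n + 1) (u ^ q ^ n) ∧
      X.IsForm (n + 1) (u ^ q ^ n) (z ^ (q ^ n - 1) • KaehlerDifferential.D k Z z) := by
  induction n with
  | zero => simpa using ⟨isCentralMod_one_of_red_eq hz, isForm_one hz⟩
  | succ n ih =>
    have hr : X.red (u ^ q ^ n) = algebraMap Z A (z ^ q ^ n) := by rw [map_pow, hz, map_pow]
    refine ⟨by rw [pow_succ, pow_mul]; exact ih.1.pow hq hq2 (by simp), ?_⟩
    have := IsForm.pow hq hq2 (by simp) ih.1 ih.2 hr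
    rw [smul_smul, ← pow_mul, ← pow_mul, ← pow_succ, ← pow_add] at this
    convert this using 3
    have h1 := Nat.one_le_pow n q hq.pos
    have h2 := hq.pos
    zify [h1, h2, Nat.one_le_pow (n + 1) q hq.pos]
    ring

end Quantization

section Pairing

variable {k Z : Type*} [CommRing k] [CommRing Z] [Algebra k Z]

lemma Derivation.liftKaehlerDifferential_smul_D (a z : Z) (D : Derivation k Z Z) :
    D.liftKaehlerDifferential (a • KaehlerDifferential.D k Z z) = a * D z := by
  rw [LinearMap.map_smul, Derivation.liftKaehlerDifferential_comp_D, smul_eq_mul]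

/-- A skew-symmetric identification of one-forms with derivations has symmetric evaluations. -/
lemma liftKaehlerDifferential_mem (e : Ω[Z⁄k] ≃ₗ[Z] Derivation k Z Z)
    (he : ∀ z w, e (KaehlerDifferential.D k Z z) w = - e (KaehlerDifferential.D k Z w) z)
    {P : Ideal Z} {ω : Ω[Z⁄k]} (h : ∀ w, e ω w ∈ P) (D : Derivation k Z Z) :
    D.liftKaehlerDifferential ω ∈ P := by
  have skew (ω η : Ω[Z⁄k]) :
      (e η).liftKaehlerDifferential ω = - (e ω).liftKaehlerDifferential η := by
    have hη : η ∈ Submodule.span Z (Set.range (KaehlerDifferential.D k Z)) := by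
      rw [KaehlerDifferential.span_range_derivation]; trivial
    have hω : ω ∈ Submodule.span Z (Set.range (KaehlerDifferential.D k Z)) := by
      rw [KaehlerDifferential.span_range_derivation]; trivial
    have lift_add (D E : Derivation k Z Z) (ω) : (D + E).liftKaehlerDifferential ω =
        D.liftKaehlerDifferential ω + E.liftKaehlerDifferential ω :=
      congrArg (· ω) (map_add (KaehlerDifferential.linearMapEquivDerivation k Z).symm D E)
    have lift_smul (a : Z) (E : Derivation k Z Z) (ω) : (a • E).liftKaehlerDifferential ω =
        a * E.liftKaehlerDifferential ω :=
      congrArg (· ω) (map_smul (KaehlerDifferential.linearMapEquivDerivation k Z).symm a E)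
    have lift_zero (ω : Ω[Z⁄k]) : (0 : Derivation k Z Z).liftKaehlerDifferential ω = 0 :=
      congrArg (fun f : Ω[Z⁄k] →ₗ[Z] Z => f ω)
        (map_zero (KaehlerDifferential.linearMapEquivDerivation k Z).symm)
    induction hη using Submodule.span_induction with
    | zero => rw [map_zero, map_zero, lift_zero, neg_zero]
    | add x y _ _ hx hy => rw [map_add, map_add, lift_add, hx, hy]; ring
    | smul a x _ hx => rw [map_smul, map_smul, lift_smul, hx, smul_eq_mul]; ring
    | mem x hx =>
      obtain ⟨z, rfl⟩ := hx
      induction hω using Submodule.span_induction with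
      | zero => rw [map_zero, map_zero, lift_zero, neg_zero]
      | add x y _ _ hx hy => rw [map_add, map_add, lift_add, hx, hy]; ring
      | smul a x _ hx => rw [map_smul, map_smul, lift_smul, hx, smul_eq_mul]; ring
      | mem x hx =>
        obtain ⟨w, rfl⟩ := hx
        rw [Derivation.liftKaehlerDifferential_comp_D, Derivation.liftKaehlerDifferential_comp_D, he]
  obtain ⟨η, rfl⟩ := e.surjective D
  rw [skew, Ideal.neg_mem_iff]
  have hη : η ∈ Submodule.span Z (Set.range (KaehlerDifferential.D k Z)) := by
    rw [KaehlerDifferential.span_range_derivation]; trivial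
  induction hη using Submodule.span_induction with
  | zero => rw [map_zero]; exact P.zero_mem
  | add x y _ _ hx hy => rw [map_add]; exact P.add_mem hx hy
  | smul a x _ hx => rw [map_smul]; exact P.mul_mem_left _ hx
  | mem x hx =>
    obtain ⟨z, rfl⟩ := hx
    rw [Derivation.liftKaehlerDifferential_comp_D]; exact h z

end Pairing

lemma Quantization.toDer_D_eq_neg {q : ℕ} {k Z A B : Type*} [Field k] [CommRing Z] [Algebra k Z]
    [Ring A] [Algebra Z A] [Ring B] (X : Quantization q k Z A B) (z w : Z) :
    X.toDer (KaehlerDifferential.D k Z z) w = - X.toDer (KaehlerDifferential.D k Z w) z := by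
  obtain ⟨zt, hz⟩ := X.red_surjective (algebraMap Z A z)
  obtain ⟨wt, hw⟩ := X.red_surjective (algebraMap Z A w)
  obtain ⟨c, hc, hc'⟩ := X.bracket z w zt wt hz hw
  obtain ⟨d, hd, hd'⟩ := X.bracket w z wt zt hw hz
  apply X.algebraMap_injective
  rw [map_neg, ← hc', ← hd', ← map_neg]
  congr 1
  refine X.smul_pow_cancel 1 ?_
  rw [smul_neg, pow_one, hc, hd, Ring.lie_def, Ring.lie_def, neg_sub]

namespace Quantization

section Tower

variable {q : ℕ} {k Z : Type u} {A B : Type*} [Field k] [IsAlgClosed k] [CommRing Z] [IsDomain Z]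
  [Algebra k Z] [Algebra.FiniteType k Z] [Algebra.FormallySmooth k Z] [Ring A] [Algebra Z A]
  [Ring B] [Fact q.Prime] [CharP k q] [CharP Z q] {X : Quantization q k Z A B} {n : ℕ} {u v : B}
  {ω η : Ω[Z⁄k]}

omit [IsAlgClosed k] [IsDomain Z] [Algebra.FiniteType k Z] [Algebra.FormallySmooth k Z]
  [Fact q.Prime] [CharP k q] [CharP Z q] in
lemma IsForm.sub (hu : X.IsForm n u ω) (hv : X.IsForm n v η) : X.IsForm n (u - v) (ω - η) :=
  fun w wt hw => by
  obtain ⟨c, hc, hc'⟩ := hu w wt hw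
  obtain ⟨d, hd, hd'⟩ := hv w wt hw
  exact ⟨c - d, by rw [smul_sub, hc, hd, Ring.commutator_sub_left], by
    rw [map_sub, hc', hd', map_sub, Derivation.sub_apply, map_sub]⟩

/-- The center of `B / q ^ (n + 1) B` reduces to `q ^ n`-th powers `z ^ q ^ n`, and the form of a
central element is sent to `dz` by the `n`-th iterate of the Cartier operator. -/
lemma IsCentralMod.exists_red_eq_pow (hq2 : 2 < q) (n : ℕ) : ∀ {u : B} {ω : Ω[Z⁄k]},
    X.IsCentralMod (n + 1) u → X.IsForm (n + 1) u ω → ∃ z : Z, X.red u = algebraMap Z A (z ^ q ^ n) ∧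
      IsCartierIterate q n (fun D => D.liftKaehlerDifferential ω) (fun D => D z) := by
  have hq : q.Prime := Fact.out
  induction n with
  | zero =>
    intro u ω hu hω
    obtain ⟨z, hz⟩ := hu.exists_red_eq
    obtain rfl := hω.eq (isForm_one hz)
    exact ⟨z, by simpa using hz, funext fun D => D.liftKaehlerDifferential_comp_D z⟩
  | succ n ih =>
    intro u ω hu hω
    obtain ⟨z, hz, hC⟩ := ih hu.of_succ hu.isForm_zero
    have h0 : (fun D : Derivation k Z Z => D.liftKaehlerDifferential (0 : Ω[Z⁄k])) = 0 :=
      funext fun D => map_zero _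
    rw [h0] at hC
    have hDz := hC.eq_zero
    obtain ⟨p, hp, t, rfl⟩ := exists_eq_add_pow_of_forall_mem (k := k) q (Q := (⊥ : Ideal Z)) (z := z)
      (fun D z hz => by rw [Ideal.mem_bot] at hz ⊢; rw [hz, map_zero])
      (fun D => congrFun hDz D)
    rw [Ideal.mem_bot] at hp
    rw [hp, zero_add, ← pow_mul, ← pow_succ'] at hz
    obtain ⟨s, hs⟩ := X.red_surjective (algebraMap Z A t)
    obtain ⟨hsC, hsF⟩ := isCentralMod_and_isForm_pow_pow hq hq2 hs (n + 1)
    obtain ⟨v, hv⟩ := X.exists_of_red_eq_zero (u - s ^ q ^ (n + 1))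
      (by rw [map_sub, hz, map_pow X.red, hs, map_pow, sub_self])
    have hvC := hu.sub hsC
    have hvF := hω.sub hsF
    rw [hv] at hvC hvF
    obtain ⟨z₁, -, hC₁⟩ := ih hvC.of_smul hvF.of_smul
    refine ⟨t, hz, ?_⟩
    have h1 : IsCartierIterate q (n + 1) _ _ := ⟨_, hC₁, isCartier_apply_zero z₁⟩
    have := h1.add (isCartierIterate_pow_mul (k := k) t (n + 1) 0)
    convert this using 1
    · funext D
      simp only [Pi.add_apply, add_zero, map_sub, Derivation.liftKaehlerDifferential_smul_D,
        sub_add_cancel]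
    · funext D
      simp

/-- The elements of the center which lift to an ideal. -/
def centralIdeal (X : Quantization q k Z A B) (I : Ideal B) : Ideal Z :=
  (I.map X.red).comap (algebraMap Z A)

/-- Elements which are central modulo `q ^ n B + I` are congruent modulo `I` to elements which are
central modulo `q ^ n`. -/
def LiftsCentral (X : Quantization q k Z A B) (I : Ideal B) (n : ℕ) : Prop :=
  ∀ v, (∀ b : B, ∃ c, ⁅v, b⁆ - q ^ n • c ∈ I) → ∃ c, X.IsCentralMod n c ∧ v - c ∈ I

/-- The ideal `Q` is stable under all derivations. -/
def IsStable (k : Type*) {Z : Type*} [CommRing k] [CommRing Z] [Algebra k Z] (Q : Ideal Z) : Prop :=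
  ∀ (D : Derivation k Z Z), ∀ z ∈ Q, D z ∈ Q

variable {I : Ideal B}

omit [IsAlgClosed k] [IsDomain Z] [Algebra.FiniteType k Z] [Algebra.FormallySmooth k Z]
  [Fact q.Prime] [CharP k q] [CharP Z q] in
lemma mem_centralIdeal {z : Z} : z ∈ X.centralIdeal I ↔ ∃ i ∈ I, X.red i = algebraMap Z A z :=
  Ideal.mem_map_iff_of_surjective _ X.red_surjective

variable [I.IsTwoSided] (hI : ∀ x, q • x ∈ I → x ∈ I)

omit [I.IsTwoSided] [Fact q.Prime] in
include hI in
lemma mem_of_pow_smul_mem (n : ℕ) {x : B} (h : q ^ n • x ∈ I) : x ∈ I := by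
  induction n with
  | zero => simpa using h
  | succ n ih => exact ih (hI _ (by rwa [smul_smul, ← pow_succ']))

lemma commutator_mem_left {I : Ideal B} [I.IsTwoSided] {a : B} (ha : a ∈ I) (b : B) : ⁅a, b⁆ ∈ I :=
  I.sub_mem (I.mul_mem_right _ ha) (I.mul_mem_left _ ha)

include hI

omit [IsAlgClosed k] [IsDomain Z] [Algebra.FiniteType k Z] [Algebra.FormallySmooth k Z]
  [CharP k q] in
/-- Elements of the `n`-th Frobenius preimage have `q ^ n`-th powers lifting to elements of `I`
which are central modulo `q ^ (n + 1)`. -/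
lemma LiftsCentral.exists_mem (hq2 : 2 < q) (hG : X.LiftsCentral I n) {z : Z}
    (hz : z ^ q ^ n ∈ X.centralIdeal I) :
    ∃ a ∈ I, X.IsCentralMod (n + 1) a ∧ X.red a = algebraMap Z A (z ^ q ^ n) := by
  obtain ⟨s, hs⟩ := X.red_surjective (algebraMap Z A z)
  obtain ⟨hsC, -⟩ := isCentralMod_and_isForm_pow_pow (Fact.out : q.Prime) hq2 hs n
  obtain ⟨a₀, ha₀, hr⟩ := mem_centralIdeal.1 hz
  obtain ⟨v, hv⟩ := X.exists_of_red_eq_zero (s ^ q ^ n - a₀)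
    (by rw [map_sub, hr, map_pow, hs, map_pow, sub_self])
  obtain ⟨c, hc, hvc⟩ := hG v fun b => by
    obtain ⟨d, hd⟩ := hsC b
    refine ⟨d, hI _ ?_⟩
    rw [smul_sub, ← Ring.nsmul_commutator, ← hv, Ring.commutator_sub_left, ← hd, smul_smul,
      ← pow_succ', sub_sub_cancel_left]
    exact I.neg_mem (commutator_mem_left ha₀ b)
  refine ⟨s ^ q ^ n - q • c, ?_, hsC.sub hc.smul, ?_⟩
  · have : s ^ q ^ n - q • c = a₀ + q • (v - c) := by rw [smul_sub, ← hv]; abel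
    rw [this]
    exact I.add_mem ha₀ (nsmul_mem hvc q)
  · rw [map_sub, red_smul, sub_zero, map_pow, hs, map_pow]

/-- If all values of the derivation attached to `c` lie in the ideal, then so do those of the form. -/
lemma IsForm.lift_mem {c : B} (hc : X.IsForm n c ω) (h : ∀ b : B, ∃ d, ⁅c, b⁆ - q ^ (n + 1) • d ∈ I)
    (D : Derivation k Z Z) : D.liftKaehlerDifferential ω ∈ X.centralIdeal I := by
  refine liftKaehlerDifferential_mem X.toDer X.toDer_D_eq_neg (fun w => ?_) D
  obtain ⟨wt, hw⟩ := X.red_surjective (algebraMap Z A w)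
  obtain ⟨e, he, he'⟩ := hc w wt hw
  obtain ⟨d, hd⟩ := h wt
  refine mem_centralIdeal.2 ⟨e - q • d, mem_of_pow_smul_mem hI n ?_, ?_⟩
  · rwa [smul_sub, he, smul_smul, ← pow_succ]
  · rw [map_sub, red_smul, sub_zero, he']

lemma LiftsCentral.isStable (hq2 : 2 < q) (hG : X.LiftsCentral I n)
    (hS : ∀ j < n, IsStable k ((X.centralIdeal I).comap (iterateFrobenius Z q j))) :
    IsStable k ((X.centralIdeal I).comap (iterateFrobenius Z q n)) := fun D z hz => by
  obtain ⟨a, ha, haC, har⟩ := hG.exists_mem hI hq2 hz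
  obtain ⟨ω, hω⟩ := haC.exists_isForm (by simp)
  have hP := hω.lift_mem hI fun b => ⟨0, by
    rw [smul_zero, sub_zero]; exact commutator_mem_left ha b⟩
  obtain ⟨z', hz', hC⟩ := haC.exists_red_eq_pow hq2 n hω
  have hzz : z = z' := by
    apply iterateFrobenius_inj Z q n
    rw [iterateFrobenius_def, iterateFrobenius_def]
    exact X.algebraMap_injective (har.symm.trans hz')
  subst hzz
  exact hC.mem_comap hS hP D

omit hI in
lemma liftsCentral_zero : X.LiftsCentral I 0 := fun v _ =>
  ⟨v, isCentralMod_zero v, by rw [sub_self]; exact I.zero_mem⟩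

omit hI in
lemma liftsCentral_one (hA : IsAzumayaOver Z A) : X.LiftsCentral I 1 := fun v hv => by
  have : RingHomSurjective X.red := ⟨X.red_surjective⟩
  obtain ⟨z, hz⟩ := hA.exists_sub_mem (𝔞 := I.map X.red) (c := X.red v) fun a => by
    obtain ⟨b, rfl⟩ := X.red_surjective a
    obtain ⟨d, hd⟩ := hv b
    have := Ideal.mem_map_of_mem X.red hd
    rwa [map_sub, pow_one, red_smul, sub_zero, Ring.lie_def, map_sub, map_mul, map_mul] at this
  obtain ⟨i, hi, hi'⟩ := (Ideal.mem_map_iff_of_surjective _ X.red_surjective).1 hz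
  refine ⟨v - i, isCentralMod_one_of_red_eq (z := z) (by rw [map_sub, hi', sub_sub_cancel]), ?_⟩
  rwa [sub_sub_cancel]

lemma LiftsCentral.succ (hq2 : 2 < q) (hG' : X.LiftsCentral I n) (hG : X.LiftsCentral I (n + 1))
    (hS : ∀ j ≤ n, IsStable k ((X.centralIdeal I).comap (iterateFrobenius Z q j))) :
    X.LiftsCentral I (n + 2) := fun v hv => by
  obtain ⟨c, hc, hvc⟩ := hG v fun b => by
    obtain ⟨d, hd⟩ := hv b
    exact ⟨q • d, by rwa [smul_smul, ← pow_succ]⟩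
  have hcd (b : B) : ∃ d, ⁅c, b⁆ - q ^ (n + 2) • d ∈ I := by
    obtain ⟨d, hd⟩ := hv b
    refine ⟨d, ?_⟩
    have := I.sub_mem hd (commutator_mem_left hvc b)
    rw [Ring.commutator_sub_left] at this
    convert this using 1
    abel
  obtain ⟨ω, hω⟩ := hc.exists_isForm (by simp)
  obtain ⟨z, hz, hC⟩ := hc.exists_red_eq_pow hq2 n hω
  obtain ⟨p, hp, t, rfl⟩ := exists_eq_add_pow_of_forall_mem (k := k) q (hS n le_rfl)
    (hC.mem_comap (fun j hj => hS j hj.le) (hω.lift_mem hI hcd))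
  obtain ⟨a, ha, -, har⟩ := hG'.exists_mem hI hq2 hp
  obtain ⟨s, hs⟩ := X.red_surjective (algebraMap Z A t)
  obtain ⟨hsC, -⟩ := isCentralMod_and_isForm_pow_pow (Fact.out : q.Prime) hq2 hs (n + 1)
  obtain ⟨c', hc'⟩ := X.exists_of_red_eq_zero (c - a - s ^ q ^ (n + 1)) (by
    rw [map_sub, map_sub, hz, har, map_pow X.red, hs, add_pow_char_pow, map_add, ← pow_mul, ← pow_succ',
      map_pow (algebraMap Z A) t]
    abel)
  obtain ⟨c'', hc'', hcc⟩ := hG c' fun b => by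
    obtain ⟨d, hd⟩ := hcd b
    obtain ⟨e, he⟩ := hsC b
    refine ⟨d - e, hI _ ?_⟩
    rw [smul_sub, ← Ring.nsmul_commutator, ← hc', Ring.commutator_sub_left,
      Ring.commutator_sub_left, ← he, smul_smul, ← pow_succ', smul_sub]
    convert I.sub_mem hd (commutator_mem_left ha b) using 1
    abel
  refine ⟨q • c'' + s ^ q ^ (n + 1), hc''.smul.add hsC, ?_⟩
  have : v - (q • c'' + s ^ q ^ (n + 1)) = (v - c) + a + q • (c' - c'') := by
    rw [smul_sub, ← hc']; abel
  rw [this]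
  exact I.add_mem (I.add_mem hvc ha) (nsmul_mem hcc q)

lemma liftsCentral_and_isStable (hq2 : 2 < q) (hA : IsAzumayaOver Z A) (n : ℕ) :
    (∀ j ≤ n, X.LiftsCentral I j) ∧
      ∀ j < n, IsStable k ((X.centralIdeal I).comap (iterateFrobenius Z q j)) := by
  induction n with
  | zero => exact ⟨fun j hj => by obtain rfl : j = 0 := by omega
                                  exact liftsCentral_zero, fun j hj => by omega⟩
  | succ n ih =>
    obtain ⟨hG, hS⟩ := ih
    have hS' : ∀ j < n + 1, IsStable k ((X.centralIdeal I).comap (iterateFrobenius Z q j)) :=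
      fun j hj => by
      rcases Nat.lt_succ_iff_lt_or_eq.1 hj with hj | rfl
      · exact hS j hj
      · exact (hG j le_rfl).isStable hI hq2 hS
    refine ⟨fun j hj => ?_, hS'⟩
    rcases Nat.le_succ_iff.1 hj with hj | rfl
    · exact hG j hj
    · cases n with
      | zero => exact liftsCentral_one hA
      | succ n => exact (hG n (by simp)).succ hI hq2 (hG _ le_rfl) fun j hj => hS j (by omega)

/-- A two-sided ideal `I` of `B` such that `B / I` has no `q`-torsion reduces to a trivial ideal. -/
theorem one_mem_map_or_map_eq_bot (hq2 : 2 < q) (hA : IsAzumayaOver Z A) :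
    1 ∈ I.map X.red ∨ I.map X.red = ⊥ := by
  have : RingHomSurjective X.red := ⟨X.red_surjective⟩
  have : IsNoetherianRing Z := Algebra.FiniteType.isNoetherianRing k Z
  have hq : q.Prime := Fact.out
  let Q : ℕ →o Ideal Z := monotone_nat_of_le_succ
    (f := fun n => (X.centralIdeal I).comap (iterateFrobenius Z q n)) (fun n z hz => by
      rw [Ideal.mem_comap, iterateFrobenius_def] at hz ⊢
      rw [pow_succ, pow_mul]
      exact Ideal.pow_mem_of_mem _ hz _ hq.pos) |> fun h => ⟨_, h⟩
  have hQ (n : ℕ) (z : Z) : z ∈ Q n ↔ z ^ q ^ n ∈ X.centralIdeal I := Iff.rfl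
  obtain ⟨N, hN⟩ := monotone_stabilizes_iff_noetherian.2 this Q
  rcases eq_bot_or_eq_top_of_stable (k := k) q (Q := Q N) hq2.le
    ((liftsCentral_and_isStable hI hq2 hA (N + 1)).2 N (Nat.lt_succ_self N)) (fun z hz => by
      rw [hN (N + 1) (Nat.le_succ N), hQ, pow_succ', pow_mul]
      exact hz) with h | h
  · right
    rw [eq_bot_iff]
    intro x hx
    refine hA.eq_zero_of_mem (𝔞 := I.map X.red) (fun z hz => ?_) hx
    have : z ∈ Q N := (hQ N z).2
      (Ideal.pow_mem_of_mem (X.centralIdeal I) hz _ (pow_pos hq.pos N))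
    rw [h, Ideal.mem_bot] at this
    rw [this, map_zero]
  · left
    have : (1 : Z) ∈ Q N := h ▸ Submodule.mem_top
    rw [hQ, one_pow] at this
    simpa [centralIdeal] using this

end Tower

end Quantization

section BaseChange

variable {R : Type*} [CommRing R] {f : R} {M : Type*} [AddCommGroup M] [Module R M]

/-- If `M_f` is free, then so is the base change of `M` to any algebra over `R_f`. -/
lemma free_tensorProduct_of_free_localizedModule
    [Module.Free (Localization.Away f) (LocalizedModule (Submonoid.powers f) M)] (B : Type*)
    [CommRing B] [Algebra R B] (hB : IsUnit (algebraMap R B f)) : Module.Free B (B ⊗[R] M) :=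
  letI : Algebra (Localization.Away f) B := (IsLocalization.Away.lift f hB).toAlgebra
  haveI : IsScalarTower R (Localization.Away f) B :=
    IsScalarTower.of_algebraMap_eq' (IsLocalization.Away.lift_comp f hB).symm
  have : Module.Free (Localization.Away f) (Localization.Away f ⊗[R] M) :=
    Module.Free.of_equiv (LocalizedModule.equivTensorProduct (Submonoid.powers f) M)
  Module.Free.of_equiv
    (TensorProduct.AlgebraTensorModule.cancelBaseChange R (Localization.Away f) B B M)

/-- An element of `M` which is not killed by any power of `f` stays nonzero after base change to
algebras in which `f` and a further nonzero element are invertible. -/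
lemma exists_tmul_ne_zero_of_free_localizedModule [IsDomain R] (hf : f ≠ 0)
    [Module.Free (Localization.Away f) (LocalizedModule (Submonoid.powers f) M)] {m : M}
    (hm : ∀ r : R, r ≠ 0 → r • m ≠ 0) : ∃ r : R, r ≠ 0 ∧ ∀ (B : Type*) [CommRing B] [Nontrivial B]
      [Algebra R B], IsUnit (algebraMap R B f) → IsUnit (algebraMap R B r) → (1 : B) ⊗ₜ[R] m ≠ 0 := by
  let b := Module.Free.chooseBasis (Localization.Away f) (LocalizedModule (Submonoid.powers f) M)
  have hm0 : LocalizedModule.mkLinearMap (Submonoid.powers f) M m ≠ 0 := fun h => by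
    rw [IsLocalizedModule.eq_zero_iff (Submonoid.powers f)] at h
    obtain ⟨⟨_, n, rfl⟩, h⟩ := h
    exact hm (f ^ n) (pow_ne_zero n hf) h
  obtain ⟨i, hi⟩ : ∃ i, b.repr (LocalizedModule.mkLinearMap (Submonoid.powers f) M m) i ≠ 0 := by
    by_contra! h
    exact hm0 (b.repr.map_eq_zero_iff.1 (Finsupp.ext h))
  let φ : M →ₗ[R] Localization.Away f :=
    ((b.coord i).restrictScalars R) ∘ₗ LocalizedModule.mkLinearMap (Submonoid.powers f) M
  obtain ⟨⟨r, s⟩, hrs⟩ := IsLocalization.surj (Submonoid.powers f) (φ m)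
  refine ⟨r, ?_, fun B _ _ _ hB hr h0 => ?_⟩
  · rintro rfl
    rw [map_zero] at hrs
    exact hi (((IsLocalization.map_units (Localization.Away f) s).mul_left_eq_zero).1 hrs)
  · letI : Algebra (Localization.Away f) B := (IsLocalization.Away.lift f hB).toAlgebra
    haveI : IsScalarTower R (Localization.Away f) B :=
      IsScalarTower.of_algebraMap_eq' (IsLocalization.Away.lift_comp f hB).symm
    let ψ : M →ₗ[R] B := (IsScalarTower.toAlgHom R (Localization.Away f) B).toLinearMap ∘ₗ φ
    have h := congrArg (TensorProduct.lift ((LinearMap.mul R B).compl₂ ψ)) h0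
    have hψ : ψ m = 0 := by simpa using h
    have h1 := congrArg (algebraMap (Localization.Away f) B) hrs
    rw [map_mul] at h1
    have h2 : algebraMap (Localization.Away f) B (φ m) = 0 := hψ
    rw [h2, zero_mul] at h1
    rw [IsScalarTower.algebraMap_apply R (Localization.Away f) B, ← h1] at hr
    exact not_isUnit_zero hr

end BaseChange

section Reduction

variable {q : ℕ} {R S k W : Type} [CommRing R] [Ring S] [Algebra R S] [Field k] [CommRing W]
  [Algebra R k] [Algebra R W] (σ : W →ₐ[R] k)

lemma exists_eq_nsmul_of_map_eq_zero (hsurj : Function.Surjective σ) [CharP k q]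
    (hker : ∀ w, σ w = 0 → ∃ w', w = q * w') {y : W ⊗[R] S}
    (hy : Algebra.TensorProduct.map σ (AlgHom.id R S) y = 0) : ∃ y', y = q • y' := by
  let μ : W →ₗ[R] W := LinearMap.mulLeft R (q : W)
  have hex : Function.Exact μ σ.toLinearMap := fun w =>
    ⟨fun h => (hker w h).imp fun w' hw' => hw'.symm, by
      rintro ⟨w', rfl⟩
      simp [μ]⟩
  obtain ⟨y', hy'⟩ := (rTensor_exact S hex hsurj y).1 hy
  refine ⟨y', ?_⟩
  rw [← hy']
  have : μ = q • LinearMap.id := by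
    ext w; simp [μ]
  rw [this]
  clear hy'
  induction y' using TensorProduct.induction_on with
  | zero => simp
  | tmul a b => simp [TensorProduct.smul_tmul']
  | add a b ha hb => rw [map_add, ha, hb, smul_add]

lemma SymplecticPoisson.exists_equiv_derivation {k Z : Type u} [CommRing k] [CommRing Z] [Algebra k Z]
    (P : SymplecticPoisson k Z) : ∃ e : Ω[Z⁄k] ≃ₗ[Z] Derivation k Z Z,
      ∀ z w, e (KaehlerDifferential.D k Z z) w = P.bracket z w :=
  P.nondeg.imp fun e he z w => by simpa using he z 1 w

/-- The quantization of the center of `k ⊗ S` given by a lift `W ⊗ S` without `q`-torsion. -/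
noncomputable def SymplecticPoisson.quantization (hsurj : Function.Surjective σ) [CharP k q]
    (hker : ∀ w, σ w = 0 → ∃ w', w = q * w')
    (htors : ∀ x : W ⊗[R] S, (q : W ⊗[R] S) * x = 0 → x = 0)
    (P : SymplecticPoisson k (Subalgebra.center k (k ⊗[R] S)))
    (hP : ∀ (z w : Subalgebra.center k (k ⊗[R] S)) (zt wt : W ⊗[R] S),
      Algebra.TensorProduct.map σ (AlgHom.id R S) zt = z →
      Algebra.TensorProduct.map σ (AlgHom.id R S) wt = w →
      ∃ c : W ⊗[R] S, (q : W ⊗[R] S) * c = zt * wt - wt * zt ∧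
        Algebra.TensorProduct.map σ (AlgHom.id R S) c = P.bracket z w) :
    Quantization q k (Subalgebra.center k (k ⊗[R] S)) (k ⊗[R] S) (W ⊗[R] S) where
  algebraMap_injective := Subtype.val_injective
  exists_algebraMap_eq a ha := ⟨⟨a, Subalgebra.mem_center_iff.2 ha⟩, rfl⟩
  red := (Algebra.TensorProduct.map σ (AlgHom.id R S)).toRingHom
  red_surjective := TensorProduct.map_surjective hsurj Function.surjective_id
  exists_of_red_eq_zero _ h := exists_eq_nsmul_of_map_eq_zero σ hsurj hker h
  eq_zero_of_smul x hx := htors x (by rwa [← nsmul_eq_mul])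
  toDer := P.exists_equiv_derivation.choose
  bracket z w zt wt hz hw := by
    obtain ⟨c, hc, hc'⟩ := hP z w zt wt hz hw
    refine ⟨c, by rw [nsmul_eq_mul, hc, Ring.lie_def], ?_⟩
    rw [P.exists_equiv_derivation.choose_spec z w]
    exact hc'

variable [IsAlgClosed k] [Fact q.Prime] [CharP k q]

/-- A two-sided ideal of `S` with nonzero image in `k ⊗ S` generates the unit ideal there, provided
that `W ⊗ (S / I)` has no `q`-torsion. -/
lemma SymplecticPoisson.one_tmul_eq_zero (hq2 : 2 < q) (hsurj : Function.Surjective σ)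
    (hker : ∀ w, σ w = 0 → ∃ w', w = q * w')
    (htors : ∀ x : W ⊗[R] S, (q : W ⊗[R] S) * x = 0 → x = 0)
    [Algebra.FiniteType k (Subalgebra.center k (k ⊗[R] S))]
    [Algebra.FormallySmooth k (Subalgebra.center k (k ⊗[R] S))]
    [IsDomain (Subalgebra.center k (k ⊗[R] S))]
    (hA : IsAzumayaOver (Subalgebra.center k (k ⊗[R] S)) (k ⊗[R] S))
    (P : SymplecticPoisson k (Subalgebra.center k (k ⊗[R] S)))
    (hP : ∀ (z w : Subalgebra.center k (k ⊗[R] S)) (zt wt : W ⊗[R] S),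
      Algebra.TensorProduct.map σ (AlgHom.id R S) zt = z →
      Algebra.TensorProduct.map σ (AlgHom.id R S) wt = w →
      ∃ c : W ⊗[R] S, (q : W ⊗[R] S) * c = zt * wt - wt * zt ∧
        Algebra.TensorProduct.map σ (AlgHom.id R S) c = P.bracket z w)
    {I : Ideal S} [I.IsTwoSided] (hI : ∀ x : W ⊗[R] (S ⧸ I), q • x = 0 → x = 0)
    {x : S} (hx : x ∈ I) (hx0 : (1 : k) ⊗ₜ[R] x ≠ 0) :
    (1 : k) ⊗ₜ[R] (1 : S ⧸ I) = 0 := by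
  have : CharP (Subalgebra.center k (k ⊗[R] S)) q := charP_of_injective_algebraMap' k q
  let π : W ⊗[R] S →ₐ[R] W ⊗[R] (S ⧸ I) :=
    Algebra.TensorProduct.map (AlgHom.id R W) (Ideal.Quotient.mkₐ R I)
  let X := P.quantization σ hsurj hker htors hP
  rcases X.one_mem_map_or_map_eq_bot (I := RingHom.ker π) (fun y hy => by
    rw [RingHom.mem_ker, map_nsmul] at hy
    exact hI _ hy) hq2 hA with h | h
  · obtain ⟨i, hi, hi'⟩ := (Ideal.mem_map_iff_of_surjective _ X.red_surjective).1 h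
    have hcomm (y : W ⊗[R] S) : Algebra.TensorProduct.map σ (AlgHom.id R (S ⧸ I)) (π y) =
        Algebra.TensorProduct.map (AlgHom.id R k) (Ideal.Quotient.mkₐ R I) (X.red y) := by
      change ((Algebra.TensorProduct.map σ (AlgHom.id R (S ⧸ I))).comp π) y =
        ((Algebra.TensorProduct.map (AlgHom.id R k) (Ideal.Quotient.mkₐ R I)).comp
          (Algebra.TensorProduct.map σ (AlgHom.id R S))) y
      congr 1
      ext <;> simp [π]
    have := hcomm i
    rw [hi', RingHom.mem_ker.1 hi, map_zero, map_one] at this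
    exact this.symm
  · refine absurd ?_ hx0
    have hmem : (1 : W) ⊗ₜ[R] x ∈ RingHom.ker π := by
      rw [RingHom.mem_ker, Algebra.TensorProduct.map_tmul, Ideal.Quotient.mkₐ_eq_mk,
        Ideal.Quotient.eq_zero_iff_mem.2 hx, TensorProduct.tmul_zero]
    have := Ideal.mem_map_of_mem X.red hmem
    rw [h, Ideal.mem_bot] at this
    have h2 : X.red ((1 : W) ⊗ₜ[R] x) = σ 1 ⊗ₜ[R] x := Algebra.TensorProduct.map_tmul _ _ _ _
    rwa [h2, map_one] at this

end Reduction

section Simple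

lemma QuantCond.exists_tmul_eq_zero {R : Type} [CommRing R] {S : Type} [Ring S] [Algebra R S] {f : R}
    {q : ℕ} [Fact q.Prime] {𝕜 : Type} [Field 𝕜] [IsAlgClosed 𝕜] [CharP 𝕜 q]
    (h : QuantCond R S f q 𝕜) (hq2 : 2 < q) {I : Ideal S} [I.IsTwoSided] {x : S} (hx : x ∈ I)
    (hfree : ∀ (B : Type) [CommRing B] [Algebra R B], IsUnit (algebraMap R B f) →
      Module.Free B (B ⊗[R] (S ⧸ I))) :
    ∃ _ : Algebra R 𝕜, IsUnit (algebraMap R 𝕜 f) ∧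
      ((1 : 𝕜) ⊗ₜ[R] x = 0 ∨ (1 : 𝕜) ⊗ₜ[R] (1 : S ⧸ I) = 0) := by
  obtain ⟨ρ, σ, hσ, h⟩ := h
  letI : Algebra R 𝕜 := ((σ.comp ρ).comp (algebraMap R (Localization.Away f))).toAlgebra
  letI : Algebra R (WittVector q 𝕜) := (ρ.comp (algebraMap R (Localization.Away f))).toAlgebra
  obtain ⟨htors, hft, hfs, hdom, hA, P, τ, hτ, hP⟩ := h
  have hf : IsUnit (algebraMap R (Localization.Away f) f) :=
    IsLocalization.Away.algebraMap_isUnit f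
  let σ' : WittVector q 𝕜 →ₐ[R] 𝕜 := { σ with commutes' := fun _ => rfl }
  have hτ' (y : WittVector q 𝕜 ⊗[R] S) :
      Algebra.TensorProduct.map σ' (AlgHom.id R S) y = τ y := by
    induction y using TensorProduct.induction_on with
    | zero => rw [map_zero, map_zero]
    | tmul w s => rw [hτ]; rfl
    | add a b ha hb => rw [map_add, map_add, ha, hb]
  have := hfree (WittVector q 𝕜) (hf.map ρ)
  refine ⟨inferInstance, hf.map (σ.comp ρ), or_iff_not_imp_left.2 fun hx0 => ?_⟩
  refine P.one_tmul_eq_zero σ' hq2 (fun a => ⟨WittVector.teichmuller q a, ?_⟩) (fun w hw => ?_) htors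
    hA (fun z w zt wt hz hw => ?_) (fun y hy => ?_) hx hx0
  · exact (hσ _).trans (WittVector.teichmuller_coeff_zero q a)
  · have h0 : w.coeff 0 = 0 := (hσ w).symm.trans hw
    exact Ideal.mem_span_singleton.1 ((WittVector.mem_span_p_iff_coeff_zero_eq_zero w).2 h0)
  · simp only [hτ'] at hz hw ⊢
    exact hP z w zt wt hz hw
  · rw [← Nat.cast_smul_eq_nsmul (WittVector q 𝕜)] at hy
    exact (smul_eq_zero.1 hy).resolve_left (WittVector.p_nonzero q 𝕜)

variable {R : Type*} [CommRing R] {F : Type*} [Field F] [Algebra R F] [IsFractionRing R F]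
  {S : Type*} [Ring S] [Algebra R S]

variable (F) in
lemma exists_smul_eq_one_tmul (y : F ⊗[R] S) :
    ∃ (r : R) (s : S), r ≠ 0 ∧ r • y = (1 : F) ⊗ₜ[R] s := by
  have : IsDomain R := (IsFractionRing.injective R F).isDomain
  induction y using TensorProduct.induction_on with
  | zero => exact ⟨1, 0, one_ne_zero, by simp⟩
  | tmul a s =>
    obtain ⟨⟨b, r⟩, hr⟩ := IsLocalization.surj (nonZeroDivisors R) a
    refine ⟨r, b • s, nonZeroDivisors.coe_ne_zero r, ?_⟩
    rw [TensorProduct.smul_tmul', Algebra.smul_def, mul_comm, hr, Algebra.algebraMap_eq_smul_one,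
      TensorProduct.smul_tmul]
  | add y z hy hz =>
    obtain ⟨r, s, hr, hs⟩ := hy
    obtain ⟨r', s', hr', hs'⟩ := hz
    refine ⟨r * r', r' • s + r • s', mul_ne_zero hr hr', ?_⟩
    rw [smul_add, mul_comm, mul_smul, hs, mul_comm, mul_smul, hs', TensorProduct.tmul_add,
      TensorProduct.tmul_smul, TensorProduct.tmul_smul]

lemma eq_of_smul_eq_smul {r : R} (hr : r ≠ 0) {y z : F ⊗[R] S} (h : r • y = r • z) : y = z := by
  have hr' : algebraMap R F r ≠ 0 := (map_ne_zero_iff _ (IsFractionRing.injective R F)).2 hr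
  rw [← algebraMap_smul F r, ← algebraMap_smul F r] at h
  exact smul_right_injective _ hr' h

lemma mem_of_smul_mem {J : Ideal (F ⊗[R] S)} {r : R} (hr : r ≠ 0) {y : F ⊗[R] S} (h : r • y ∈ J) :
    y ∈ J := by
  have hr' : algebraMap R F r ≠ 0 := (map_ne_zero_iff _ (IsFractionRing.injective R F)).2 hr
  have := J.mul_mem_left (algebraMap F (F ⊗[R] S) (algebraMap R F r)⁻¹) h
  rwa [← algebraMap_smul F r, ← Algebra.smul_def, inv_smul_smul₀ hr'] at this

end Simple

/-- Let `R` be a finitely generated subring of `ℂ` with fraction field `F`, and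
let `S` be an `R`-algebra with the generic freeness property. If for every nonzero `f ∈ R`
and every `N` there are a prime `q > max(N,2)`, an algebraically closed field `𝕜` of
characteristic `q` and a homomorphism `ρ : R_f → W(𝕜)` satisfying the good-reduction
condition `QuantCond`, then the `F`-algebra `F ⊗_R S` is simple. -/
theorem stmt_7 (R : Subring ℂ) (hR : Algebra.FiniteType ℤ ↥R)
    (S : Type) [Ring S] [Algebra ↥R S]
    (hgf : ∀ (M : Type) [AddCommGroup M] [Module ↥R M] [Module S M] [IsScalarTower ↥R S M],
      Module.Finite S M → ∃ f : ↥R, f ≠ 0 ∧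
        Module.Free (Localization.Away f) (LocalizedModule (Submonoid.powers f) M))
    (hred : ∀ f : ↥R, f ≠ 0 → ∀ N : ℕ, ∃ (q : ℕ) (hq : Fact q.Prime),
      N < q ∧ 2 < q ∧
      ∃ (𝕜 : Type) (h1 : Field 𝕜) (h2 : IsAlgClosed 𝕜) (h3 : CharP 𝕜 q),
        @QuantCond ↥R _ S _ _ f q hq 𝕜 h1 h2 h3)
    (F : Type) [Field F] [Algebra ↥R F] [IsFractionRing ↥R F]
    (J : Ideal (F ⊗[↥R] S))
    (hJ2 : ∀ x ∈ J, ∀ a : F ⊗[↥R] S, x * a ∈ J) :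
    J = ⊥ ∨ J = ⊤ := by
  by_contra! hJ
  obtain ⟨hbot, htop⟩ := hJ
  have : J.IsTwoSided := ⟨fun b ha => hJ2 _ ha b⟩
  let I : Ideal S := J.comap (Algebra.TensorProduct.includeRight : S →ₐ[↥R] F ⊗[↥R] S)
  have hI (s : S) : s ∈ I ↔ (1 : F) ⊗ₜ[↥R] s ∈ J := Iff.rfl
  obtain ⟨y, hy, hy0⟩ := Submodule.exists_mem_ne_zero_of_ne_bot hbot
  obtain ⟨r, x, hr, hx⟩ := exists_smul_eq_one_tmul F y
  have hxI : x ∈ I := by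
    rw [hI, ← hx, Algebra.smul_def]
    exact J.mul_mem_left _ hy
  have hx0 (a : ↥R) (ha : a ≠ 0) : a • x ≠ 0 := fun h => by
    refine hy0 (eq_of_smul_eq_smul hr (eq_of_smul_eq_smul ha ?_))
    rw [hx, ← TensorProduct.tmul_smul, h, TensorProduct.tmul_zero, smul_zero, smul_zero]
  have h10 (a : ↥R) (ha : a ≠ 0) : a • (1 : S ⧸ I) ≠ 0 := fun h => by
    have h' : a • (1 : S) ∈ I := Ideal.Quotient.eq_zero_iff_mem.1 h
    rw [hI, TensorProduct.tmul_smul] at h'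
    exact htop ((Ideal.eq_top_iff_one _).2 (mem_of_smul_mem ha h'))
  obtain ⟨f₁, hf₁, hfree₁⟩ := hgf (S ⧸ I) inferInstance
  obtain ⟨f₂, hf₂, hfree₂⟩ := hgf S inferInstance
  obtain ⟨r₁, hr₁, hne₁⟩ := exists_tmul_ne_zero_of_free_localizedModule hf₁ h10
  obtain ⟨r₂, hr₂, hne₂⟩ := exists_tmul_ne_zero_of_free_localizedModule hf₂ hx0
  obtain ⟨q, hq, -, hq2, 𝕜, h1, h2, h3, h⟩ := hred (f₁ * f₂ * (r₁ * r₂))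
    (mul_ne_zero (mul_ne_zero hf₁ hf₂) (mul_ne_zero hr₁ hr₂)) 0
  obtain ⟨_, hu, h⟩ := h.exists_tmul_eq_zero hq2 hxI fun B _ _ hB => by
    rw [map_mul, map_mul, IsUnit.mul_iff, IsUnit.mul_iff] at hB
    exact free_tensorProduct_of_free_localizedModule B hB.1.1
  rw [map_mul, map_mul, map_mul, IsUnit.mul_iff, IsUnit.mul_iff, IsUnit.mul_iff] at hu
  rcases h with h | h
  · exact hne₂ 𝕜 hu.1.2 hu.2.2 h
  · exact hne₁ 𝕜 hu.1.1 hu.2.1 h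
end

section
/- Let A be a deformation quantization of A₁ over W_n(k) with n ≥ 2, and let ψ : A/pA ≅ A₁ be its structural isomorphism. Let m be an ideal of S = Z(A₁) such that (m ∩ S^{p^{n−1}})·S ≠ m, and let I = { a ∈ A : ψ(a mod p) ∈ m·A₁ } be the preimage in A of the two-sided ideal m·A₁ of A₁. Then I is a two-sided ideal of A which is not generated by its central elements: I is strictly larger than the two-sided ideal of A generated by I ∩ Z(A). -/
universe u

open scoped TensorProduct

theorem TruncatedWittVector.exists_eq_mul_pow_of_mul_p_eq_zero {p : ℕ} [Fact p.Prime]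
    {k : Type*} [Field k] [CharP k p] [PerfectRing k p] {n : ℕ}
    {w : TruncatedWittVector p n k} (hw : w * (p : TruncatedWittVector p n k) = 0) :
    ∃ v : TruncatedWittVector p n k, w = v * (p : TruncatedWittVector p n k) ^ (n - 1) := by
  obtain ⟨x, rfl⟩ := WittVector.truncate_surjective p n k w
  by_cases hx : x = 0
  · exact ⟨0, by simp [hx]⟩
  obtain ⟨m, b, hb, rfl⟩ := WittVector.exists_eq_pow_p_mul x hx
  have hm : n - 1 ≤ m := by
    by_contra! hlt
    have hmem : (p : WittVector p k) ^ m * b * p ∈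
        RingHom.ker (WittVector.truncate (p := p) n) := by
      rw [RingHom.mem_ker, map_mul, map_natCast]
      exact hw
    rw [WittVector.mem_ker_truncate] at hmem
    have h := hmem (m + 1) (by omega)
    rw [mul_comm _ b, mul_assoc, ← pow_succ] at h
    have h2 := WittVector.mul_pow_charP_coeff_succ b (m := 0) (n := m + 1)
    rw [zero_add, h] at h2
    exact hb (pow_eq_zero_iff (pow_ne_zero _ (Fact.out : p.Prime).ne_zero) |>.mp h2.symm)
  refine ⟨WittVector.truncate n (p ^ (m - (n - 1)) * b), ?_⟩
  rw [← map_natCast (WittVector.truncate (p := p) (R := k) n), ← map_pow, ← map_mul]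
  congr 1
  rw [mul_assoc, mul_comm b, ← mul_assoc, ← pow_add, Nat.sub_add_cancel hm]

theorem TruncatedWittVector.exists_eq_pow_mul_of_flat {p : ℕ} [Fact p.Prime]
    {k : Type*} [Field k] [CharP k p] [PerfectRing k p] {n : ℕ}
    {A : Type*} [Ring A] [Algebra (TruncatedWittVector p n k) A]
    [Module.Flat (TruncatedWittVector p n k) A] {a : A} (ha : (p : A) * a = 0) :
    ∃ b : A, a = (p : A) ^ (n - 1) * b := by
  have key : ∑ i : Fin 1, (fun _ : Fin 1 => (p : TruncatedWittVector p n k)) i •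
      (fun _ : Fin 1 => a) i = 0 := by
    simp [Algebra.smul_def, ha]
  obtain ⟨l, c, y, h1, h2⟩ := Module.Flat.iff_forall_isTrivialRelation.mp ‹_› key
  have h3 : ∀ j : Fin l, ∃ v, c 0 j = v * (p : TruncatedWittVector p n k) ^ (n - 1) := fun j =>
    exists_eq_mul_pow_of_mul_p_eq_zero (by
      have h := h2 j
      rw [Fin.sum_univ_one] at h
      rw [mul_comm]
      exact h)
  choose v hv using h3
  refine ⟨∑ j, v j • y j, ?_⟩
  rw [show a = _ from h1 0, Finset.mul_sum]
  refine Finset.sum_congr rfl fun j _ => ?_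
  rw [hv, mul_comm, mul_smul, Algebra.smul_def, map_pow, map_natCast]

/-- If multiplication by `s` maps a faithful finite projective module `M` into `J M`,
then `s ∈ J`. -/
theorem Ideal.mem_of_smul_mem_smul_top {S M : Type*} [CommRing S] [AddCommGroup M]
    [Module S M] [Module.Finite S M] [Module.Projective S M] [FaithfulSMul S M]
    {J : Ideal S} {s : S} (hs : ∀ x : M, s • x ∈ J • (⊤ : Submodule S M)) : s ∈ J := by
  obtain ⟨N, f, g, -, -, hfg⟩ := Module.Finite.exists_comp_eq_id_of_projective S M
  let T : Ideal S := Ideal.span {t | ∃ (φ : M →ₗ[S] S) (x : M), φ x = t}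
  have hT : (⊤ : Submodule S M) ≤ T • (⊤ : Submodule S M) := by
    intro x _
    have hx : x = ∑ i, g x i • f (Pi.single i 1) := by
      conv_lhs => rw [← LinearMap.id_apply (R := S) x, ← hfg, LinearMap.comp_apply]
      conv_lhs => rw [pi_eq_sum_univ' (g x)]
      simp [map_sum]
    rw [hx]
    exact Submodule.sum_mem _ fun i _ => Submodule.smul_mem_smul
      (Ideal.subset_span ⟨LinearMap.proj i ∘ₗ g, x, rfl⟩) trivial
  obtain ⟨r, hr, h0⟩ := Submodule.exists_sub_one_mem_and_smul_eq_zero_of_fg_of_le_smul T ⊤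
    Module.Finite.fg_top hT
  have hr0 : r = 0 := FaithfulSMul.eq_of_smul_eq_smul (α := M) fun x => by
    rw [h0 x trivial, zero_smul]
  have hone : (1 : S) ∈ T := by simpa [hr0] using T.neg_mem hr
  have hTs : T ≤ Submodule.comap (LinearMap.mulRight S s) J := by
    refine Ideal.span_le.mpr ?_
    rintro _ ⟨φ, x, rfl⟩
    have hle : J • (⊤ : Submodule S M) ≤ Submodule.comap φ J := by
      refine Submodule.smul_le.mpr fun r hr y _ => ?_
      rw [Submodule.mem_comap, map_smul, smul_eq_mul]
      exact J.mul_mem_right _ hr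
    have h2 : φ (s • x) ∈ J := hle (hs x)
    simpa [mul_comm] using h2
  simpa using hTs hone

theorem Ideal.mem_span_of_algebraMap_mem_span_image {S B : Type*} [CommRing S] [Ring B]
    [Algebra S B] [Module.Finite S B] [Module.Projective S B] [FaithfulSMul S B]
    {X : Set S} {s : S} (hs : algebraMap S B s ∈ Ideal.span (algebraMap S B '' X)) :
    s ∈ Ideal.span X := by
  have hle : ∀ b ∈ Ideal.span (algebraMap S B '' X), ∀ x : B,
      b * x ∈ Ideal.span X • (⊤ : Submodule S B) := by
    intro b hb
    induction hb using Submodule.span_induction with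
    | mem y hy =>
      obtain ⟨t, ht, rfl⟩ := hy
      intro x
      rw [← Algebra.smul_def]
      exact Submodule.smul_mem_smul (Ideal.subset_span ht) trivial
    | zero => intro x; simp
    | add y z _ _ hy hz => intro x; rw [add_mul]; exact Submodule.add_mem _ (hy x) (hz x)
    | smul c y _ hy =>
      intro x
      have hc : (Ideal.span X • (⊤ : Submodule S B)).map (LinearMap.mulLeft S c) ≤
          Ideal.span X • (⊤ : Submodule S B) := by
        rw [Submodule.map_smul'']
        exact Submodule.smul_mono le_rfl le_top
      rw [smul_eq_mul, mul_assoc]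
      exact hc ⟨_, hy x, rfl⟩
  refine Ideal.mem_of_smul_mem_smul_top (M := B) fun x => ?_
  rw [Algebra.smul_def s x]
  exact hle _ hs x

theorem Ideal.mul_mem_span_image_algebraMap {S B : Type*} [CommRing S] [Ring B]
    [Algebra S B] {X : Set S} {x : B} (hx : x ∈ Ideal.span (algebraMap S B '' X)) (a : B) :
    x * a ∈ Ideal.span (algebraMap S B '' X) := by
  induction hx using Submodule.span_induction with
  | mem y hy =>
    obtain ⟨t, ht, rfl⟩ := hy
    rw [Algebra.commutes]
    exact Ideal.mul_mem_left _ _ (Ideal.subset_span ⟨t, ht, rfl⟩)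
  | zero => simp
  | add y z _ _ hy hz => rw [add_mul]; exact add_mem hy hz
  | smul c y _ hy => rw [smul_mul_assoc]; exact Submodule.smul_mem _ c hy

section Commutator

variable {A : Type*} [Ring A]

/-- Second order expansion of `v ^ (N + 2) * a` in terms of iterated commutators. -/
theorem exists_pow_mul_eq_of_commutator {p r : ℕ} {v a c e e' : A}
    (h₁ : v * a = a * v + (p ^ r) • c) (h₂ : v * c = c * v + p • e)
    (h₃ : v * e = e * v + p • e') (N : ℕ) :
    ∃ f : A, v ^ (N + 2) * a = a * v ^ (N + 2) + ((N + 2) * p ^ r) • (c * v ^ (N + 1)) +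
      ((N + 2).choose 2 * p ^ (r + 1)) • (e * v ^ N) + (p ^ (r + 2)) • f := by
  induction N with
  | zero =>
    refine ⟨0, ?_⟩
    have : v ^ 2 * a = v * (v * a) := by rw [pow_two, mul_assoc]
    rw [zero_add, this, h₁, mul_add, ← mul_assoc, h₁, mul_smul_comm, h₂]
    simp only [add_mul, smul_mul_assoc, mul_assoc, pow_two, pow_zero, pow_one, mul_one,
      Nat.choose_self, zero_add]
    module
  | succ N ih =>
    obtain ⟨f, hf⟩ := ih
    refine ⟨v * f + ((N + 2).choose 2) • (e' * v ^ N), ?_⟩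
    have hc : (N + 1 + 2).choose 2 = (N + 2) + (N + 2).choose 2 := by
      rw [Nat.choose_succ_succ' (N + 2) 1, Nat.choose_one_right]
    rw [pow_succ' v (N + 1 + 1), mul_assoc, show N + 1 + 1 = N + 2 from rfl, hf, hc]
    simp only [mul_add, mul_smul_comm, ← mul_assoc v, h₁, h₂, h₃]
    simp only [add_mul, smul_mul_assoc, mul_assoc, ← pow_succ']
    module

/-- If `v` and its commutators are central modulo `p`, then `[v ^ p, a]` is divisible by one more
power of `p` than `[v, a]`. -/
theorem exists_commutator_pow_p {B S : Type*} [Ring B] [CommRing S] [Algebra S B]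
    {p : ℕ} (hp : p.Prime) (hp2 : 2 < p) {π : A →+* B}
    (hker : ∀ a : A, π a = 0 ↔ ∃ b : A, a = (p : A) * b) {v : A} {s : S}
    (hv : π v = algebraMap S B s) {r : ℕ} {a c : A}
    (h : v * a - a * v = (p : A) ^ r * c) :
    ∃ c' : A, v ^ p * a - a * v ^ p = (p : A) ^ (r + 1) * c' ∧ π c' = π c * π v ^ (p - 1) := by
  have hcomm : ∀ x : A, ∃ e : A, v * x = x * v + p • e := by
    intro x
    obtain ⟨e, he⟩ := (hker (v * x - x * v)).mp (by
      rw [map_sub, map_mul, map_mul, hv, Algebra.commutes, sub_self])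
    exact ⟨e, by rw [nsmul_eq_mul, ← he]; abel⟩
  obtain ⟨e, he⟩ := hcomm c
  obtain ⟨e', he'⟩ := hcomm e
  have h₁ : v * a = a * v + (p ^ r) • c := by
    rw [nsmul_eq_mul, Nat.cast_pow, ← h]; abel
  obtain ⟨N, rfl⟩ : ∃ N, p = N + 2 := ⟨p - 2, by omega⟩
  obtain ⟨f, hf⟩ := exists_pow_mul_eq_of_commutator h₁ he he' N
  obtain ⟨q, hq⟩ : N + 2 ∣ (N + 2).choose 2 := hp.dvd_choose_self two_ne_zero hp2
  refine ⟨c * v ^ (N + 1) + ((N + 2 : ℕ) : A) * (q • (e * v ^ N) + f), ?_, ?_⟩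
  · rw [hf, hq, ← Nat.cast_pow, ← nsmul_eq_mul, ← nsmul_eq_mul]
    module
  · have hz : π (((N + 2 : ℕ) : A) * (q • (e * v ^ N) + f)) = 0 := (hker _).mpr ⟨_, rfl⟩
    rw [map_add, hz, add_zero, map_mul, map_pow]
    rfl

theorem exists_commutator_pow_pow {B S : Type*} [Ring B] [CommRing S] [Algebra S B]
    {p : ℕ} (hp : p.Prime) (hp2 : 2 < p) {π : A →+* B}
    (hker : ∀ a : A, π a = 0 ↔ ∃ b : A, a = (p : A) * b) {u : A} {s : S}
    (hu : π u = algebraMap S B s) {a c : A} (h : u * a - a * u = (p : A) * c) (m : ℕ) :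
    ∃ c' : A, u ^ p ^ m * a - a * u ^ p ^ m = (p : A) ^ (m + 1) * c' ∧
      π c' = π c * π u ^ (p ^ m - 1) := by
  induction m with
  | zero => exact ⟨c, by simpa using h, by simp⟩
  | succ m ih =>
    obtain ⟨c₁, h₁, h₁'⟩ := ih
    have hv : π (u ^ p ^ m) = algebraMap S B (s ^ p ^ m) := by rw [map_pow, hu, map_pow]
    obtain ⟨c₂, h₂, h₂'⟩ := exists_commutator_pow_p hp hp2 hker hv h₁
    refine ⟨c₂, by rw [pow_succ p, pow_mul]; exact h₂, ?_⟩
    rw [h₂', h₁', map_pow, mul_assoc, ← pow_mul, ← pow_add]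
    congr 2
    have h1 : 1 ≤ p ^ m := Nat.one_le_pow _ _ hp.pos
    have h2 : p ^ m ≤ p ^ m * p := Nat.le_mul_of_pos_right _ hp.pos
    rw [Nat.mul_sub, pow_succ]
    omega

end Commutator

section Hochschild

open PowerSeries

variable {k S : Type*} [Field k] [CommRing S] [Algebra k S]

/-- The exponential of a derivation in characteristic `p`, truncated in degrees `≥ p`
(where the inverse factorials vanish). -/
noncomputable def Derivation.truncExp (D : Derivation k S S) (a : S) : S⟦X⟧ :=
  PowerSeries.mk fun i => ((i.factorial : k)⁻¹) • D^[i] a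

theorem Derivation.coeff_truncExp (D : Derivation k S S) (a : S) (i : ℕ) :
    coeff i (D.truncExp a) = ((i.factorial : k)⁻¹) • D^[i] a := by
  simp [truncExp]

variable {p : ℕ} [Fact p.Prime] [CharP k p]

omit [Fact p.Prime] in
theorem natCast_ne_zero_of_lt_char {i : ℕ} (h0 : 0 < i) (hi : i < p) : (i : k) ≠ 0 := by
  rw [Ne, CharP.cast_eq_zero_iff k p]
  exact Nat.not_dvd_of_pos_of_lt h0 hi

omit [Fact p.Prime] in
theorem Derivation.coeff_derivative_truncExp (D : Derivation k S S) (a : S) {i : ℕ}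
    (hi : i + 1 < p) :
    coeff i (d⁄dX S (D.truncExp a)) = coeff i (D.truncExp (D a)) := by
  have h := natCast_ne_zero_of_lt_char (k := k) (Nat.succ_pos i) hi
  rw [coeff_derivative, coeff_truncExp, coeff_truncExp, Function.iterate_succ_apply,
    Nat.factorial_succ, Nat.cast_mul, mul_inv, mul_comm, ← Nat.cast_succ, ← nsmul_eq_mul,
    ← Nat.cast_smul_eq_nsmul k, smul_smul, ← mul_assoc, mul_inv_cancel₀ h, one_mul]

omit [Fact p.Prime] in
theorem Derivation.coeff_truncExp_mul (D : Derivation k S S) {i : ℕ} (hi : i < p) (a b : S) :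
    coeff i (D.truncExp (a * b)) = coeff i (D.truncExp a * D.truncExp b) := by
  induction i using Nat.strong_induction_on generalizing a b with
  | _ i ih =>
  cases i with
  | zero => simp [truncExp]
  | succ i =>
    have h := natCast_ne_zero_of_lt_char (k := k) (Nat.succ_pos i) hi
    have key : coeff i (d⁄dX S (D.truncExp (a * b))) =
        coeff i (d⁄dX S (D.truncExp a * D.truncExp b)) := by
      rw [coeff_derivative_truncExp D _ hi, D.leibniz, smul_eq_mul, smul_eq_mul,
        Derivation.leibniz, smul_eq_mul, smul_eq_mul]
      have hadd : ∀ x y : S, D.truncExp (x + y) = D.truncExp x + D.truncExp y := by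
        intro x y
        ext j
        simp [coeff_truncExp, iterate_map_add]
      rw [hadd, map_add, map_add, ih i (Nat.lt_succ_self i) (by omega),
        ih i (Nat.lt_succ_self i) (by omega)]
      simp only [coeff_mul]
      congr 1 <;> refine Finset.sum_congr rfl fun x hx => ?_ <;>
        rw [coeff_derivative_truncExp D _ (lt_of_le_of_lt (Nat.succ_le_succ (by
          have := Finset.HasAntidiagonal.mem_antidiagonal.mp hx; omega : x.2 ≤ i)) hi)]
    rw [coeff_derivative, coeff_derivative] at key
    have hu : IsUnit ((i : S) + 1) := by
      have := (IsUnit.mk0 _ h).map (algebraMap k S)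
      simpa using this
    exact hu.mul_right_cancel key

omit [Fact p.Prime] in
theorem Derivation.coeff_truncExp_pow (D : Derivation k S S) (a : S) (m : ℕ) {i : ℕ}
    (hi : i < p) : coeff i (D.truncExp (a ^ m)) = coeff i (D.truncExp a ^ m) := by
  induction m generalizing i with
  | zero =>
    rw [pow_zero, pow_zero, coeff_truncExp, coeff_one]
    cases i with
    | zero => simp
    | succ i => simp [Function.iterate_succ_apply, iterate_map_zero]
  | succ m ih =>
    rw [pow_succ, pow_succ, coeff_truncExp_mul D hi, coeff_mul, coeff_mul]
    exact Finset.sum_congr rfl fun x hx => by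
      rw [ih (lt_of_le_of_lt (by
        have := Finset.HasAntidiagonal.mem_antidiagonal.mp hx; omega) hi)]

/-- The coefficient of `X ^ (p - 1)` in `G ^ (p - 1) * G'` is the `p`-th power of the linear
coefficient of `G` in characteristic `p`. -/
theorem PowerSeries.coeff_pow_mul_derivative [CharP S p] (G : S⟦X⟧) :
    coeff (p - 1) (G ^ (p - 1) * d⁄dX S G) = coeff 1 G ^ p := by
  have hpp : p.Prime := Fact.out
  obtain ⟨q, rfl⟩ : ∃ q, p = q + 1 := ⟨p - 1, by have := hpp.pos; omega⟩
  rw [Nat.add_sub_cancel]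
  let R := MvPolynomial S ℤ
  let φ : R →+* S := (MvPolynomial.aeval (id : S → S)).toRingHom
  have hφ : Function.Surjective φ := fun s => ⟨MvPolynomial.X s, MvPolynomial.aeval_X _ _⟩
  obtain ⟨F, rfl⟩ := PowerSeries.map_surjective φ hφ G
  have hF : coeff q (F ^ q * d⁄dX R F) = coeff (q + 1) (F ^ (q + 1)) := by
    have h1 : d⁄dX R (F ^ (q + 1)) = ((q + 1 : ℕ) : R⟦X⟧) * (F ^ q * d⁄dX R F) := by
      rw [Derivation.leibniz_pow, Nat.add_sub_cancel, nsmul_eq_mul, smul_eq_mul]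
    have h2 := congrArg (coeff q) h1
    rw [coeff_derivative, ← nsmul_eq_mul, map_nsmul, nsmul_eq_mul, mul_comm] at h2
    have hne : ((q + 1 : ℕ) : R) ≠ 0 := Nat.cast_ne_zero.mpr (Nat.succ_ne_zero q)
    exact (mul_left_cancel₀ hne (by simpa using h2)).symm
  have hd : d⁄dX S (PowerSeries.map φ F) = PowerSeries.map φ (d⁄dX R F) := by
    ext i
    rw [coeff_derivative, PowerSeries.coeff_map, PowerSeries.coeff_map, coeff_derivative]
    simp
  rw [hd, ← map_pow, ← map_mul, PowerSeries.coeff_map, hF, ← PowerSeries.coeff_map, map_pow]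
  generalize PowerSeries.map φ F = H
  have hH : PowerSeries.map (frobenius S (q + 1)) (H.expand (q + 1) q.succ_ne_zero) =
    H ^ (q + 1) := MvPowerSeries.map_frobenius_expand (q + 1) q.succ_ne_zero
  have h3 := coeff_expand_mul (q + 1) q.succ_ne_zero H 1
  rw [mul_one] at h3
  rw [← hH, PowerSeries.coeff_map, h3, frobenius_def]

/-- Hochschild's identity for the Cartier operator: for a derivation `D` in characteristic `p`,
`D ^ (p - 1) (g ^ (p - 1) * D g) = g ^ (p - 1) * D ^ p g - (D g) ^ p`. -/
theorem Derivation.iterate_pow_mul_apply [CharP S p] (D : Derivation k S S) (g : S) :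
    D^[p - 1] (g ^ (p - 1) * D g) = g ^ (p - 1) * D^[p] g - D g ^ p := by
  have hpp : p.Prime := Fact.out
  have hlt : p - 1 < p := Nat.sub_lt hpp.pos one_pos
  have hwil : ((p - 1).factorial : k) = -1 := by
    have h := congrArg (ZMod.castHom (dvd_refl p) k) (ZMod.wilsons_lemma p)
    rwa [_root_.map_natCast, map_neg, map_one] at h
  have h1 : coeff (p - 1) (D.truncExp (g ^ (p - 1) * D g)) =
      coeff (p - 1) (D.truncExp g ^ (p - 1) * D.truncExp (D g)) := by
    rw [coeff_truncExp_mul D hlt, coeff_mul, coeff_mul]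
    exact Finset.sum_congr rfl fun x hx => by
      rw [coeff_truncExp_pow D _ _ (lt_of_le_of_lt (by
        have := Finset.HasAntidiagonal.mem_antidiagonal.mp hx; omega) hlt)]
  have h2 : coeff (p - 1) (D.truncExp g ^ (p - 1) * D.truncExp (D g)) =
      coeff (p - 1) (D.truncExp g ^ (p - 1) * d⁄dX S (D.truncExp g)) - g ^ (p - 1) * D^[p] g := by
    have hmem : ((0, p - 1) : ℕ × ℕ) ∈ Finset.HasAntidiagonal.antidiagonal (p - 1) := by simp
    rw [coeff_mul, coeff_mul, ← Finset.add_sum_erase _ _ hmem, ← Finset.add_sum_erase _ _ hmem]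
    have hrest : ∀ x ∈ (Finset.HasAntidiagonal.antidiagonal (p - 1)).erase (0, p - 1),
        coeff x.1 (D.truncExp g ^ (p - 1)) * coeff x.2 (D.truncExp (D g)) =
          coeff x.1 (D.truncExp g ^ (p - 1)) * coeff x.2 (d⁄dX S (D.truncExp g)) := by
      rintro ⟨i, j⟩ hx
      rw [Finset.mem_erase, Finset.HasAntidiagonal.mem_antidiagonal] at hx
      have hj : j + 1 < p := by
        rcases Nat.eq_zero_or_pos i with rfl | hi
        · exact absurd (by simpa using hx.2) (by simpa using hx.1)
        · have := hx.2
          simp only at this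
          omega
      rw [coeff_derivative_truncExp D g hj]
    rw [Finset.sum_congr rfl hrest]
    have hz : coeff (p - 1) (d⁄dX S (D.truncExp g)) = 0 := by
      rw [coeff_derivative, ← Nat.cast_succ, Nat.succ_eq_add_one, Nat.sub_add_cancel hpp.one_le,
        CharP.cast_eq_zero, mul_zero]
    have hc : coeff (p - 1) (D.truncExp (D g)) = - D^[p] g := by
      rw [coeff_truncExp, hwil, ← Function.iterate_succ_apply, Nat.succ_eq_add_one,
        Nat.sub_add_cancel hpp.one_le, inv_neg, inv_one, neg_smul, one_smul]
    have h0 : coeff 0 (D.truncExp g ^ (p - 1)) = g ^ (p - 1) := by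
      rw [coeff_zero_eq_constantCoeff_apply, map_pow, ← coeff_zero_eq_constantCoeff_apply,
        coeff_truncExp]
      simp
    simp only [hz, hc, h0]
    ring
  rw [h2, PowerSeries.coeff_pow_mul_derivative, coeff_truncExp, coeff_truncExp, hwil] at h1
  simp only [Nat.factorial_one, Nat.cast_one, inv_neg, inv_one, neg_smul, one_smul,
    Function.iterate_one] at h1
  linear_combination -h1

open TensorProduct in
variable (p) in
/-- In characteristic `p` the `p`-th iterate of a derivation is a derivation. -/
noncomputable def Derivation.iteratePow (D : Derivation k S S) : Derivation k S S :=
  Derivation.mk' ((D : S →ₗ[k] S) ^ p) fun a b => by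
    let d : Module.End k S := (D : S →ₗ[k] S)
    let x : Module.End k (S ⊗[k] S) := d.rTensor S
    let y : Module.End k (S ⊗[k] S) := d.lTensor S
    let μ : S ⊗[k] S →ₗ[k] S := LinearMap.mul' k S
    have hμ : ∀ t, μ ((x + y) t) = d (μ t) := by
      intro t
      induction t with
      | zero => rw [map_zero, map_zero, map_zero]
      | tmul a b =>
        change μ (D a ⊗ₜ b + a ⊗ₜ D b) = D (a * b)
        rw [map_add, LinearMap.mul'_apply, LinearMap.mul'_apply, D.leibniz, smul_eq_mul,
          smul_eq_mul]
        ring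
      | add s t hs ht => rw [map_add, map_add, map_add, map_add, hs, ht]
    have hμ' : ∀ (n : ℕ) t, μ (((x + y) ^ n) t) = (d ^ n) (μ t) := by
      intro n
      induction n with
      | zero => intro t; rfl
      | succ n ih =>
        intro t
        rw [pow_succ', pow_succ', Module.End.mul_apply, Module.End.mul_apply, hμ, ih]
    have hcomm : Commute x y := TensorProduct.ext' fun a b => rfl
    have hx : ∀ n, (x ^ n) (a ⊗ₜ b) = (d ^ n) a ⊗ₜ b := fun n => by
      rw [LinearMap.rTensor_pow, LinearMap.rTensor_tmul]
    have hy : ∀ n, (y ^ n) (a ⊗ₜ b) = a ⊗ₜ (d ^ n) b := fun n => by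
      rw [LinearMap.lTensor_pow, LinearMap.lTensor_tmul]
    obtain ⟨r, hr⟩ := hcomm.exists_add_pow_prime_eq (Fact.out : p.Prime)
    have hp0 : (p : Module.End k (S ⊗[k] S)) = 0 := by
      refine LinearMap.ext fun t => ?_
      rw [Module.End.natCast_apply, ← Nat.cast_smul_eq_nsmul k, CharP.cast_eq_zero, zero_smul,
        LinearMap.zero_apply]
    have h := hμ' p (a ⊗ₜ b)
    rw [hr, hp0, zero_mul, zero_mul, zero_mul, add_zero, LinearMap.add_apply, hx, hy, map_add,
      LinearMap.mul'_apply, LinearMap.mul'_apply, LinearMap.mul'_apply] at h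
    rw [← h, smul_eq_mul, smul_eq_mul]
    ring

theorem Derivation.iteratePow_apply (D : Derivation k S S) (a : S) :
    D.iteratePow p a = D^[p] a :=
  Module.End.pow_apply _ _ _

omit [Fact p.Prime] [CharP k p] in
theorem Derivation.iterate_pow_p_mul [CharP S p] (D : Derivation k S S) (f x : S) (n : ℕ) :
    D^[n] (f ^ p * x) = f ^ p * D^[n] x := by
  induction n with
  | zero => rfl
  | succ n ih =>
    rw [Function.iterate_succ_apply', ih, D.leibniz, D.leibniz_pow,
      ← Nat.cast_smul_eq_nsmul S, CharP.cast_eq_zero, zero_smul, smul_zero, add_zero,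
      smul_eq_mul, Function.iterate_succ_apply']

/-- If `∑ u_j ^ (p ^ (r - j) - 1) d u_j` vanishes on all derivations, then so does `d u_0`. -/
theorem Derivation.apply_eq_zero_of_sum_pow_mul_eq_zero [CharP S p] [IsReduced S] (u : ℕ → S)
    (r : ℕ) (h : ∀ D : Derivation k S S,
      ∑ j ∈ Finset.range (r + 1), u j ^ (p ^ (r - j) - 1) * D (u j) = 0)
    (D : Derivation k S S) : D (u 0) = 0 := by
  have hpp : p.Prime := Fact.out
  induction r with
  | zero => simpa using h D
  | succ r ih =>
    refine ih fun D => ?_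
    have h1 := h (D.iteratePow p)
    have h2 := congrArg (((D : S →ₗ[k] S) ^ (p - 1) : Module.End k S)) (h D)
    rw [map_sum, map_zero, Finset.sum_range_succ] at h2
    simp only [Module.End.pow_apply, Derivation.coeFn_coe] at h2
    rw [Finset.sum_range_succ] at h1
    have hlast : D^[p - 1] (u (r + 1) ^ (p ^ (r + 1 - (r + 1)) - 1) * D (u (r + 1))) =
        u (r + 1) ^ (p ^ (r + 1 - (r + 1)) - 1) * D.iteratePow p (u (r + 1)) := by
      simp only [Nat.sub_self, pow_zero, one_mul, iteratePow_apply]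
      rw [← Function.iterate_succ_apply, Nat.succ_eq_add_one, Nat.sub_add_cancel hpp.one_le]
    have hterm : ∀ j ∈ Finset.range (r + 1),
        D^[p - 1] (u j ^ (p ^ (r + 1 - j) - 1) * D (u j)) =
          u j ^ (p ^ (r + 1 - j) - 1) * D.iteratePow p (u j) -
            (u j ^ (p ^ (r - j) - 1) * D (u j)) ^ p := by
      intro j hj
      have hj' : j ≤ r := Nat.lt_succ_iff.mp (Finset.mem_range.mp hj)
      have hexp : p ^ (r + 1 - j) - 1 = (p ^ (r - j) - 1) * p + (p - 1) := by
        have h1 : 1 ≤ p ^ (r - j) := Nat.one_le_pow _ _ hpp.pos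
        have h2 : p ≤ p ^ (r - j) * p := Nat.le_mul_of_pos_left _ (by omega)
        have h3 := hpp.pos
        rw [Nat.succ_sub hj', pow_succ, Nat.sub_mul]
        omega
      rw [hexp, pow_add, pow_mul, mul_assoc, iterate_pow_p_mul, iterate_pow_mul_apply,
        iteratePow_apply]
      ring
    rw [Finset.sum_congr rfl hterm, Finset.sum_sub_distrib, hlast] at h2
    have h3 : ∑ j ∈ Finset.range (r + 1), (u j ^ (p ^ (r - j) - 1) * D (u j)) ^ p = 0 := by
      linear_combination h1 - h2
    rw [← sum_pow_char] at h3
    exact pow_eq_zero_iff hpp.ne_zero |>.mp h3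

end Hochschild

section Smooth

/-- The derivation induced on the quotient by an ideal stable under a derivation. -/
noncomputable def Derivation.quotient {k R : Type*} [CommRing k] [CommRing R] [Algebra k R]
    (D : Derivation k R R) (J : Ideal R) (hJ : ∀ f ∈ J, D f ∈ J) :
    Derivation k (R ⧸ J) (R ⧸ J) :=
  have hD : ∀ f : R, Ideal.Quotient.mk J (D (Quotient.out (Ideal.Quotient.mk J f))) =
      Ideal.Quotient.mk J (D f) := fun f => by
    rw [Ideal.Quotient.eq, ← map_sub]
    exact hJ _ (Ideal.Quotient.eq.mp (Ideal.Quotient.mk_out _))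
  Derivation.mk'
    { toFun := fun x => Ideal.Quotient.mk J (D (Quotient.out x))
      map_add' := fun x y => by
        obtain ⟨f, rfl⟩ := Ideal.Quotient.mk_surjective x
        obtain ⟨g, rfl⟩ := Ideal.Quotient.mk_surjective y
        rw [← map_add, hD, hD, hD, map_add, map_add]
      map_smul' := fun c x => by
        obtain ⟨f, rfl⟩ := Ideal.Quotient.mk_surjective x
        have hsmul : ∀ g : R, Ideal.Quotient.mk J (c • g) = c • Ideal.Quotient.mk J g :=
          fun g => rfl
        rw [← hsmul, hD, hD, D.map_smul, hsmul, RingHom.id_apply] }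
    fun x y => by
      obtain ⟨f, rfl⟩ := Ideal.Quotient.mk_surjective x
      obtain ⟨g, rfl⟩ := Ideal.Quotient.mk_surjective y
      change Ideal.Quotient.mk J _ = _ * Ideal.Quotient.mk J _ + _ * Ideal.Quotient.mk J _
      rw [← map_mul, hD, hD, hD, D.leibniz, map_add, smul_eq_mul, smul_eq_mul, map_mul, map_mul]

theorem Derivation.quotient_mk {k R : Type*} [CommRing k] [CommRing R] [Algebra k R]
    (D : Derivation k R R) (J : Ideal R) (hJ : ∀ f ∈ J, D f ∈ J) (f : R) :
    D.quotient J hJ (Ideal.Quotient.mk J f) = Ideal.Quotient.mk J (D f) := by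
  change Ideal.Quotient.mk J _ = _
  rw [Ideal.Quotient.eq, ← map_sub]
  exact hJ _ (Ideal.Quotient.eq.mp (Ideal.Quotient.mk_out _))

variable {p : ℕ} [Fact p.Prime] {k : Type*} [Field k] [CharP k p] {σ : Type*}

namespace MvPolynomial

theorem coeff_iterate_X_smul_pderiv (i : σ) (b : σ →₀ ℕ) (n : ℕ) (f : MvPolynomial σ k) :
    coeff b (((X i : MvPolynomial σ k) • pderiv (R := k) i)^[n] f) = (b i : k) ^ n * coeff b f := by
  classical
  have h1 : ∀ f : MvPolynomial σ k,
      coeff b (((X i : MvPolynomial σ k) • pderiv (R := k) i) f) = (b i : k) * coeff b f := by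
    intro f
    induction f using MvPolynomial.induction_on' with
    | monomial m c =>
      rw [Derivation.smul_apply, smul_eq_mul, X_mul_pderiv_monomial, coeff_smul, nsmul_eq_mul,
        coeff_monomial]
      split_ifs with h
      · rw [h]
      · simp
    | add f g hf hg => rw [map_add, coeff_add, hf, hg, coeff_add, mul_add]
  induction n with
  | zero => simp
  | succ n ih => rw [Function.iterate_succ_apply', h1, ih, pow_succ']; ring

/-- A `p`-th-power-linear projector onto the polynomials all of whose exponents of the variables
in `T` are divisible by `p`. -/
theorem exists_projector (T : Finset σ) :
    ∃ E : MvPolynomial σ k →+ MvPolynomial σ k,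
      (∀ g b, coeff b (E g) ≠ 0 → ∀ i ∈ T, p ∣ b i) ∧
      (∀ h g, E (h ^ p * g) = h ^ p * E g) ∧ E 1 = 1 ∧
      ∀ J : Ideal (MvPolynomial σ k), (∀ i, ∀ f ∈ J, pderiv i f ∈ J) →
        ∀ f, (∀ i, pderiv i f ∈ J) → f - E f ∈ J := by
  classical
  have hpp : p.Prime := Fact.out
  induction T using Finset.induction_on with
  | empty =>
    refine ⟨AddMonoidHom.id _, by simp, by simp, rfl, fun J _ f _ => by simp⟩
  | insert j T _ ih =>
    obtain ⟨E, hE1, hE2, hE3, hE4⟩ := ih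
    let θ : Derivation k (MvPolynomial σ k) (MvPolynomial σ k) := (X j : MvPolynomial σ k) • pderiv j
    let Θ : Module.End k (MvPolynomial σ k) := (θ : MvPolynomial σ k →ₗ[k] MvPolynomial σ k) ^ (p - 1)
    have hΘ : ∀ f, Θ f = θ^[p - 1] f := fun f => Module.End.pow_apply _ _ _
    have hΘc : ∀ b f, coeff b (Θ f) = (b j : k) ^ (p - 1) * coeff b f := fun b f => by
      rw [hΘ]; exact coeff_iterate_X_smul_pderiv j b (p - 1) f
    refine ⟨E - Θ.toAddMonoidHom.comp E, ?_, ?_, ?_, ?_⟩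
    · intro g b hb i hi
      have hb' : (1 - (b j : k) ^ (p - 1)) * coeff b (E g) ≠ 0 := by
        rw [sub_mul, one_mul, ← hΘc, ← coeff_sub]
        exact hb
      rcases Finset.mem_insert.mp hi with rfl | hi
      · by_contra hdvd
        refine left_ne_zero_of_mul hb' ?_
        have h1 : ((b i : ℕ) : ZMod p) ≠ 0 := by rwa [Ne, ZMod.natCast_eq_zero_iff]
        have h2 := congrArg (ZMod.castHom (dvd_refl p) k) (ZMod.pow_card_sub_one_eq_one h1)
        rw [map_pow, map_natCast, map_one] at h2
        rw [h2, sub_self]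
      · exact hE1 g b (right_ne_zero_of_mul hb') i hi
    · intro h g
      change E (h ^ p * g) - Θ (E (h ^ p * g)) = h ^ p * (E g - Θ (E g))
      rw [hE2, hΘ, hΘ, Derivation.iterate_pow_p_mul, mul_sub]
    · change E 1 - Θ (E 1) = 1
      have h1 : p - 1 = (p - 2) + 1 := by have := hpp.two_le; omega
      rw [hE3, hΘ, h1, Function.iterate_succ_apply, Derivation.map_one_eq_zero, iterate_map_zero,
        sub_zero]
    · intro J hJ f hf
      have hθJ : ∀ n, ∀ x ∈ J, θ^[n] x ∈ J := by
        intro n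
        induction n with
        | zero => exact fun x hx => hx
        | succ n ih =>
          intro x hx
          rw [Function.iterate_succ_apply']
          exact J.mul_mem_left _ (hJ j _ (ih x hx))
      have hf1 : Θ f ∈ J := by
        have h1 : p - 1 = (p - 2) + 1 := by have := hpp.two_le; omega
        rw [hΘ, h1, Function.iterate_succ_apply]
        exact hθJ _ _ (J.mul_mem_left _ (hf j))
      have hf2 := hE4 J hJ f hf
      have hf3 : Θ (f - E f) ∈ J := by rw [hΘ]; exact hθJ _ _ hf2
      have : f - (E f - Θ (E f)) = (f - E f) + (Θ f - Θ (f - E f)) := by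
        rw [map_sub]; ring
      change f - (E f - Θ (E f)) ∈ J
      rw [this]
      exact J.add_mem hf2 (J.sub_mem hf1 hf3)

theorem exists_eq_pow_of_forall_dvd [PerfectRing k p] {g : MvPolynomial σ k}
    (hg : ∀ b, coeff b g ≠ 0 → ∀ i, p ∣ b i) : ∃ e : MvPolynomial σ k, g = e ^ p := by
  have h : ∀ b ∈ g.support, ∃ e : MvPolynomial σ k, monomial b (coeff b g) = e ^ p := by
    intro b hb
    obtain ⟨c, hc⟩ := surjective_frobenius k p (coeff b g)
    refine ⟨monomial (b.mapRange (· / p) (Nat.zero_div p)) c, ?_⟩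
    have hpb : p • b.mapRange (· / p) (Nat.zero_div p) = b := by
      ext i
      simp [Nat.mul_div_cancel' (hg b (mem_support_iff.mp hb) i)]
    rw [monomial_pow, ← frobenius_def, hc, hpb]
  choose! e he using h
  refine ⟨∑ b ∈ g.support, e b, ?_⟩
  rw [sum_pow_char, ← Finset.sum_congr rfl he]
  exact (support_sum_monomial_coeff g).symm

theorem exists_projector_pow [PerfectRing k p] [Fintype σ] :
    ∃ E : MvPolynomial σ k →+ MvPolynomial σ k,
      (∀ g, ∃ e, E g = e ^ p) ∧
      (∀ h g, E (h ^ p * g) = h ^ p * E g) ∧ E 1 = 1 ∧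
      ∀ J : Ideal (MvPolynomial σ k), (∀ i, ∀ f ∈ J, pderiv i f ∈ J) →
        ∀ f, (∀ i, pderiv i f ∈ J) → f - E f ∈ J := by
  obtain ⟨E, h1, h2⟩ := exists_projector (p := p) (k := k) (Finset.univ : Finset σ)
  exact ⟨E, fun g => exists_eq_pow_of_forall_dvd fun b hb i => h1 g b hb i (Finset.mem_univ i), h2⟩

theorem mem_of_pow_mem_map_frobenius [PerfectRing k p] [Fintype σ] {I : Ideal (MvPolynomial σ k)}
    {f : MvPolynomial σ k} (hf : f ^ p ∈ I.map (frobenius (MvPolynomial σ k) p)) : f ∈ I := by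
  obtain ⟨E, hE1, hE2, hE3, -⟩ := exists_projector_pow (p := p) (k := k) (σ := σ)
  have key : ∀ x ∈ I.map (frobenius (MvPolynomial σ k) p), ∀ a, ∃ e ∈ I, E (a * x) = e ^ p := by
    intro x hx
    induction hx using Submodule.span_induction with
    | mem x hx =>
      obtain ⟨h, hh, rfl⟩ := hx
      intro a
      obtain ⟨e, he⟩ := hE1 a
      exact ⟨h * e, I.mul_mem_right _ hh, by rw [frobenius_def, mul_comm, hE2, he, mul_pow]⟩
    | zero => exact fun a => ⟨0, I.zero_mem, by simp [(Fact.out : p.Prime).ne_zero]⟩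
    | add x y _ _ hx hy =>
      intro a
      obtain ⟨e, he, he'⟩ := hx a
      obtain ⟨g, hg, hg'⟩ := hy a
      exact ⟨e + g, I.add_mem he hg, by rw [mul_add, map_add, he', hg', add_pow_char]⟩
    | smul c x _ hx =>
      intro a
      rw [smul_eq_mul, ← mul_assoc]
      exact hx (a * c)
  obtain ⟨e, he, he'⟩ := key _ hf 1
  rw [one_mul, ← mul_one (f ^ p), hE2, hE3, mul_one] at he'
  rwa [frobenius_inj (MvPolynomial σ k) p he']

theorem pderiv_mem_map_frobenius {I : Ideal (MvPolynomial σ k)} (i : σ) {f : MvPolynomial σ k}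
    (hf : f ∈ I.map (frobenius (MvPolynomial σ k) p)) :
    pderiv i f ∈ I.map (frobenius (MvPolynomial σ k) p) := by
  induction hf using Submodule.span_induction with
  | mem x hx =>
    obtain ⟨h, -, rfl⟩ := hx
    rw [frobenius_def, Derivation.leibniz_pow, ← Nat.cast_smul_eq_nsmul (MvPolynomial σ k),
      CharP.cast_eq_zero, zero_smul]
    exact zero_mem _
  | zero => rw [map_zero]; exact zero_mem _
  | add x y _ _ hx hy => rw [map_add]; exact add_mem hx hy
  | smul c x hx' hx =>
    rw [smul_eq_mul, Derivation.leibniz, smul_eq_mul, smul_eq_mul]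
    exact add_mem (Ideal.mul_mem_left _ _ hx) (Ideal.mul_mem_right _ _ hx')

end MvPolynomial

open MvPolynomial in
/-- A smooth algebra over a perfect field `k` is a retract of `k[x] / I ^ [p]`. -/
theorem Algebra.FormallySmooth.exists_section (S : Type*) [CommRing S] [Algebra k S]
    [hfg : Algebra.FiniteType k S] [Algebra.FormallySmooth k S] (p : ℕ) [Fact p.Prime] [CharP k p] :
    ∃ (N : ℕ) (π : MvPolynomial (Fin N) k →ₐ[k] S)
      (q : (MvPolynomial (Fin N) k ⧸
        (RingHom.ker π).map (frobenius (MvPolynomial (Fin N) k) p)) →ₐ[k] S)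
      (s : S →ₐ[k] (MvPolynomial (Fin N) k ⧸
        (RingHom.ker π).map (frobenius (MvPolynomial (Fin N) k) p))),
      (∀ f, q (Ideal.Quotient.mk _ f) = π f) ∧ ∀ x, q (s x) = x := by
  have hpp : p.Prime := Fact.out
  obtain ⟨N, π, hπ⟩ := Algebra.FiniteType.iff_quotient_mvPolynomial''.mp hfg
  set I := RingHom.ker π with hI
  set J := I.map (frobenius (MvPolynomial (Fin N) k) p) with hJ
  have hJI : ∀ f ∈ J, π f = 0 := by
    have : J ≤ I := by
      refine Ideal.map_le_iff_le_comap.mpr fun f hf => ?_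
      rw [Ideal.mem_comap, frobenius_def]
      exact I.pow_mem_of_mem hf _ hpp.pos
    exact fun f hf => this hf
  let q : (MvPolynomial (Fin N) k ⧸ J) →ₐ[k] S := Ideal.Quotient.liftₐ J π hJI
  have hq : ∀ f, q (Ideal.Quotient.mk _ f) = π f := fun f => rfl
  have hqs : Function.Surjective q := fun x => by
    obtain ⟨f, rfl⟩ := hπ x
    exact ⟨_, hq f⟩
  have hnil : IsNilpotent (RingHom.ker (q : (MvPolynomial (Fin N) k ⧸ J) →+* S)) := by
    have hrad : I ≤ J.radical := fun f hf => ⟨p, Ideal.mem_map_of_mem _ hf⟩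
    obtain ⟨M, hM⟩ := Ideal.exists_pow_le_of_le_radical_of_fg hrad (IsNoetherian.noetherian I)
    refine ⟨M, ?_⟩
    have hker : RingHom.ker (q : (MvPolynomial (Fin N) k ⧸ J) →+* S) ≤
        I.map (Ideal.Quotient.mk J) := by
      intro x hx
      obtain ⟨f, rfl⟩ := Ideal.Quotient.mk_surjective x
      exact Ideal.mem_map_of_mem _ hx
    refine le_bot_iff.mp ((Ideal.pow_right_mono hker M).trans ?_)
    rw [← Ideal.map_pow, Ideal.map_le_iff_le_comap]
    intro f hf
    rw [Ideal.mem_comap]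
    exact Ideal.Quotient.eq_zero_iff_mem.mpr (hM hf)
  exact ⟨N, π, q, Algebra.FormallySmooth.liftOfSurjective (AlgHom.id k S) q hqs hnil, hq,
    Algebra.FormallySmooth.liftOfSurjective_apply (AlgHom.id k S) q hqs hnil⟩

open MvPolynomial in
theorem Algebra.FormallySmooth.isReduced_of_perfectRing (S : Type*) [CommRing S] [Algebra k S]
    [Algebra.FiniteType k S] [Algebra.FormallySmooth k S] (p : ℕ) [Fact p.Prime] [CharP k p]
    [PerfectRing k p] : IsReduced S := by
  obtain ⟨N, π, q, s, hq, hs⟩ := exists_section (k := k) S p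
  refine (isReduced_iff_pow_one_lt p (Fact.out : p.Prime).one_lt).mpr fun x hx => ?_
  obtain ⟨f, hf⟩ := Ideal.Quotient.mk_surjective (s x)
  have hfp : f ^ p ∈ (RingHom.ker π).map (frobenius (MvPolynomial (Fin N) k) p) := by
    rw [← Ideal.Quotient.eq_zero_iff_mem, map_pow, hf, ← map_pow, hx, map_zero]
  rw [← hs x, ← hf, hq]
  exact mem_of_pow_mem_map_frobenius hfp

open MvPolynomial in
/-- Over a perfect field of characteristic `p`, functions on a smooth algebra with vanishing
differential are `p`-th powers. -/
theorem Algebra.FormallySmooth.exists_eq_pow_of_D_eq_zero {S : Type*} [CommRing S] [Algebra k S]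
    [Algebra.FiniteType k S] [Algebra.FormallySmooth k S] (p : ℕ) [Fact p.Prime] [CharP k p]
    [PerfectRing k p] {x : S} (hx : KaehlerDifferential.D k S x = 0) : ∃ y, x = y ^ p := by
  obtain ⟨N, π, h⟩ := exists_section (k := k) S p
  set J := (RingHom.ker π).map (frobenius (MvPolynomial (Fin N) k) p)
  obtain ⟨q, s, hq, hs⟩ := h
  obtain ⟨E, hE1, -, -, hE4⟩ := exists_projector_pow (p := p) (k := k) (σ := Fin N)
  obtain ⟨f, hf⟩ := Ideal.Quotient.mk_surjective (s x)
  have hJ : ∀ i, ∀ f ∈ J, pderiv i f ∈ J := fun i f hf => pderiv_mem_map_frobenius i hf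
  have hd : ∀ i, pderiv i f ∈ J := by
    intro i
    let _ := s.toRingHom.toAlgebra
    have : IsScalarTower k S (MvPolynomial (Fin N) k ⧸ J) :=
      IsScalarTower.of_algebraMap_eq fun c => (s.commutes c).symm
    let δ : Derivation k S (MvPolynomial (Fin N) k ⧸ J) :=
      ((pderiv i).quotient J (hJ i)).compAlgebraMap S
    have h1 : δ x = 0 := by
      rw [← δ.liftKaehlerDifferential_comp_D x, hx, map_zero]
    have h2 : (pderiv i).quotient J (hJ i) (s x) = 0 := h1
    rwa [← hf, Derivation.quotient_mk, Ideal.Quotient.eq_zero_iff_mem] at h2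
  obtain ⟨e, he⟩ := hE1 f
  have hfe := hE4 J hJ f hd
  rw [he] at hfe
  refine ⟨π e, ?_⟩
  rw [← hs x, ← hf, Ideal.Quotient.eq.mpr hfe, hq, map_pow]

end Smooth

section Symplectic

variable {p : ℕ} [Fact p.Prime] {k S : Type u} [Field k] [CharP k p] [PerfectRing k p]
  [CommRing S] [Algebra k S]

theorem SymplecticPoisson.exists_eq_pow_of_sum_eq_zero [Algebra.FiniteType k S]
    [Algebra.FormallySmooth k S] [Nontrivial S] (P : SymplecticPoisson k S) (s : ℕ → S) (r : ℕ)
    (h : ∀ t, ∑ j ∈ Finset.range (r + 1), s j ^ (p ^ (r - j) - 1) * P.bracket (s j) t = 0) :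
    ∃ v, s 0 = v ^ p := by
  have : CharP S p := charP_of_injective_algebraMap (algebraMap k S).injective p
  have : IsReduced S := Algebra.FormallySmooth.isReduced_of_perfectRing (k := k) S p
  obtain ⟨ι, hι⟩ := P.nondeg
  have hω : ∑ j ∈ Finset.range (r + 1),
      s j ^ (p ^ (r - j) - 1) • KaehlerDifferential.D k S (s j) = 0 := by
    refine ι.map_eq_zero_iff.mp (Derivation.ext fun t => ?_)
    have hsum := congrFun (map_sum (Derivation.coeFnAddMonoidHom (R := k) (A := S) (M := S))
      (fun j => ι (s j ^ (p ^ (r - j) - 1) • KaehlerDifferential.D k S (s j)))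
      (Finset.range (r + 1))) t
    rw [Finset.sum_apply] at hsum
    rw [map_sum, Derivation.coe_zero, Pi.zero_apply, ← h t]
    exact hsum.trans (Finset.sum_congr rfl fun j _ => hι _ _ _)
  have hD : ∀ D : Derivation k S S, D (s 0) = 0 :=
    Derivation.apply_eq_zero_of_sum_pow_mul_eq_zero s r fun D => by
      have h1 := congrArg D.liftKaehlerDifferential hω
      simpa only [map_sum, map_smul, Derivation.liftKaehlerDifferential_comp_D, smul_eq_mul,
        map_zero] using h1
  refine Algebra.FormallySmooth.exists_eq_pow_of_D_eq_zero (k := k) p ?_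
  refine ι.map_eq_zero_iff.mp (Derivation.ext fun t => ?_)
  have h1 := hι (s 0) 1 t
  have h2 := hι t 1 (s 0)
  rw [hD, one_mul] at h2
  rw [one_smul, one_mul, P.antisymm, ← h2, neg_zero] at h1
  exact h1

end Symplectic

section Center

variable {A B S : Type*} [Ring A] [Ring B] [CommRing S] [Algebra S B] {p n : ℕ}

theorem exists_eq_pow_mul_of_mul_eq_pow_succ_mul
    (htor : ∀ a : A, (p : A) * a = 0 → ∃ b : A, a = (p : A) ^ (n - 1) * b)
    {i : ℕ} (hi : i < n) {x y : A} (h : (p : A) * x = (p : A) ^ (i + 1) * y) :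
    ∃ y', x = (p : A) ^ i * y' := by
  obtain ⟨b, hb⟩ := htor (x - (p : A) ^ i * y) (by
    rw [mul_sub, h, ← mul_assoc, ← pow_succ', sub_self])
  refine ⟨y + (p : A) ^ (n - 1 - i) * b, ?_⟩
  rw [mul_add, ← mul_assoc, ← pow_add, Nat.add_sub_cancel' (by omega), ← hb]
  abel

theorem exists_eq_mul_of_pow_mul_eq_pow_succ_mul
    (htor : ∀ a : A, (p : A) * a = 0 → ∃ b : A, a = (p : A) ^ (n - 1) * b)
    {i : ℕ} (hi : i < n) {x y : A} (h : (p : A) ^ i * x = (p : A) ^ (i + 1) * y) :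
    ∃ y', x = (p : A) * y' := by
  induction i generalizing y with
  | zero => exact ⟨y, by simpa using h⟩
  | succ i ih =>
    rw [pow_succ', mul_assoc] at h
    obtain ⟨y', hy'⟩ := exists_eq_pow_mul_of_mul_eq_pow_succ_mul htor hi h
    exact ih (by omega) hy'

/-- An element central modulo `p ^ (i + 1)` is a sum of `p ^ j u_j ^ (p ^ (i - j))` modulo
`p ^ (i + 1)`, where the `u_j` are central modulo `p`. -/
theorem exists_eq_sum_of_commutator (hp : p.Prime) (hp2 : 2 < p) {π : A →+* B}
    (hinj : Function.Injective (algebraMap S B))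
    (hcen : Set.range (algebraMap S B) = (Subring.center B : Set B))
    (hsurj : Function.Surjective π)
    (hker : ∀ a : A, π a = 0 ↔ ∃ b : A, a = (p : A) * b)
    (htor : ∀ a : A, (p : A) * a = 0 → ∃ b : A, a = (p : A) ^ (n - 1) * b)
    {br : S → S → S}
    (hbr : ∀ (a b : A) (s t : S), π a = algebraMap S B s → π b = algebraMap S B t →
      ∃ c : A, (p : A) * c = a * b - b * a ∧ π c = algebraMap S B (br s t))
    (hpow : ∀ (s : ℕ → S) (r : ℕ),
      (∀ t, ∑ j ∈ Finset.range (r + 1), s j ^ (p ^ (r - j) - 1) * br (s j) t = 0) →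
        ∃ v, s 0 = v ^ p)
    {i : ℕ} (hi : i < n) {z : A} (hz : ∀ a, ∃ c, z * a - a * z = (p : A) ^ (i + 1) * c) :
    ∃ (u : ℕ → A) (s : ℕ → S) (y : A), (∀ j, π (u j) = algebraMap S B (s j)) ∧
      z = ∑ j ∈ Finset.range (i + 1), (p : A) ^ j * u j ^ p ^ (i - j) + (p : A) ^ (i + 1) * y := by
  have hcomm : ∀ {u : A} {s : S}, π u = algebraMap S B s → ∀ a, ∃ c, u * a - a * u = (p : A) * c :=
    fun {u s} hu a => (hker _).mp (by rw [map_sub, map_mul, map_mul, hu, Algebra.commutes, sub_self])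
  have hπp : ∀ (j : ℕ) (x : A), π ((p : A) ^ (j + 1) * x) = 0 := fun j x =>
    (hker _).mpr ⟨(p : A) ^ j * x, by rw [pow_succ', mul_assoc]⟩
  have hpc : ∀ (j : ℕ) (x y : A), (p : A) ^ j * x * y - y * ((p : A) ^ j * x) =
      (p : A) ^ j * (x * y - y * x) := fun j x y => by
    rw [mul_sub, ← mul_assoc y, ((Nat.cast_commute p y).pow_left j).symm.eq, mul_assoc, mul_assoc]
  induction i generalizing z with
  | zero =>
    have hc : π z ∈ (Subring.center B : Set B) := by
      refine Subring.mem_center_iff.mpr fun g => ?_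
      obtain ⟨a, rfl⟩ := hsurj g
      obtain ⟨c, hc⟩ := hz a
      have h1 : π (z * a - a * z) = 0 := by rw [hc]; exact hπp _ _
      rw [map_sub, map_mul, map_mul, sub_eq_zero] at h1
      exact h1.symm
    rw [← hcen] at hc
    obtain ⟨s, hs⟩ := hc
    exact ⟨fun _ => z, fun _ => s, 0, fun _ => hs.symm, by simp⟩
  | succ i ih =>
    obtain ⟨u, s, y, hus, hzu⟩ := ih (by omega) (z := z) fun a => by
      obtain ⟨c, hc⟩ := hz a
      exact ⟨(p : A) * c, by rw [hc, ← mul_assoc, ← pow_succ]⟩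
    obtain ⟨v, hv⟩ := hpow s i fun t => by
      obtain ⟨b, hb⟩ := hsurj (algebraMap S B t)
      choose c hc hc' using fun j => hbr (u j) b (s j) t (hus j) hb
      choose d hd hd' using fun j =>
        exists_commutator_pow_pow hp hp2 hker (hus j) (hc j).symm (i - j)
      obtain ⟨e, he⟩ := hcomm hb y
      obtain ⟨f, hf⟩ := hz b
      have hsum : z * b - b * z = (p : A) ^ (i + 1) * ∑ j ∈ Finset.range (i + 1), d j -
          (p : A) ^ (i + 1) * ((p : A) * e) := by
        have h1 : (p : A) ^ (i + 1) * ∑ j ∈ Finset.range (i + 1), d j =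
            ∑ j ∈ Finset.range (i + 1),
              ((p : A) ^ j * u j ^ p ^ (i - j) * b - b * ((p : A) ^ j * u j ^ p ^ (i - j))) := by
          rw [Finset.mul_sum]
          refine Finset.sum_congr rfl fun j hj => ?_
          have hj' := Finset.mem_range.mp hj
          rw [hpc, hd, ← mul_assoc, ← pow_add]
          congr 2
          omega
        have h2 : (p : A) ^ (i + 1) * ((p : A) * e) =
            b * ((p : A) ^ (i + 1) * y) - (p : A) ^ (i + 1) * y * b := by
          rw [← he, ← neg_sub (y * b), mul_neg, ← hpc, neg_sub]
        rw [h1, h2, Finset.sum_sub_distrib, ← Finset.sum_mul, ← Finset.mul_sum, hzu, add_mul,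
          mul_add]
        abel
      have h3 : (p : A) ^ (i + 1) * ∑ j ∈ Finset.range (i + 1), d j =
          (p : A) ^ (i + 1 + 1) * (f + e) := by
        rw [mul_add, ← hf, hsum, pow_succ (p : A) (i + 1), mul_assoc, sub_add_cancel]
      have h4 := (hker _).mpr (exists_eq_mul_of_pow_mul_eq_pow_succ_mul htor hi h3)
      apply hinj
      rw [map_zero, ← h4, map_sum, map_sum]
      refine Finset.sum_congr rfl fun j _ => ?_
      rw [hd', hc', hus, ← map_pow, ← map_mul, mul_comm]
    obtain ⟨w, hw⟩ := hsurj (algebraMap S B v)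
    obtain ⟨z', hz'⟩ := (hker (z - w ^ p ^ (i + 1))).mp (by
      rw [hzu, Finset.sum_range_succ', map_sub, map_add, map_add, map_sum, hπp,
        Finset.sum_eq_zero fun j _ => hπp _ _, map_pow, hw, pow_zero, one_mul, map_pow, hus, hv,
        Nat.sub_zero, map_pow, ← pow_mul, ← pow_succ', zero_add, add_zero, sub_self])
    obtain ⟨u', s', y', hus', hzu'⟩ := ih (by omega) (z := z') fun a => by
      obtain ⟨c, hc⟩ := hz a
      obtain ⟨e, he⟩ := hcomm hw a
      obtain ⟨d, hd, -⟩ := exists_commutator_pow_pow hp hp2 hker hw he (i + 1)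
      refine exists_eq_pow_mul_of_mul_eq_pow_succ_mul htor hi (y := c - d) ?_
      have h1 := hpc 1 z' a
      rw [pow_one, ← hz'] at h1
      rw [← h1, mul_sub ((p : A) ^ _), ← hc, ← hd, sub_mul, mul_sub]
      abel
    refine ⟨fun j => Nat.casesOn j w u', fun j => Nat.casesOn j v s', y', ?_, ?_⟩
    · rintro (_ | j)
      · exact hw
      · exact hus' j
    · rw [Finset.sum_range_succ', ← sub_add_cancel z (w ^ p ^ (i + 1)), hz', hzu', mul_add,
        Finset.mul_sum]
      simp only [pow_zero, one_mul, Nat.sub_zero, Nat.add_sub_add_right, ← mul_assoc, ← pow_succ']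
      abel

theorem exists_pow_of_mem_center (hp : p.Prime) (hp2 : 2 < p) {π : A →+* B}
    (hinj : Function.Injective (algebraMap S B))
    (hcen : Set.range (algebraMap S B) = (Subring.center B : Set B))
    (hsurj : Function.Surjective π)
    (hker : ∀ a : A, π a = 0 ↔ ∃ b : A, a = (p : A) * b)
    (htor : ∀ a : A, (p : A) * a = 0 → ∃ b : A, a = (p : A) ^ (n - 1) * b)
    {br : S → S → S}
    (hbr : ∀ (a b : A) (s t : S), π a = algebraMap S B s → π b = algebraMap S B t →
      ∃ c : A, (p : A) * c = a * b - b * a ∧ π c = algebraMap S B (br s t))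
    (hpow : ∀ (s : ℕ → S) (r : ℕ),
      (∀ t, ∑ j ∈ Finset.range (r + 1), s j ^ (p ^ (r - j) - 1) * br (s j) t = 0) →
        ∃ v, s 0 = v ^ p)
    (hn : 0 < n) {z : A} (hz : z ∈ Subring.center A) :
    ∃ s : S, π z = algebraMap S B (s ^ p ^ (n - 1)) := by
  obtain ⟨u, s, y, hus, hzu⟩ := exists_eq_sum_of_commutator (n := n) (i := n - 1) hp hp2 hinj hcen
    hsurj hker htor hbr hpow (by omega) (z := z) fun a =>
      ⟨0, by rw [Subring.mem_center_iff.mp hz a, sub_self, mul_zero]⟩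
  have hπp : ∀ (j : ℕ) (x : A), π ((p : A) ^ (j + 1) * x) = 0 := fun j x =>
    (hker _).mpr ⟨(p : A) ^ j * x, by rw [pow_succ', mul_assoc]⟩
  refine ⟨s 0, ?_⟩
  rw [hzu, Finset.sum_range_succ', map_add, map_add, map_sum, hπp,
    Finset.sum_eq_zero fun j _ => hπp _ _, pow_zero, one_mul, map_pow, hus, Nat.sub_zero, map_pow,
    zero_add, add_zero]

end Center

/-- Let `A` be a deformation quantization over `W_n(k)` (`n ≥ 2`) of an Azumaya
algebra `A₁` over a smooth affine symplectic `k`-algebra `S = Z(A₁)`, with structural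
surjection `π : A → A₁` having kernel `pA`. Let `m` be an ideal of `S` with
`(m ∩ S^{p^{n−1}})·S ≠ m`, and let `I = π⁻¹(m·A₁)`. Then `I` is a two-sided ideal of `A`
which is strictly larger than the two-sided ideal generated by `I ∩ Z(A)`. -/
theorem stmt_8 (p : ℕ) [Fact p.Prime] (hp : 2 < p)
    (k : Type u) [Field k] [CharP k p] [ExpChar k p] [PerfectRing k p]
    (S : Type u) [CommRing S] [Algebra k S]
    (hfg : Algebra.FiniteType k S) [Algebra.FormallySmooth k S]
    (P : SymplecticPoisson k S)
    (A₁ : Type*) [Ring A₁] [Algebra k A₁] [Algebra S A₁] [IsScalarTower k S A₁]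
    (hinj : Function.Injective (algebraMap S A₁))
    (hcen : Set.range (algebraMap S A₁) = (Subring.center A₁ : Set A₁))
    (hAz : IsAzumayaOver S A₁)
    (n : ℕ) (hn : 0 < n)
    (A : Type*) [Ring A] [Algebra (TruncatedWittVector p n k) A]
    [Module.Flat (TruncatedWittVector p n k) A]
    (π : A →+* A₁) (hsurj : Function.Surjective π)
    (hker : ∀ a : A, π a = 0 ↔ ∃ b : A, a = (p : A) * b)
    (hcompat : ∀ w : TruncatedWittVector p n k,
      π (algebraMap (TruncatedWittVector p n k) A w) =
        algebraMap k A₁ (TruncatedWittVector.coeff ⟨0, hn⟩ w))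
    (hbr : ∀ (a b : A) (s t : S), π a = algebraMap S A₁ s → π b = algebraMap S A₁ t →
      ∃ c : A, (p : A) * c = a * b - b * a ∧ π c = algebraMap S A₁ (P.bracket s t))
    (hn2 : 2 ≤ n)
    (m : Ideal S)
    (hm : Ideal.span ((m : Set S) ∩ {x : S | ∃ s : S, x = s ^ p ^ (n - 1)}) ≠ m) :
    (∀ x ∈ Ideal.comap π (Ideal.span (algebraMap S A₁ '' (m : Set S))), ∀ a : A,
        x * a ∈ Ideal.comap π (Ideal.span (algebraMap S A₁ '' (m : Set S)))) ∧
      Ideal.span (((Ideal.comap π (Ideal.span (algebraMap S A₁ '' (m : Set S))) : Set A)) ∩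
          (Subring.center A : Set A)) <
        Ideal.comap π (Ideal.span (algebraMap S A₁ '' (m : Set S))) := by
  obtain ⟨_, _, _, _⟩ := hAz
  have hmul := fun x (hx : x ∈ Ideal.span (algebraMap S A₁ '' (m : Set S))) (a : A₁) =>
    Ideal.mul_mem_span_image_algebraMap hx a
  refine ⟨fun x hx a => ?_, lt_of_le_not_ge (Ideal.span_le.mpr Set.inter_subset_left) fun hle => ?_⟩
  · rw [Ideal.mem_comap, map_mul]
    exact hmul _ hx _
  have : Nontrivial S := by
    by_contra hS
    have : Subsingleton S := not_nontrivial_iff_subsingleton.mp hS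
    exact hm (Subsingleton.elim _ _)
  refine hm (le_antisymm (Ideal.span_le.mpr Set.inter_subset_left) fun s hs => ?_)
  refine Ideal.mem_span_of_algebraMap_mem_span_image (B := A₁) ?_
  obtain ⟨a, ha⟩ := hsurj (algebraMap S A₁ s)
  rw [← ha, ← Ideal.mem_comap]
  refine Ideal.span_le.mpr ?_ (hle (x := a) ?_)
  · rintro z ⟨hzI, hzc⟩
    obtain ⟨v, hv⟩ := exists_pow_of_mem_center (Fact.out : p.Prime) hp hinj hcen hsurj hker
      (fun a ha => TruncatedWittVector.exists_eq_pow_mul_of_flat (k := k) (n := n) ha) hbr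
      (fun s r => P.exists_eq_pow_of_sum_eq_zero s r) hn hzc
    rw [SetLike.mem_coe, Ideal.mem_comap, hv] at hzI ⊢
    have hvm := Ideal.mem_span_of_algebraMap_mem_span_image hzI
    rw [Ideal.span_eq] at hvm
    exact Ideal.subset_span ⟨_, ⟨hvm, v, rfl⟩, rfl⟩
  · rw [Ideal.mem_comap, ha]
    exact Ideal.subset_span ⟨s, hs, rfl⟩
end
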